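/- arXiv:2307.13304 — 4 statements merged into one kernel-verified Lean document; each statement's English description precedes it below -/
import Mathlib

section
/- Let H ∈ ℝ^{n×n} be positive semidefinite with LDL decomposition H = (Ù + I)D(Ù + I)^T, where Ù is strictly upper triangular and D is a nonnegative diagonal matrix. Then LDLQ achieves average proxy loss 𝓛_avg(LDLQ, H) = (m/c)·tr(D), where c = 12 if the entrywise quantizer Q is nearest rounding and c = 6 if Q is standard unbiased stochastic rounding, and for every adaptive rounding method 𝒜 with linear feedback whose strictly upper triangular feedback matrix U is a function of H only, 𝓛_avg(LDLQ, H) ≤ 𝓛_avg(𝒜, H). -/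
open MeasureTheory Matrix
open scoped ENNReal

namespace QuIP

noncomputable section

instance matMeasurableSpace {ι κ : Type*} : MeasurableSpace (Matrix ι κ ℝ) :=
  inferInstanceAs (MeasurableSpace (ι → κ → ℝ))

instance matMeasureSpace {m n : ℕ} : MeasureSpace (Matrix (Fin m) (Fin n) ℝ) :=
  inferInstanceAs (MeasureSpace (Fin m → Fin n → ℝ))

variable {m n : ℕ}

/-- `U` is strictly upper triangular. -/
def StrictUpper (U : Matrix (Fin n) (Fin n) ℝ) : Prop :=
  ∀ i j : Fin n, j ≤ i → U i j = 0

/-- The adaptive rounding proxy loss `tr((Ŵ - W) H (Ŵ - W)ᵀ)`. -/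
def proxyLoss (H : Matrix (Fin n) (Fin n) ℝ) (W What : Matrix (Fin m) (Fin n) ℝ) : ℝ :=
  Matrix.trace ((What - W) * H * (What - W)ᵀ)

/-- Worst-case (over `W`) expected proxy loss of a randomized rounding method. -/
def Lworst {Ω : Type*} [MeasurableSpace Ω] (μ : Measure Ω)
    (A : Matrix (Fin m) (Fin n) ℝ → Ω → Matrix (Fin m) (Fin n) ℝ)
    (H : Matrix (Fin n) (Fin n) ℝ) : ℝ≥0∞ :=
  ⨆ W : Matrix (Fin m) (Fin n) ℝ, ∫⁻ ω, ENNReal.ofReal (proxyLoss H W (A W ω)) ∂μ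

/-- The unit box `[0,1]^{m×n}`. -/
def unitBox (m n : ℕ) : Set (Matrix (Fin m) (Fin n) ℝ) :=
  {W | ∀ i j, W i j ∈ Set.Icc (0 : ℝ) 1}

/-- Average (over `W ~ Unif[0,1]^{m×n}`) expected proxy loss of a randomized
rounding method. -/
def Lavg {Ω : Type*} [MeasurableSpace Ω] (μ : Measure Ω)
    (A : Matrix (Fin m) (Fin n) ℝ → Ω → Matrix (Fin m) (Fin n) ℝ)
    (H : Matrix (Fin n) (Fin n) ℝ) : ℝ≥0∞ :=
  ∫⁻ W in unitBox m n, ∫⁻ ω, ENNReal.ofReal (proxyLoss H W (A W ω)) ∂(μ) ∂(volume)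

/-- The σ-algebra generated by the quantized columns strictly before column `k`. -/
def pastSigma {Ω : Type*} [MeasurableSpace Ω]
    (A : Ω → Matrix (Fin m) (Fin n) ℝ) (k : Fin n) : MeasurableSpace Ω :=
  MeasurableSpace.comap
    (fun ω => fun p : Fin m × {j : Fin n // j < k} => A ω p.1 p.2.1) inferInstance

/-- `A` is the adaptive rounding method with linear feedback `U` whose entrywise
quantizer is nearest rounding to the integers: `Ŵ = Q(W + (W - Ŵ)U)`. -/
def IsNearestMethod {Ω : Type*} [MeasurableSpace Ω] (μ : Measure Ω)
    (A : Matrix (Fin m) (Fin n) ℝ → Ω → Matrix (Fin m) (Fin n) ℝ)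
    (U : Matrix (Fin n) (Fin n) ℝ) : Prop :=
  ∀ W, (∀ i k, Measurable fun ω => A W ω i k) ∧
    ∀ᵐ ω ∂μ, ∀ i k, A W ω i k = ((round ((W + (W - A W ω) * U) i k) : ℤ) : ℝ)

/-- `A` is the adaptive rounding method with linear feedback `U` whose entrywise
quantizer is standard unbiased stochastic rounding to the integers:
`Ŵ = Q(W + (W - Ŵ)U)`, where each entry rounds up or down, and the quantization
error of each entry has conditional mean zero given the previously quantized
columns. -/
def IsStochMethod {Ω : Type*} [MeasurableSpace Ω] (μ : Measure Ω)
    (A : Matrix (Fin m) (Fin n) ℝ → Ω → Matrix (Fin m) (Fin n) ℝ)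
    (U : Matrix (Fin n) (Fin n) ℝ) : Prop :=
  ∀ W, (∀ i k, Measurable fun ω => A W ω i k) ∧
    (∀ i k, ∀ᵐ ω ∂μ,
      A W ω i k = ((⌊(W + (W - A W ω) * U) i k⌋ : ℤ) : ℝ) ∨
      A W ω i k = ((⌊(W + (W - A W ω) * U) i k⌋ : ℤ) : ℝ) + 1) ∧
    (∀ i k,
      μ[(fun ω => A W ω i k - (W + (W - A W ω) * U) i k) | pastSigma (A W) k]
        =ᵐ[μ] 0)

end

end QuIP

namespace QuIPAux

open QuIP MeasureTheory Matrix

/-- Uniform measure on the unit interval. -/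
noncomputable def nu : Measure ℝ := volume.restrict (Set.Icc (0 : ℝ) 1)

instance nu_prob : IsProbabilityMeasure nu := ⟨by simp [nu]⟩

/-- The pre-quantization value of coordinate `k`. -/
noncomputable def Zf {n : ℕ} (U : Matrix (Fin n) (Fin n) ℝ) (w x : Fin n → ℝ) (k : Fin n) : ℝ :=
  w k + ∑ j, (w j - x j) * U j k

noncomputable def trunc {n : ℕ} (k : ℕ) (x : Fin n → ℝ) : Fin n → ℝ :=
  fun j => if (j : ℕ) < k then x j else 0

noncomputable def clamp (t : ℝ) : ℝ := max (-1) (min 1 t)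

/-- One step of conditional expectation. -/
noncomputable def Rop {n : ℕ} (U : Matrix (Fin n) (Fin n) ℝ) (p : ℝ → ℝ) (k : Fin n)
    (φ : (Fin n → ℝ) → (Fin n → ℝ) → ℝ) (w x : Fin n → ℝ) : ℝ :=
  (1 - p (Zf U w x k)) * φ w (Function.update x k (⌊Zf U w x k⌋ : ℝ)) +
    p (Zf U w x k) * φ w (Function.update x k ((⌊Zf U w x k⌋ : ℝ) + 1))

structure Cls {n : ℕ} (l : Fin n) (c : ℝ) (φ : (Fin n → ℝ) → (Fin n → ℝ) → ℝ) : Prop where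
  meas : Measurable (Function.uncurry φ)
  bd : ∀ w x, |φ w x| ≤ 1
  avg : ∀ w x, ∫ t, φ (Function.update w l t) x ∂nu = c

structure GoodP (p : ℝ → ℝ) (c : ℝ) : Prop where
  meas : Measurable p
  nonneg : ∀ z, 0 ≤ p z
  le_one : ∀ z, p z ≤ 1
  first : ∀ a, ∫ t, (p (t + a) - Int.fract (t + a)) ∂nu = 0
  second : ∀ a, ∫ t, ((1 - p (t + a)) * Int.fract (t + a) ^ 2 +
    p (t + a) * (1 - Int.fract (t + a)) ^ 2) ∂nu = c

structure Meth {m n : ℕ} {Ω : Type} [MeasurableSpace Ω] (μ : Measure Ω)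
    (A : Matrix (Fin m) (Fin n) ℝ → Ω → Matrix (Fin m) (Fin n) ℝ)
    (U : Matrix (Fin n) (Fin n) ℝ) (p : ℝ → ℝ) : Prop where
  meas : ∀ W i k, Measurable fun ω => A W ω i k
  bd : ∀ W i k, ∀ᵐ ω ∂μ, |A W ω i k - Zf U (W i) (A W ω i) k| ≤ 1
  step : ∀ W i (k : Fin n) (φ : (Fin n → ℝ) → (Fin n → ℝ) → ℝ),
    Measurable (Function.uncurry φ) → (∀ w x, |φ w x| ≤ 1) →
    ∫ ω, φ (W i) (trunc (k + 1) (A W ω i)) ∂μ =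
      ∫ ω, Rop U p k φ (W i) (trunc k (A W ω i)) ∂μ

section basic
variable {n : ℕ} {U : Matrix (Fin n) (Fin n) ℝ}

lemma meas_update {α : Type*} [MeasurableSpace α] (k : Fin n) {x : α → Fin n → ℝ} {v : α → ℝ}
    (hx : Measurable x) (hv : Measurable v) :
    Measurable fun q => Function.update (x q) k (v q) := by
  refine measurable_pi_iff.2 fun j => ?_
  by_cases h : j = k
  · subst h; simpa using hv
  · simp only [Function.update_of_ne h]
    exact (measurable_pi_apply j).comp hx

lemma meas_Zf {α : Type*} [MeasurableSpace α] (k : Fin n) {w x : α → Fin n → ℝ}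
    (hw : Measurable w) (hx : Measurable x) : Measurable fun q => Zf U (w q) (x q) k := by
  unfold Zf
  have h1 : ∀ j, Measurable fun q => w q j := fun j => (measurable_pi_apply j).comp hw
  have h2 : ∀ j, Measurable fun q => x q j := fun j => (measurable_pi_apply j).comp hx
  fun_prop

lemma meas_floor {α : Type*} [MeasurableSpace α] {f : α → ℝ} (hf : Measurable f) :
    Measurable fun q => (⌊f q⌋ : ℝ) := (measurable_of_countable (fun z : ℤ => (z : ℝ))).comp hf.floor

lemma meas_trunc (k : ℕ) : Measurable (trunc (n := n) k) := by
  refine measurable_pi_iff.2 fun j => ?_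
  unfold trunc
  by_cases h : (j : ℕ) < k
  · simpa [h] using measurable_pi_apply j
  · simp [h]

lemma meas_Rop {α : Type*} [MeasurableSpace α] {p : ℝ → ℝ} (hp : Measurable p) (k : Fin n)
    {φ : (Fin n → ℝ) → (Fin n → ℝ) → ℝ} (hφ : Measurable (Function.uncurry φ))
    {w x : α → Fin n → ℝ} (hw : Measurable w) (hx : Measurable x) :
    Measurable fun q => Rop U p k φ (w q) (x q) := by
  have hz := meas_Zf (U := U) k hw hx
  have hpz := hp.comp hz
  have h0 : Measurable fun q => φ (w q) (Function.update (x q) k (⌊Zf U (w q) (x q) k⌋ : ℝ)) :=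
    hφ.comp (hw.prodMk (meas_update k hx (meas_floor hz)))
  have h1 : Measurable fun q => φ (w q) (Function.update (x q) k ((⌊Zf U (w q) (x q) k⌋ : ℝ) + 1)) :=
    hφ.comp (hw.prodMk (meas_update k hx ((meas_floor hz).add_const 1)))
  exact ((hpz.const_sub 1).mul h0).add (hpz.mul h1)

lemma Rop_bd {p : ℝ → ℝ} {c : ℝ} (hp : GoodP p c) (k : Fin n)
    {φ : (Fin n → ℝ) → (Fin n → ℝ) → ℝ} (hφ : ∀ w x, |φ w x| ≤ 1) (w x : Fin n → ℝ) :
    |Rop U p k φ w x| ≤ 1 := by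
  unfold Rop
  set z := Zf U w x k
  have h0 := hp.nonneg z
  have h1 := hp.le_one z
  have a := abs_le.1 (hφ w (Function.update x k (⌊z⌋ : ℝ)))
  have b := abs_le.1 (hφ w (Function.update x k ((⌊z⌋ : ℝ) + 1)))
  rw [abs_le]
  constructor <;> nlinarith

lemma Zf_update_w (hU : StrictUpper U) {k l : Fin n} (h : k < l) (w x : Fin n → ℝ) (t : ℝ) :
    Zf U (Function.update w l t) x k = Zf U w x k := by
  unfold Zf
  rw [Function.update_of_ne h.ne]
  congr 1
  refine Finset.sum_congr rfl fun j _ => ?_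
  by_cases hj : j = l
  · subst hj; rw [hU j k h.le]; simp
  · rw [Function.update_of_ne hj]

lemma Zf_update_self (hU : StrictUpper U) (l : Fin n) (w x : Fin n → ℝ) (t : ℝ) :
    Zf U (Function.update w l t) x l = t + ∑ j, (w j - x j) * U j l := by
  unfold Zf
  rw [Function.update_self]
  congr 1
  refine Finset.sum_congr rfl fun j _ => ?_
  by_cases hj : j = l
  · subst hj; rw [hU j j le_rfl]; simp
  · rw [Function.update_of_ne hj]

lemma Zf_update_x (hU : StrictUpper U) {k l : Fin n} (h : k ≤ l) (w x : Fin n → ℝ) (t : ℝ) :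
    Zf U w (Function.update x l t) k = Zf U w x k := by
  unfold Zf
  congr 1
  refine Finset.sum_congr rfl fun j _ => ?_
  by_cases hj : j = l
  · subst hj; rw [hU j k h]; simp
  · rw [Function.update_of_ne hj]

lemma Zf_trunc (hU : StrictUpper U) {k : Fin n} {l : ℕ} (h : (k : ℕ) ≤ l) (w x : Fin n → ℝ) :
    Zf U w (trunc l x) k = Zf U w x k := by
  unfold Zf
  congr 1
  refine Finset.sum_congr rfl fun j _ => ?_
  by_cases hj : (j : ℕ) < l
  · simp [trunc, hj]
  · rw [hU j k (by rw [Fin.le_def]; omega)]; simp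

lemma trunc_succ (k : Fin n) (x : Fin n → ℝ) :
    trunc (k + 1) x = Function.update (trunc k x) k (x k) := by
  funext j
  by_cases hj : j = k
  · subst hj; simp [trunc]
  · rw [Function.update_of_ne hj]
    have : (j : ℕ) ≠ k := fun h => hj (Fin.ext h)
    have e : (j : ℕ) < k + 1 ↔ (j : ℕ) < k := by omega
    simp [trunc, e]

lemma Cls_Rop (hU : StrictUpper U) {p : ℝ → ℝ} {c d : ℝ} (hp : GoodP p d) {k l : Fin n} (h : k < l)
    {φ : (Fin n → ℝ) → (Fin n → ℝ) → ℝ} (hφ : Cls l c φ) : Cls l c (Rop U p k φ) := by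
  refine ⟨meas_Rop hp.meas k hφ.meas measurable_fst measurable_snd, Rop_bd hp k hφ.bd, ?_⟩
  intro w x
  unfold Rop
  simp only [Zf_update_w hU h]
  have hi : ∀ y, Integrable (fun t => φ (Function.update w l t) y) nu := fun y =>
    Integrable.of_bound (hφ.meas.comp ((measurable_update w).prodMk
      measurable_const)).aestronglyMeasurable 1 (ae_of_all _ fun t => hφ.bd _ _)
  rw [integral_add ((hi _).const_mul _) ((hi _).const_mul _), integral_const_mul,
    integral_const_mul, hφ.avg, hφ.avg]
  ring

lemma exists_G {m : ℕ} (hU : StrictUpper U) {p : ℝ → ℝ} {c d : ℝ} (hp : GoodP p d)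
    {Ω : Type} [MeasurableSpace Ω] {μ : Measure Ω} [IsProbabilityMeasure μ]
    {A : Matrix (Fin m) (Fin n) ℝ → Ω → Matrix (Fin m) (Fin n) ℝ} (hA : Meth μ A U p)
    (l : Fin n) (k : ℕ) (hk : k ≤ l) (φ : (Fin n → ℝ) → (Fin n → ℝ) → ℝ) (hφ : Cls l c φ) :
    ∃ G : (Fin n → ℝ) → ℝ, Measurable G ∧ (∀ w, |G w| ≤ 1) ∧
      (∀ w, ∫ t, G (Function.update w l t) ∂nu = c) ∧
      ∀ W i, ∫ ω, φ (W i) (trunc k (A W ω i)) ∂μ = G (W i) := by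
  induction k generalizing φ with
  | zero =>
    refine ⟨fun w => φ w (fun _ => 0), hφ.meas.comp (measurable_id.prodMk measurable_const),
      fun w => hφ.bd _ _, fun w => hφ.avg _ _, fun W i => ?_⟩
    have : ∀ x : Fin n → ℝ, trunc 0 x = fun _ => 0 := fun x => by funext j; simp [trunc]
    simp [this]
  | succ k ih =>
    have hkl : k < (l : ℕ) := hk
    have hkn : k < n := hkl.trans l.2
    obtain ⟨G, h1, h2, h3, h4⟩ := ih hkl.le (Rop U p ⟨k, hkn⟩ φ)
      (Cls_Rop hU hp (show (⟨k, hkn⟩ : Fin n) < l from hkl) hφ)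
    exact ⟨G, h1, h2, h3, fun W i => (hA.step W i ⟨k, hkn⟩ φ hφ.meas hφ.bd).trans (h4 W i)⟩

lemma clamp_abs (t : ℝ) : |clamp t| ≤ 1 := by
  unfold clamp
  rw [abs_le]
  exact ⟨le_max_left _ _, max_le (by norm_num) (min_le_left _ _)⟩

lemma clamp_eq {t : ℝ} (h : |t| ≤ 1) : clamp t = t := by
  obtain ⟨a, b⟩ := abs_le.1 h
  unfold clamp
  rw [min_eq_right b, max_eq_right a]

lemma meas_clamp : Measurable clamp := by
  unfold clamp; fun_prop

/-- Product of clamped errors. -/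
noncomputable def phi (U : Matrix (Fin n) (Fin n) ℝ) (k l : Fin n) (w x : Fin n → ℝ) : ℝ :=
  clamp (x k - Zf U w x k) * clamp (x l - Zf U w x l)

lemma phi_bd (k l : Fin n) (w x : Fin n → ℝ) : |phi U k l w x| ≤ 1 := by
  unfold phi
  rw [abs_mul]
  exact mul_le_one₀ (clamp_abs _) (abs_nonneg _) (clamp_abs _)

lemma phi_meas (k l : Fin n) : Measurable (Function.uncurry (phi U k l)) := by
  have h : ∀ k : Fin n, Measurable fun q : (Fin n → ℝ) × (Fin n → ℝ) =>
      clamp (q.2 k - Zf U q.1 q.2 k) := fun k => meas_clamp.comp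
    (((measurable_pi_apply k).comp measurable_snd).sub (meas_Zf k measurable_fst measurable_snd))
  exact (h k).mul (h l)

lemma clamp_floor (z : ℝ) : clamp ((⌊z⌋ : ℝ) - z) = - Int.fract z := by
  have : (⌊z⌋ : ℝ) - z = - Int.fract z := by unfold Int.fract; ring
  rw [this]
  apply clamp_eq
  rw [abs_neg, abs_of_nonneg (Int.fract_nonneg z)]
  exact (Int.fract_lt_one z).le

lemma clamp_ceil (z : ℝ) : clamp ((⌊z⌋ : ℝ) + 1 - z) = 1 - Int.fract z := by
  have : (⌊z⌋ : ℝ) + 1 - z = 1 - Int.fract z := by unfold Int.fract; ring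
  rw [this]
  apply clamp_eq
  rw [abs_of_nonneg (by linarith [Int.fract_lt_one z])]
  linarith [Int.fract_nonneg z]

lemma Rop_phi_lt (hU : StrictUpper U) (p : ℝ → ℝ) {k l : Fin n} (h : k < l) (w x : Fin n → ℝ) :
    Rop U p l (phi U k l) w x =
      clamp (x k - Zf U w x k) * (p (Zf U w x l) - Int.fract (Zf U w x l)) := by
  unfold Rop phi
  simp only [Zf_update_x hU h.le, Zf_update_x hU le_rfl, Function.update_self,
    Function.update_of_ne h.ne, clamp_floor, clamp_ceil]
  ring

lemma Rop_phi_self (hU : StrictUpper U) (p : ℝ → ℝ) (l : Fin n) (w x : Fin n → ℝ) :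
    Rop U p l (phi U l l) w x =
      (1 - p (Zf U w x l)) * Int.fract (Zf U w x l) ^ 2 +
    p (Zf U w x l) * (1 - Int.fract (Zf U w x l)) ^ 2 := by
  unfold Rop phi
  simp only [Zf_update_x hU le_rfl, Function.update_self, clamp_floor, clamp_ceil]
  ring

lemma Cls_phi (hU : StrictUpper U) {p : ℝ → ℝ} {c : ℝ} (hp : GoodP p c) {k l : Fin n} (h : k ≤ l) :
    Cls l (if k = l then c else 0) (Rop U p l (phi U k l)) := by
  refine ⟨meas_Rop hp.meas l (phi_meas k l) measurable_fst measurable_snd,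
    Rop_bd hp l (phi_bd k l), ?_⟩
  intro w x
  rcases h.eq_or_lt with rfl | h
  · simp only [Rop_phi_self hU, Zf_update_self hU, hp.second, if_true]
  · simp only [Rop_phi_lt hU p h, Zf_update_self hU, Zf_update_w hU h, integral_const_mul,
      hp.first, h.ne, if_false, mul_zero]

lemma phi_trunc (hU : StrictUpper U) {k l : Fin n} (h : k ≤ l) (w x : Fin n → ℝ) :
    phi U k l w (trunc (l + 1) x) = phi U k l w x := by
  have h' : (k : ℕ) ≤ l := h
  have a : (k : ℕ) < l + 1 := by omega
  unfold phi
  rw [Zf_trunc hU (by omega), Zf_trunc hU (by omega)]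
  simp [trunc, a]

lemma exists_G_le {m : ℕ} (hU : StrictUpper U) {p : ℝ → ℝ} {c : ℝ} (hp : GoodP p c)
    {Ω : Type} [MeasurableSpace Ω] {μ : Measure Ω} [IsProbabilityMeasure μ]
    {A : Matrix (Fin m) (Fin n) ℝ → Ω → Matrix (Fin m) (Fin n) ℝ} (hA : Meth μ A U p)
    {k l : Fin n} (h : k ≤ l) :
    ∃ G : (Fin n → ℝ) → ℝ, Measurable G ∧ (∀ w, |G w| ≤ 1) ∧
      (∀ w, ∫ t, G (Function.update w l t) ∂nu = if k = l then c else 0) ∧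
      ∀ W i, ∫ ω, phi U k l (W i) (A W ω i) ∂μ = G (W i) := by
  obtain ⟨G, h1, h2, h3, h4⟩ := exists_G hU hp hA l l le_rfl _ (Cls_phi hU hp h)
  refine ⟨G, h1, h2, h3, fun W i => ?_⟩
  rw [← h4, ← hA.step W i l _ (phi_meas k l) (phi_bd k l)]
  simp only [phi_trunc hU h]

lemma mp_update (l : Fin n) : MeasurePreserving
    (fun q : (Fin n → ℝ) × ℝ => Function.update q.1 l q.2)
    ((Measure.pi fun _ : Fin n => nu).prod nu) (Measure.pi fun _ => nu) := by
  have hm : Measurable (fun q : (Fin n → ℝ) × ℝ => Function.update q.1 l q.2) :=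
    meas_update l measurable_fst measurable_snd
  refine ⟨hm, ?_⟩
  symm
  refine Measure.pi_eq fun s hs => ?_
  rw [Measure.map_apply hm (MeasurableSet.univ_pi hs)]
  have : (fun q : (Fin n → ℝ) × ℝ => Function.update q.1 l q.2) ⁻¹' (Set.univ.pi s) =
      (Set.univ.pi (Function.update s l Set.univ)) ×ˢ s l := by
    ext ⟨x, t⟩
    simp only [Set.mem_preimage, Set.mem_pi, Set.mem_univ, true_imp_iff, Set.mem_prod]
    constructor
    · intro h
      refine ⟨fun j => ?_, by simpa using h l⟩
      by_cases hj : j = l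
      · subst hj; simp
      · simpa [hj] using h j
    · rintro ⟨h, ht⟩ j
      by_cases hj : j = l
      · subst hj; simpa using ht
      · simpa [hj] using h j
  rw [this, Measure.prod_prod, Measure.pi_pi, ← Finset.prod_erase_mul _ _ (Finset.mem_univ l),
    ← Finset.prod_erase_mul (s := Finset.univ) (f := fun i => nu (s i)) (Finset.mem_univ l)]
  simp only [Function.update_self, measure_univ, mul_one]
  congr 1
  refine Finset.prod_congr rfl fun j hj => ?_
  rw [Function.update_of_ne (Finset.ne_of_mem_erase hj)]

lemma integral_avg (l : Fin n) {c : ℝ} {G : (Fin n → ℝ) → ℝ} (h1 : Measurable G)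
    (h2 : ∀ w, |G w| ≤ 1) (h3 : ∀ w, ∫ t, G (Function.update w l t) ∂nu = c) :
    ∫ w, G w ∂(Measure.pi fun _ => nu) = c := by
  rw [← (mp_update l).map_eq, integral_map (mp_update l).measurable.aemeasurable
    h1.aestronglyMeasurable, integral_prod]
  · simp [h3]
  · exact Integrable.of_bound (h1.comp (mp_update l).measurable).aestronglyMeasurable 1
      (ae_of_all _ fun t => h2 _)

lemma exists_G' {m : ℕ} (hU : StrictUpper U) {p : ℝ → ℝ} {c : ℝ} (hp : GoodP p c)
    {Ω : Type} [MeasurableSpace Ω] {μ : Measure Ω} [IsProbabilityMeasure μ]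
    {A : Matrix (Fin m) (Fin n) ℝ → Ω → Matrix (Fin m) (Fin n) ℝ} (hA : Meth μ A U p)
    (k l : Fin n) :
    ∃ G : (Fin n → ℝ) → ℝ, Measurable G ∧ (∀ w, |G w| ≤ 1) ∧
      (∫ w, G w ∂(Measure.pi fun _ => nu) = if k = l then c else 0) ∧
      ∀ W i, ∫ ω, phi U k l (W i) (A W ω i) ∂μ = G (W i) := by
  rcases le_total k l with h | h
  · obtain ⟨G, h1, h2, h3, h4⟩ := exists_G_le hU hp hA h
    exact ⟨G, h1, h2, integral_avg l h1 h2 h3, h4⟩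
  · obtain ⟨G, h1, h2, h3, h4⟩ := exists_G_le hU hp hA h
    refine ⟨G, h1, h2, ?_, fun W i => ?_⟩
    · rw [integral_avg k h1 h2 h3]; simp only [eq_comm]
    · rw [← h4]; simp only [phi, mul_comm]

end basic

section master
variable {m n : ℕ} {U : Matrix (Fin n) (Fin n) ℝ}

lemma box_measure : (volume : Measure (Matrix (Fin m) (Fin n) ℝ)).restrict (unitBox m n) =
    (Measure.pi fun _ : Fin m => Measure.pi fun _ : Fin n => nu) := by
  have h : unitBox m n =
      (Set.univ.pi fun _ : Fin m => Set.univ.pi fun _ : Fin n => Set.Icc (0 : ℝ) 1) := by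
    ext W; exact ⟨fun h i _ j _ => h i j, fun h i j => h i trivial j trivial⟩
  have h2 : (Measure.pi fun _ : Fin n => nu) =
      (volume : Measure (Fin n → ℝ)).restrict (Set.univ.pi fun _ : Fin n => Set.Icc (0 : ℝ) 1) := by
    rw [volume_pi, Measure.restrict_pi_pi]; rfl
  rw [h, h2, ← Measure.restrict_pi_pi]
  rfl

lemma Z_eq (W A : Matrix (Fin m) (Fin n) ℝ) (i : Fin m) (k : Fin n) :
    (W + (W - A) * U) i k = Zf U (W i) (A i) k := by
  simp [Zf, Matrix.mul_apply]

lemma proxy_eq {H M : Matrix (Fin n) (Fin n) ℝ} (hM : H = (U + 1) * M * (U + 1)ᵀ)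
    (W A : Matrix (Fin m) (Fin n) ℝ) :
    proxyLoss H W A = ∑ i, ∑ k, ∑ l, M k l *
      ((A i k - Zf U (W i) (A i) k) * (A i l - Zf U (W i) (A i) l)) := by
  have h : ∀ i k, A i k - Zf U (W i) (A i) k = ((A - W) * (U + 1) : Matrix (Fin m) (Fin n) ℝ) i k := by
    intro i k
    rw [← Z_eq, Matrix.mul_add, Matrix.mul_one, ← neg_sub A W, Matrix.neg_mul]
    simp only [Matrix.add_apply, Matrix.neg_apply, Matrix.sub_apply]
    ring
  simp only [h]
  unfold proxyLoss
  rw [hM]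
  set E := (A - W) * (U + 1)
  have : (A - W) * ((U + 1) * M * (U + 1)ᵀ) * (A - W)ᵀ = E * M * Eᵀ := by
    simp only [E, Matrix.transpose_mul, Matrix.mul_assoc]
  rw [this, Matrix.trace]
  refine Finset.sum_congr rfl fun i _ => ?_
  rw [Matrix.diag_apply, Matrix.mul_apply, Finset.sum_comm]
  refine Finset.sum_congr rfl fun l _ => ?_
  rw [Matrix.mul_apply, Finset.sum_mul]
  refine Finset.sum_congr rfl fun k _ => ?_
  rw [Matrix.transpose_apply]
  ring

lemma proxy_nonneg {H : Matrix (Fin n) (Fin n) ℝ} (hH : H.PosSemidef)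
    (W A : Matrix (Fin m) (Fin n) ℝ) : 0 ≤ proxyLoss H W A := by
  have := (hH.mul_mul_conjTranspose_same (A - W)).trace_nonneg
  simpa [proxyLoss, Matrix.conjTranspose_eq_transpose_of_trivial] using this

lemma int_sum3 {Ω : Type*} [MeasurableSpace Ω] {μ : Measure Ω} (a : Fin n → Fin n → ℝ)
    (f : Fin m → Fin n → Fin n → Ω → ℝ) (hf : ∀ i k l, Integrable (f i k l) μ) :
    Integrable (fun ω => ∑ i, ∑ k, ∑ l, a k l * f i k l ω) μ ∧
    ∫ ω, ∑ i, ∑ k, ∑ l, a k l * f i k l ω ∂μ = ∑ i, ∑ k, ∑ l, a k l * ∫ ω, f i k l ω ∂μ := by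
  have h1 : ∀ i k l, Integrable (fun ω => a k l * f i k l ω) μ := fun i k l =>
    (hf i k l).const_mul _
  have h2 : ∀ i k, Integrable (fun ω => ∑ l, a k l * f i k l ω) μ := fun i k =>
    integrable_finsetSum _ fun l _ => h1 i k l
  have h3 : ∀ i, Integrable (fun ω => ∑ k, ∑ l, a k l * f i k l ω) μ := fun i =>
    integrable_finsetSum _ fun k _ => h2 i k
  refine ⟨integrable_finsetSum _ fun i _ => h3 i, ?_⟩
  rw [integral_finsetSum _ fun i _ => h3 i]
  refine Finset.sum_congr rfl fun i _ => ?_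
  rw [integral_finsetSum _ fun k _ => h2 i k]
  refine Finset.sum_congr rfl fun k _ => ?_
  rw [integral_finsetSum _ fun l _ => h1 i k l]
  refine Finset.sum_congr rfl fun l _ => ?_
  rw [integral_const_mul]

lemma Lavg_eq {H M : Matrix (Fin n) (Fin n) ℝ} (hH : H.PosSemidef) (hU : StrictUpper U)
    {p : ℝ → ℝ} {c : ℝ} (hp : GoodP p c)
    {Ω : Type} [MeasurableSpace Ω] {μ : Measure Ω} [IsProbabilityMeasure μ]
    {A : Matrix (Fin m) (Fin n) ℝ → Ω → Matrix (Fin m) (Fin n) ℝ} (hA : Meth μ A U p)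
    (hM : H = (U + 1) * M * (U + 1)ᵀ) :
    Lavg μ A H = ENNReal.ofReal (m * c * M.trace) := by
  choose G h1 h2 h3 h4 using exists_G' hU hp hA
  set F : Matrix (Fin m) (Fin n) ℝ → ℝ := fun W => ∑ i, ∑ k, ∑ l, M k l * G k l (W i) with hF
  have hAm : ∀ W i, Measurable fun ω => A W ω i := fun W i =>
    measurable_pi_iff.2 fun k => hA.meas W i k
  have hphi : ∀ W i k l, Integrable (fun ω => phi U k l (W i) (A W ω i)) μ := fun W i k l =>
    Integrable.of_bound ((phi_meas k l).comp (measurable_const.prodMk (hAm W i))).aestronglyMeasurable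
      1 (ae_of_all _ fun _ => phi_bd _ _ _ _)
  have hae : ∀ W, (fun ω => proxyLoss H W (A W ω)) =ᵐ[μ]
      fun ω => ∑ i, ∑ k, ∑ l, M k l * phi U k l (W i) (A W ω i) := by
    intro W
    have : ∀ᵐ ω ∂μ, ∀ i k, |A W ω i k - Zf U (W i) (A W ω i) k| ≤ 1 :=
      ae_all_iff.2 fun i => ae_all_iff.2 fun k => hA.bd W i k
    filter_upwards [this] with ω hω
    rw [proxy_eq hM]
    simp only [phi, clamp_eq (hω _ _)]
  have hint : ∀ W, Integrable (fun ω => ∑ i, ∑ k, ∑ l, M k l * phi U k l (W i) (A W ω i)) μ :=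
    fun W => (int_sum3 (fun k l => M k l) (fun i k l ω => phi U k l (W i) (A W ω i)) (hphi W)).1
  have hFW : ∀ W, ∫ ω, proxyLoss H W (A W ω) ∂μ = F W := by
    intro W
    refine (integral_congr_ae (hae W)).trans ((int_sum3 (fun k l => M k l)
      (fun i k l ω => phi U k l (W i) (A W ω i)) (hphi W)).2.trans ?_)
    simp only [h4]
    rfl
  have hinner : ∀ W, ∫⁻ ω, ENNReal.ofReal (proxyLoss H W (A W ω)) ∂μ = ENNReal.ofReal (F W) := by
    intro W
    rw [← hFW, ofReal_integral_eq_lintegral_ofReal ((hint W).congr (hae W).symm)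
      (ae_of_all _ fun ω => proxy_nonneg hH _ _)]
  have hF0 : ∀ W, 0 ≤ F W := fun W => by
    rw [← hFW]; exact integral_nonneg fun ω => proxy_nonneg hH _ _
  have hGi : ∀ i k l, Integrable (fun W : Fin m → Fin n → ℝ => G k l (W i))
      (Measure.pi fun _ : Fin m => Measure.pi fun _ : Fin n => nu) := fun i k l =>
    Integrable.of_bound ((h1 k l).comp (measurable_pi_apply i)).aestronglyMeasurable 1
      (ae_of_all _ fun _ => h2 _ _ _)
  have hGI : ∀ i k l, ∫ W : Fin m → Fin n → ℝ, G k l (W i)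
      ∂(Measure.pi fun _ : Fin m => Measure.pi fun _ : Fin n => nu) = if k = l then c else 0 := by
    intro i k l
    have e := measurePreserving_eval (fun _ : Fin m => Measure.pi fun _ : Fin n => nu) i
    have e2 := integral_map (f := G k l)
      (μ := Measure.pi fun _ : Fin m => Measure.pi fun _ : Fin n => nu) e.measurable.aemeasurable
      (h1 k l).aestronglyMeasurable
    rw [e.map_eq, h3] at e2
    exact e2.symm
  unfold Lavg
  simp only [hinner]
  rw [box_measure]
  change ∫⁻ W : Fin m → Fin n → ℝ, ENNReal.ofReal (F W)
    ∂(Measure.pi fun _ : Fin m => Measure.pi fun _ : Fin n => nu) = _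
  have key := int_sum3 (fun k l => M k l)
    (fun i k l (W : Fin m → Fin n → ℝ) => G k l (W i)) hGi
  rw [← ofReal_integral_eq_lintegral_ofReal key.1 (ae_of_all _ fun W => hF0 W)]
  congr 1
  refine key.2.trans ?_
  simp only [hGI, mul_ite, mul_zero, Finset.sum_ite_eq, Finset.mem_univ, if_true, Finset.sum_const,
    Finset.card_univ, Fintype.card_fin, nsmul_eq_mul, Matrix.trace, Matrix.diag_apply]
  rw [← Finset.sum_mul]
  ring

lemma exists_M {H V D : Matrix (Fin n) (Fin n) ℝ} (hV : StrictUpper V) (hU : StrictUpper U)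
    (hDdiag : ∀ i j, i ≠ j → D i j = 0) (hDnonneg : ∀ i, 0 ≤ D i i)
    (hLDL : H = (V + 1) * D * (V + 1)ᵀ) :
    ∃ M, H = (U + 1) * M * (U + 1)ᵀ ∧ D.trace ≤ M.trace := by
  have tri : ∀ {X : Matrix (Fin n) (Fin n) ℝ}, StrictUpper X → (X + 1).BlockTriangular id := by
    intro X hX i j hij
    have hij' : j < i := hij
    simp [hX i j hij'.le, Matrix.one_apply_ne hij'.ne']
  have diag : ∀ {X : Matrix (Fin n) (Fin n) ℝ}, StrictUpper X → ∀ i, (X + 1) i i = 1 := by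
    intro X hX i
    simp [hX i i le_rfl]
  have hdet : (U + 1).det = 1 := by
    rw [Matrix.det_of_isUpperTriangular (tri hU)]
    simp [diag hU]
  have hunit : IsUnit (U + 1).det := by rw [hdet]; exact isUnit_one
  haveI := Matrix.invertibleOfIsUnitDet _ hunit
  set B := (U + 1)⁻¹ * (V + 1) with hB
  have hUB : (U + 1) * B = V + 1 := by
    rw [hB, ← Matrix.mul_assoc, Matrix.mul_nonsing_inv _ hunit, Matrix.one_mul]
  have hBt : B.BlockTriangular id :=
    (Matrix.blockTriangular_inv_of_blockTriangular (tri hU)).mul (tri hV)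
  have hBd : ∀ k, B k k = 1 := by
    intro k
    have h := congrFun (congrFun hUB k) k
    rw [diag hV, Matrix.mul_apply, Finset.sum_eq_single k, diag hU, one_mul] at h
    · exact h
    · intro j _ hj
      rcases lt_or_gt_of_ne hj with h' | h'
      · rw [tri hU (show id j < id k from h'), zero_mul]
      · rw [hBt (show id k < id j from h'), mul_zero]
    · simp
  refine ⟨B * D * Bᵀ, ?_, ?_⟩
  · rw [hLDL, ← hUB, Matrix.transpose_mul]
    simp only [Matrix.mul_assoc]
  · have h : ∀ j k, (B * D) j k = B j k * D k k := by
      intro j k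
      rw [Matrix.mul_apply, Finset.sum_eq_single k]
      · intro l _ hl; rw [hDdiag l k hl, mul_zero]
      · simp
    simp only [Matrix.trace, Matrix.diag_apply]
    refine Finset.sum_le_sum fun k _ => ?_
    rw [Matrix.mul_apply]
    have := Finset.single_le_sum (f := fun l => (B * D) k l * Bᵀ l k) (fun l _ => by
      simp only [h, Matrix.transpose_apply]
      nlinarith [mul_nonneg (hDnonneg l) (mul_self_nonneg (B k l))]) (Finset.mem_univ k)
    refine le_trans (le_of_eq ?_) this
    simp [h, hBd]

end master

section quantizers

lemma shift_int {g : ℝ → ℝ} (hg : Function.Periodic g 1) (a b : ℝ) :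
    ∫ t, g (t + a) ∂nu = ∫ t in b..(b + 1), g t := by
  unfold nu
  rw [integral_Icc_eq_integral_Ioc, ← intervalIntegral.integral_of_le zero_le_one,
    intervalIntegral.integral_comp_add_right]
  rw [zero_add, add_comm 1 a]
  exact hg.intervalIntegral_add_eq a b

lemma goodP_fract : GoodP Int.fract (1 / 6) := by
  refine ⟨measurable_fract, Int.fract_nonneg, fun z => (Int.fract_lt_one z).le, by simp, fun a => ?_⟩
  have hper : Function.Periodic (fun t : ℝ => (1 - Int.fract t) * Int.fract t ^ 2 +
    Int.fract t * (1 - Int.fract t) ^ 2) 1 := fun t => by simp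
  rw [shift_int hper a 0]
  have : ∫ t in (0 : ℝ)..(0 + 1), ((1 - Int.fract t) * Int.fract t ^ 2 +
    Int.fract t * (1 - Int.fract t) ^ 2) = ∫ t in (0 : ℝ)..(0 + 1), (t - t ^ 2) := by
    apply intervalIntegral.integral_congr_ae
    have h1 : ∀ᵐ t : ℝ, t ≠ 1 := by simp [ae_iff]
    filter_upwards [h1] with t ht1 ht
    rw [Set.uIoc_of_le (by norm_num)] at ht
    have : t < 1 := lt_of_le_of_ne (by linarith [ht.2]) ht1
    rw [Int.fract_eq_self.2 ⟨ht.1.le, this⟩]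
    ring
  rw [this, intervalIntegral.integral_sub (by simp) (by simp)]
  norm_num

noncomputable def pr (z : ℝ) : ℝ := (round z : ℝ) - ⌊z⌋

lemma pr_cases (z : ℝ) : (pr z = 0 ∧ round z = ⌊z⌋) ∨ (pr z = 1 ∧ round z = ⌊z⌋ + 1) := by
  have h1 : ⌊z⌋ ≤ round z := by
    rw [round_eq]; exact Int.floor_mono (by linarith)
  have h2 : round z ≤ ⌊z⌋ + 1 := by
    rw [round_eq, ← Int.floor_add_one]; exact Int.floor_mono (by linarith)
  have : round z = ⌊z⌋ ∨ round z = ⌊z⌋ + 1 := by omega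
  rcases this with h | h
  · left; exact ⟨by simp [pr, h], h⟩
  · right; exact ⟨by simp [pr, h], h⟩

lemma goodP_pr : GoodP pr (1 / 12) := by
  have e1 : ∀ t : ℝ, pr t - Int.fract t = (round t : ℝ) - t := fun t => by
    simp only [pr, Int.fract]; ring
  have e2 : ∀ t : ℝ, (1 - pr t) * Int.fract t ^ 2 + pr t * (1 - Int.fract t) ^ 2 =
      ((round t : ℝ) - t) ^ 2 := fun t => by
    rcases pr_cases t with ⟨h, h'⟩ | ⟨h, h'⟩
    · rw [h, h']; simp only [Int.fract]; ring
    · rw [h, h']; simp only [Int.fract]; push_cast; ring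
  have hper : Function.Periodic (fun t : ℝ => (round t : ℝ) - t) 1 := fun t => by
    simp [round_add_one]
  have hper2 : Function.Periodic (fun t : ℝ => ((round t : ℝ) - t) ^ 2) 1 := fun t => by
    simp [round_add_one]
  have hae : ∀ᵐ t : ℝ, t ∈ Set.uIoc (-(1 / 2) : ℝ) (-(1 / 2) + 1) → round t = 0 := by
    have h1 : ∀ᵐ t : ℝ, t ≠ 1 / 2 := by simp [ae_iff]
    filter_upwards [h1] with t ht1 ht
    rw [Set.uIoc_of_le (by norm_num)] at ht
    have : t < 1 / 2 := lt_of_le_of_ne (by linarith [ht.2]) ht1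
    rw [round_eq, Int.floor_eq_zero_iff]
    exact ⟨by linarith [ht.1], by linarith⟩
  refine ⟨?_, fun z => ?_, fun z => ?_, fun a => ?_, fun a => ?_⟩
  · unfold pr
    simp only [round_eq]
    exact (meas_floor (measurable_id.add_const _)).sub (meas_floor measurable_id)
  · rcases pr_cases z with ⟨h, _⟩ | ⟨h, _⟩ <;> rw [h] <;> norm_num
  · rcases pr_cases z with ⟨h, _⟩ | ⟨h, _⟩ <;> rw [h] <;> norm_num
  · simp only [e1]
    rw [shift_int hper a (-(1 / 2))]
    have : ∫ t in (-(1 / 2) : ℝ)..(-(1 / 2) + 1), ((round t : ℝ) - t) =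
        ∫ t in (-(1 / 2) : ℝ)..(-(1 / 2) + 1), (- t) := by
      apply intervalIntegral.integral_congr_ae
      filter_upwards [hae] with t h ht
      rw [h ht]; simp
    rw [this, intervalIntegral.integral_neg, integral_id]
    norm_num
  · simp only [e2]
    rw [shift_int hper2 a (-(1 / 2))]
    have : ∫ t in (-(1 / 2) : ℝ)..(-(1 / 2) + 1), ((round t : ℝ) - t) ^ 2 =
        ∫ t in (-(1 / 2) : ℝ)..(-(1 / 2) + 1), t ^ 2 := by
      apply intervalIntegral.integral_congr_ae
      filter_upwards [hae] with t h ht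
      rw [h ht]; simp
    rw [this, integral_pow]
    norm_num

variable {m n : ℕ} {U : Matrix (Fin n) (Fin n) ℝ} {Ω : Type} [MeasurableSpace Ω] {μ : Measure Ω}
    [IsProbabilityMeasure μ] {A : Matrix (Fin m) (Fin n) ℝ → Ω → Matrix (Fin m) (Fin n) ℝ}

lemma meth_nearest (hU : StrictUpper U) (hA : IsNearestMethod μ A U) : Meth μ A U pr := by
  have key : ∀ W, ∀ᵐ ω ∂μ, ∀ i k, A W ω i k = (round (Zf U (W i) (A W ω i) k) : ℝ) := by
    intro W
    filter_upwards [(hA W).2] with ω h i k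
    rw [h i k, Z_eq]
  refine ⟨fun W => (hA W).1, fun W i k => ?_, fun W i k φ hφ hb => ?_⟩
  · filter_upwards [key W] with ω h
    have h1 := abs_sub_round (Zf U (W i) (A W ω i) k)
    rw [← h i k, abs_sub_comm] at h1
    linarith
  · apply integral_congr_ae
    filter_upwards [key W] with ω h
    simp only [Rop, Zf_trunc hU le_rfl, trunc_succ]
    have hk := h i k
    generalize Zf U (W i) (A W ω i) k = z at *
    rcases pr_cases z with ⟨a, b⟩ | ⟨a, b⟩
    · rw [b] at hk; rw [a, hk]; simp
    · rw [b] at hk; push_cast at hk; rw [a, hk]; simp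

lemma meth_stoch (hU : StrictUpper U) (hA : IsStochMethod μ A U) : Meth μ A U Int.fract := by
  have hbd : ∀ W i k, ∀ᵐ ω ∂μ, |A W ω i k - Zf U (W i) (A W ω i) k| ≤ 1 := by
    intro W i k
    filter_upwards [(hA W).2.1 i k] with ω h
    rw [Z_eq] at h
    have h1 := Int.floor_le (Zf U (W i) (A W ω i) k)
    have h2 := Int.lt_floor_add_one (Zf U (W i) (A W ω i) k)
    rw [abs_le]
    rcases h with h | h <;> rw [h] at * <;> constructor <;> linarith
  refine ⟨fun W => (hA W).1, hbd, fun W i k φ hφ hb => ?_⟩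
  have hmA : ∀ i, Measurable fun ω => A W ω i := fun i =>
    measurable_pi_iff.2 fun k => (hA W).1 i k
  have hle : pastSigma (A W) k ≤ ‹MeasurableSpace Ω› := by
    apply Measurable.comap_le
    exact measurable_pi_iff.2 fun q => (hA W).1 _ _
  -- the truncated row is past-measurable
  have htr : Measurable[pastSigma (A W) k] fun ω => trunc k (A W ω i) := by
    have hT : Measurable fun (f : Fin m × {j : Fin n // j < k} → ℝ) (j : Fin n) =>
        if h : j < k then f (i, ⟨j, h⟩) else 0 := by
      refine measurable_pi_iff.2 fun j => ?_
      by_cases h : j < k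
      · simpa [h] using measurable_pi_apply _
      · simp [h]
    have := hT.comp (comap_measurable
      (fun ω => fun p : Fin m × {j : Fin n // j < k} => A W ω p.1 p.2.1))
    exact this
  set η : Ω → ℝ := fun ω => A W ω i k - Zf U (W i) (A W ω i) k with hη
  have hηm : Measurable η := ((hA W).1 i k).sub (meas_Zf k measurable_const (hmA i))
  have hηi : Integrable η μ := Integrable.of_bound hηm.aestronglyMeasurable 1 (hbd W i k)
  have hce : μ[η | pastSigma (A W) k] =ᵐ[μ] 0 := by
    have := (hA W).2.2 i k
    simpa only [Z_eq] using this
  set ψ : (Fin n → ℝ) → ℝ := fun x =>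
    φ (W i) (Function.update x k ((⌊Zf U (W i) x k⌋ : ℝ) + 1)) -
      φ (W i) (Function.update x k (⌊Zf U (W i) x k⌋ : ℝ)) with hψ
  have hψm : Measurable ψ := by
    have hz := meas_Zf (U := U) k (measurable_const (a := W i)) (measurable_id (α := Fin n → ℝ))
    exact (hφ.comp (measurable_const.prodMk (meas_update k measurable_id
      ((meas_floor hz).add_const 1)))).sub
      (hφ.comp (measurable_const.prodMk (meas_update k measurable_id (meas_floor hz))))
  have hψb : ∀ x, |ψ x| ≤ 2 := fun x => by
    refine (abs_sub _ _).trans ?_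
    linarith [hb (W i) (Function.update x k ((⌊Zf U (W i) x k⌋ : ℝ) + 1)),
      hb (W i) (Function.update x k (⌊Zf U (W i) x k⌋ : ℝ))]
  have hψp : StronglyMeasurable[pastSigma (A W) k] fun ω => ψ (trunc k (A W ω i)) :=
    (hψm.comp htr).stronglyMeasurable
  have hprodi : Integrable (fun ω => ψ (trunc k (A W ω i)) * η ω) μ :=
    hηi.bdd_mul (c := 2) (hψm.comp (htr.mono hle le_rfl)).aestronglyMeasurable
      (ae_of_all _ fun ω => hψb _)
  have hzero : ∫ ω, ψ (trunc k (A W ω i)) * η ω ∂μ = 0 := by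
    rw [← integral_condExp hle]
    have h := condExp_mul_of_stronglyMeasurable_left hψp hprodi hηi
    rw [integral_congr_ae (g := fun _ => (0 : ℝ))]
    · simp
    · filter_upwards [h, hce] with ω h1 h2
      change (μ[(fun ω => ψ (trunc k (A W ω i))) * η | pastSigma (A W) k]) ω = 0
      rw [h1]; simp [h2]
  have hRi : Integrable (fun ω => Rop U Int.fract k φ (W i) (trunc k (A W ω i))) μ :=
    Integrable.of_bound (meas_Rop measurable_fract k hφ measurable_const
      ((meas_trunc k).comp (hmA i))).aestronglyMeasurable 1
      (ae_of_all _ fun ω => Rop_bd goodP_fract k hb _ _)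
  have : (fun ω => φ (W i) (trunc (k + 1) (A W ω i))) =ᵐ[μ] fun ω =>
      Rop U Int.fract k φ (W i) (trunc k (A W ω i)) + ψ (trunc k (A W ω i)) * η ω := by
    filter_upwards [(hA W).2.1 i k] with ω h
    rw [Z_eq] at h
    simp only [Rop, hψ, hη, Zf_trunc hU le_rfl, trunc_succ]
    generalize Zf U (W i) (A W ω i) k = z at *
    rcases h with h | h <;> rw [h] <;> simp only [Int.fract] <;> ring
  rw [integral_congr_ae this, integral_add hRi hprodi, hzero, add_zero]

end quantizers

lemma main_aux {m n : ℕ}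
    {H V D : Matrix (Fin n) (Fin n) ℝ}
    (hH : H.PosSemidef)
    (hV : StrictUpper V)
    (hDdiag : ∀ i j, i ≠ j → D i j = 0) (hDnonneg : ∀ i, 0 ≤ D i i)
    (hLDL : H = (V + 1) * D * (V + 1)ᵀ) {p : ℝ → ℝ} {c : ℝ} (hc : 0 ≤ c) (hp : GoodP p c)
    {Ω : Type} [MeasurableSpace Ω] {μ : Measure Ω} [IsProbabilityMeasure μ]
    {L : Matrix (Fin m) (Fin n) ℝ → Ω → Matrix (Fin m) (Fin n) ℝ} (hL : Meth μ L V p)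
    {Ω' : Type} [MeasurableSpace Ω'] {μ' : Measure Ω'} [IsProbabilityMeasure μ']
    {A : Matrix (Fin m) (Fin n) ℝ → Ω' → Matrix (Fin m) (Fin n) ℝ}
    {U : Matrix (Fin n) (Fin n) ℝ} (hU : StrictUpper U) (hA : Meth μ' A U p) :
    Lavg μ L H ≤ Lavg μ' A H := by
  obtain ⟨M, hM, hle⟩ := exists_M hV hU hDdiag hDnonneg hLDL
  rw [Lavg_eq hH hV hp hL hLDL, Lavg_eq hH hU hp hA hM]
  exact ENNReal.ofReal_le_ofReal (mul_le_mul_of_nonneg_left hle (by positivity))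

end QuIPAux

open QuIP MeasureTheory Matrix

/-- Let `H` be positive semidefinite with LDL decomposition
`H = (Ù + I) D (Ù + I)ᵀ` (`Ù` strictly upper triangular, `D` nonnegative diagonal).
Then any realization of LDLQ achieves average proxy loss `(m/c) · tr D`, with
`c = 12` when the entrywise quantizer is nearest rounding and `c = 6` when it is
standard unbiased stochastic rounding, and (for either quantizer) its average
proxy loss is at most that of any adaptive rounding method with linear feedback
(with the same quantizer) whose strictly upper triangular feedback matrix is a
function of `H` only. -/
theorem ldlq_average_case_optimal {m n : ℕ}
    (H Ugrave D : Matrix (Fin n) (Fin n) ℝ)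
    (hH : H.PosSemidef)
    (hUgrave : StrictUpper Ugrave)
    (hDdiag : ∀ i j, i ≠ j → D i j = 0) (hDnonneg : ∀ i, 0 ≤ D i i)
    (hLDL : H = (Ugrave + 1) * D * (Ugrave + 1)ᵀ)
    {Ω : Type} [MeasurableSpace Ω] (μ : Measure Ω) [IsProbabilityMeasure μ]
    (LDLQ : Matrix (Fin m) (Fin n) ℝ → Ω → Matrix (Fin m) (Fin n) ℝ) :
    (IsNearestMethod μ LDLQ Ugrave →
      Lavg μ LDLQ H = ENNReal.ofReal ((m : ℝ) / 12 * D.trace) ∧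
      ∀ (Ω' : Type) [MeasurableSpace Ω'] (μ' : Measure Ω') [IsProbabilityMeasure μ']
        (A : Matrix (Fin m) (Fin n) ℝ → Ω' → Matrix (Fin m) (Fin n) ℝ)
        (U : Matrix (Fin n) (Fin n) ℝ), StrictUpper U →
        IsNearestMethod μ' A U →
        Lavg μ LDLQ H ≤ Lavg μ' A H) ∧
    (IsStochMethod μ LDLQ Ugrave →
      Lavg μ LDLQ H = ENNReal.ofReal ((m : ℝ) / 6 * D.trace) ∧
      ∀ (Ω' : Type) [MeasurableSpace Ω'] (μ' : Measure Ω') [IsProbabilityMeasure μ']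
        (A : Matrix (Fin m) (Fin n) ℝ → Ω' → Matrix (Fin m) (Fin n) ℝ)
        (U : Matrix (Fin n) (Fin n) ℝ), StrictUpper U →
        IsStochMethod μ' A U →
        Lavg μ LDLQ H ≤ Lavg μ' A H) := by
  refine ⟨fun h => ?_, fun h => ?_⟩
  · have hL := QuIPAux.meth_nearest hUgrave h
    refine ⟨?_, fun Ω' _ μ' _ A U hU hA => QuIPAux.main_aux hH hUgrave hDdiag hDnonneg hLDL (by norm_num)
      QuIPAux.goodP_pr hL hU (QuIPAux.meth_nearest hU hA)⟩
    rw [QuIPAux.Lavg_eq hH hUgrave QuIPAux.goodP_pr hL hLDL]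
    congr 1; ring
  · have hL := QuIPAux.meth_stoch hUgrave h
    refine ⟨?_, fun Ω' _ μ' _ A U hU hA => QuIPAux.main_aux hH hUgrave hDdiag hDnonneg hLDL (by norm_num)
      QuIPAux.goodP_fract hL hU (QuIPAux.meth_stoch hU hA)⟩
    rw [QuIPAux.Lavg_eq hH hUgrave QuIPAux.goodP_fract hL hLDL]
    congr 1; ring
end

section
/- For any positive semidefinite H ∈ ℝ^{n×n}, taking the supremum over all positive semidefinite H̃ with the same eigenvalues (with multiplicity) as H: sup_{H̃ : eig(H̃) = eig(H)} 𝓛_worst(LDLQ, H̃) = (m/4)·tr(H), which equals 𝓛_worst(Stoch, H); and sup_{H̃ : eig(H̃) = eig(H)} 𝓛_avg(LDLQ, H̃) = (m/c)·tr(H), where c = 12 when Q is nearest rounding (matching 𝓛_avg(Near, H)) and c = 6 when Q is standard unbiased stochastic rounding (matching 𝓛_avg(Stoch, H)). -/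
open MeasureTheory Matrix
open scoped ENNReal

open QuIP MeasureTheory Matrix

/-- The set of worst-case proxy losses achieved by realizations of LDLQ (with
entrywise quantizer either nearest or stochastic rounding) on positive
semidefinite matrices `H'` with the same eigenvalues (with multiplicity,
i.e. the same characteristic polynomial) as `H`. -/
def ldlqWorstLosses (m n : ℕ) (H : Matrix (Fin n) (Fin n) ℝ) : Set ℝ≥0∞ :=
  {x | ∃ (H' Ugrave D : Matrix (Fin n) (Fin n) ℝ)
        (Ω : Type) (_ : MeasurableSpace Ω) (μ : Measure Ω)
        (A : Matrix (Fin m) (Fin n) ℝ → Ω → Matrix (Fin m) (Fin n) ℝ),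
      IsProbabilityMeasure μ ∧
      H'.PosSemidef ∧ H'.charpoly = H.charpoly ∧
      StrictUpper Ugrave ∧ (∀ i j, i ≠ j → D i j = 0) ∧ (∀ i, 0 ≤ D i i) ∧
      H' = (Ugrave + 1) * D * (Ugrave + 1)ᵀ ∧
      (IsNearestMethod μ A Ugrave ∨ IsStochMethod μ A Ugrave) ∧
      x = Lworst μ A H'}

/-- The set of average proxy losses achieved by realizations of LDLQ with the
quantizer specified by `near` (nearest if `near = true`, stochastic otherwise)
on positive semidefinite matrices `H'` with the same eigenvalues (with
multiplicity) as `H`. -/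
def ldlqAvgLosses (m n : ℕ) (H : Matrix (Fin n) (Fin n) ℝ) (near : Bool) : Set ℝ≥0∞ :=
  {x | ∃ (H' Ugrave D : Matrix (Fin n) (Fin n) ℝ)
        (Ω : Type) (_ : MeasurableSpace Ω) (μ : Measure Ω)
        (A : Matrix (Fin m) (Fin n) ℝ → Ω → Matrix (Fin m) (Fin n) ℝ),
      IsProbabilityMeasure μ ∧
      H'.PosSemidef ∧ H'.charpoly = H.charpoly ∧
      StrictUpper Ugrave ∧ (∀ i j, i ≠ j → D i j = 0) ∧ (∀ i, 0 ≤ D i i) ∧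
      H' = (Ugrave + 1) * D * (Ugrave + 1)ᵀ ∧
      (if near then IsNearestMethod μ A Ugrave else IsStochMethod μ A Ugrave) ∧
      x = Lavg μ A H'}

namespace QuIPProof

open Function

/-- The value fed to the quantizer at column `k` of a row. -/
noncomputable def xv {n : ℕ} (U : Matrix (Fin n) (Fin n) ℝ) (w a : Fin n → ℝ) (k : Fin n) : ℝ :=
  w k + ∑ j, (w j - a j) * U j k

lemma xv_eq {m n : ℕ} (U : Matrix (Fin n) (Fin n) ℝ) (W B : Matrix (Fin m) (Fin n) ℝ) (i k) :
    (W + (W - B) * U) i k = xv U (W i) (B i) k := by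
  simp [xv, Matrix.add_apply, Matrix.mul_apply, Matrix.sub_apply]

lemma xv_congr {n : ℕ} {U : Matrix (Fin n) (Fin n) ℝ} (hU : StrictUpper U) (w a b : Fin n → ℝ)
    (k : Fin n) (h : ∀ l : Fin n, l < k → a l = b l) : xv U w a k = xv U w b k := by
  unfold xv
  congr 1
  refine Finset.sum_congr rfl fun j _ => ?_
  by_cases hj : j < k
  · rw [h j hj]
  · rw [hU j k (not_lt.1 hj)]; simp

lemma xv_update_a {n : ℕ} {U : Matrix (Fin n) (Fin n) ℝ} (hU : StrictUpper U) (w a : Fin n → ℝ)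
    (k : Fin n) (v : ℝ) : xv U w (update a k v) k = xv U w a k :=
  xv_congr hU _ _ _ _ fun l hl => by simp [hl.ne]

lemma xv_update_w {n : ℕ} {U : Matrix (Fin n) (Fin n) ℝ} (hU : StrictUpper U) (w a : Fin n → ℝ)
    (k l : Fin n) (hl : l < k) (t : ℝ) : xv U (update w k t) a l = xv U w a l := by
  unfold xv
  rw [update_of_ne hl.ne]
  congr 1
  refine Finset.sum_congr rfl fun j _ => ?_
  by_cases hj : j < l
  · rw [update_of_ne (hj.trans hl).ne]
  · rw [hU j l (not_lt.1 hj)]; simp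

lemma xv_update_w_self {n : ℕ} {U : Matrix (Fin n) (Fin n) ℝ} (hU : StrictUpper U)
    (w a : Fin n → ℝ) (k : Fin n) (t : ℝ) :
    xv U (update w k t) a k = t + ∑ j, (w j - a j) * U j k := by
  unfold xv
  rw [update_self]
  congr 1
  refine Finset.sum_congr rfl fun j _ => ?_
  by_cases hj : j < k
  · rw [update_of_ne hj.ne]
  · rw [hU j k (not_lt.1 hj)]; simp

lemma measurable_xv {n : ℕ} (U : Matrix (Fin n) (Fin n) ℝ) (k : Fin n) :
    Measurable fun q : (Fin n → ℝ) × (Fin n → ℝ) => xv U q.1 q.2 k := by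
  unfold xv; fun_prop

lemma measurable_xv_right {n : ℕ} (U : Matrix (Fin n) (Fin n) ℝ) (w : Fin n → ℝ) (k : Fin n) :
    Measurable fun a : (Fin n → ℝ) => xv U w a k := by
  unfold xv; fun_prop

/-- One-step transition operator for column `k`. -/
noncomputable def K {n : ℕ} (U : Matrix (Fin n) (Fin n) ℝ) (p α β : ℝ → ℝ) (k : Fin n)
    (w : Fin n → ℝ) (φ : (Fin n → ℝ) → ℝ≥0∞) (a : Fin n → ℝ) : ℝ≥0∞ :=
  ENNReal.ofReal (1 - p (xv U w a k)) * φ (update a k (α (xv U w a k))) +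
  ENNReal.ofReal (p (xv U w a k)) * φ (update a k (β (xv U w a k)))

lemma measurable_K {n : ℕ} (U : Matrix (Fin n) (Fin n) ℝ) {p α β : ℝ → ℝ} (hp : Measurable p)
    (hα : Measurable α) (hβ : Measurable β) (k : Fin n)
    (φ : (Fin n → ℝ) → (Fin n → ℝ) → ℝ≥0∞) (hφ : Measurable (uncurry φ)) :
    Measurable (uncurry fun w a => K U p α β k w (φ w) a) := by
  have hx := measurable_xv U k
  have h1 : ∀ γ : ℝ → ℝ, Measurable γ → Measurable
      fun q : (Fin n → ℝ) × (Fin n → ℝ) => φ q.1 (update q.2 k (γ (xv U q.1 q.2 k))) := by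
    intro γ hγ
    exact hφ.comp (measurable_fst.prodMk
      (measurable_update'.comp (measurable_snd.prodMk (hγ.comp hx))))
  unfold K
  exact ((measurable_const.sub (hp.comp hx)).ennreal_ofReal.mul (h1 α hα)).add
    ((hp.comp hx).ennreal_ofReal.mul (h1 β hβ))

/-- The method has the given one-step transitions, row by row. -/
def IsKer {m n : ℕ} {Ω : Type} [MeasurableSpace Ω] (μ : Measure Ω)
    (A : Matrix (Fin m) (Fin n) ℝ → Ω → Matrix (Fin m) (Fin n) ℝ)
    (U : Matrix (Fin n) (Fin n) ℝ) (p α β : ℝ → ℝ) : Prop :=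
  ∀ W i k (φ : (Fin n → ℝ) → ℝ≥0∞), Measurable φ →
    (∀ a b : Fin n → ℝ, (∀ l : Fin n, l ≤ k → a l = b l) → φ a = φ b) →
    ∫⁻ ω, φ (A W ω i) ∂μ = ∫⁻ ω, K U p α β k (W i) φ (A W ω i) ∂μ

lemma isKer_near {m n : ℕ} {Ω : Type} [MeasurableSpace Ω] {μ : Measure Ω}
    {A : Matrix (Fin m) (Fin n) ℝ → Ω → Matrix (Fin m) (Fin n) ℝ}
    {U : Matrix (Fin n) (Fin n) ℝ} (h : IsNearestMethod μ A U) :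
    IsKer μ A U (fun _ => 0) (fun x => ((round x : ℤ) : ℝ)) (fun _ => 0) := by
  intro W i k φ _ _
  refine lintegral_congr_ae ?_
  filter_upwards [(h W).2] with ω hω
  have := hω i k
  rw [xv_eq] at this
  simp [K, ← this]

lemma stoch_bound {x y : ℝ} (h : y = ((⌊x⌋ : ℤ) : ℝ) ∨ y = ((⌊x⌋ : ℤ) : ℝ) + 1) :
    |y - x| ≤ 1 := by
  have h1 := Int.floor_le x
  have h2 := Int.lt_floor_add_one x
  rw [abs_le]
  rcases h with h | h <;> constructor <;> linarith

lemma pastSigma_le {m n : ℕ} {Ω : Type} [mΩ : MeasurableSpace Ω]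
    {B : Ω → Matrix (Fin m) (Fin n) ℝ} (hB : ∀ i k, Measurable fun ω => B ω i k) (k : Fin n) :
    pastSigma B k ≤ mΩ := by
  unfold pastSigma
  rw [← measurable_iff_comap_le]
  exact measurable_pi_lambda _ fun p => hB _ _

lemma measurable_past {m n : ℕ} {Ω : Type} [MeasurableSpace Ω]
    (B : Ω → Matrix (Fin m) (Fin n) ℝ) (k j : Fin n) (hj : j < k) (i : Fin m) :
    Measurable[pastSigma B k] fun ω => B ω i j := by
  have h : Measurable[pastSigma B k]
    (fun ω => fun p : Fin m × {j : Fin n // j < k} => B ω p.1 p.2.1) := comap_measurable _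
  exact (measurable_pi_apply (i, (⟨j, hj⟩ : {j : Fin n // j < k}))).comp h

/-- past-measurable weights do not see centred errors -/
lemma lintegral_weight {Ω : Type} {m' m0 : MeasurableSpace Ω} {μ : Measure Ω}
    [IsProbabilityMeasure μ] (hm : m' ≤ m0) {g η f : Ω → ℝ} {G : Ω → ℝ≥0∞}
    (hG : Measurable[m'] G) (hη : Measurable η) (hf : Measurable f) (hηi : Integrable η μ)
    (hfi : Integrable f μ) (hf0 : ∀ᵐ ω ∂μ, 0 ≤ f ω) (hg : ∀ᵐ ω ∂μ, g ω = η ω + f ω)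
    (hg0 : ∀ᵐ ω ∂μ, 0 ≤ g ω) (hc : μ[η | m'] =ᵐ[μ] 0) :
    ∫⁻ ω, ENNReal.ofReal (g ω) * G ω ∂μ = ∫⁻ ω, ENNReal.ofReal (f ω) * G ω ∂μ := by
  have e1 : ∫⁻ ω, ENNReal.ofReal (g ω) * G ω ∂μ = ∫⁻ ω, ENNReal.ofReal (η ω + f ω) * G ω ∂μ := by
    refine lintegral_congr_ae ?_
    filter_upwards [hg] with ω hω
    rw [hω]
  have hs0 : ∀ᵐ ω ∂μ, 0 ≤ η ω + f ω := by
    filter_upwards [hg, hg0] with ω h1 h2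
    rwa [← h1]
  have hG0 : Measurable G := hG.mono hm le_rfl
  have key : (μ.withDensity fun ω => ENNReal.ofReal (η ω + f ω)).trim hm
      = (μ.withDensity fun ω => ENNReal.ofReal (f ω)).trim hm := by
    refine @Measure.ext _ m' _ _ fun s hs => ?_
    rw [trim_measurableSet_eq hm hs, trim_measurableSet_eq hm hs,
      withDensity_apply _ (hm s hs), withDensity_apply _ (hm s hs),
      ← ofReal_integral_eq_lintegral_ofReal (f := fun ω => η ω + f ω)
        (hηi.add hfi).integrableOn (ae_restrict_of_ae hs0),
      ← ofReal_integral_eq_lintegral_ofReal hfi.integrableOn (ae_restrict_of_ae hf0),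
      integral_add hηi.integrableOn hfi.integrableOn, ← setIntegral_condExp hm hηi hs,
      integral_congr_ae (ae_restrict_of_ae hc)]
    simp
  have e2 := lintegral_trim (μ := μ.withDensity fun ω => ENNReal.ofReal (η ω + f ω)) hm hG
  have e3 := lintegral_trim (μ := μ.withDensity fun ω => ENNReal.ofReal (f ω)) hm hG
  have hsm : Measurable fun ω => ENNReal.ofReal (η ω + f ω) := (hη.add hf).ennreal_ofReal
  rw [lintegral_withDensity_eq_lintegral_mul _ hsm hG0] at e2
  rw [lintegral_withDensity_eq_lintegral_mul _ hf.ennreal_ofReal hG0] at e3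
  rw [e1]
  simp only [Pi.mul_apply] at e2 e3
  rw [← e2, ← e3, key]

lemma measurable_fl : Measurable fun x : ℝ => ((⌊x⌋ : ℤ) : ℝ) :=
  (measurable_from_top (f := fun z : ℤ => (z : ℝ))).comp Int.measurable_floor

lemma isKer_stoch {m n : ℕ} {Ω : Type} [MeasurableSpace Ω] {μ : Measure Ω}
    [IsProbabilityMeasure μ]
    {A : Matrix (Fin m) (Fin n) ℝ → Ω → Matrix (Fin m) (Fin n) ℝ}
    {U : Matrix (Fin n) (Fin n) ℝ} (hU : StrictUpper U) (h : IsStochMethod μ A U) :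
    IsKer μ A U Int.fract (fun x => ((⌊x⌋ : ℤ) : ℝ)) (fun x => ((⌊x⌋ : ℤ) : ℝ) + 1) := by
  intro W i k φ hφ hdep
  obtain ⟨hmeas, hor, hc⟩ := h W
  have hor := hor i k
  have hc := hc i k
  simp only [xv_eq] at hor hc
  have hm := pastSigma_le hmeas k
  have hrow : Measurable fun ω => A W ω i := measurable_pi_lambda _ fun j => hmeas i j
  have hx : Measurable fun ω => xv U (W i) (A W ω i) k :=
    (measurable_xv_right U (W i) k).comp hrow
  -- past measurability
  let msk : Ω → Fin n → ℝ := fun ω j => if j < k then A W ω i j else 0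
  have hmsk : Measurable[pastSigma (A W) k] msk := by
    refine @measurable_pi_lambda _ _ _ (pastSigma (A W) k) _ _ fun j => ?_
    by_cases hj : j < k
    · simp only [msk, hj, if_true]; exact measurable_past (A W) k j hj i
    · simp only [msk, hj, if_false]; exact @measurable_const _ _ _ (pastSigma (A W) k) _
  have hxm : ∀ ω, xv U (W i) (A W ω i) k = xv U (W i) (msk ω) k := fun ω =>
    xv_congr hU _ _ _ _ fun l hl => by simp [msk, hl]
  have hxp : Measurable[pastSigma (A W) k] fun ω => xv U (W i) (msk ω) k :=
    (measurable_xv_right U (W i) k).comp hmsk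
  have hGp : ∀ γ : ℝ → ℝ, Measurable γ → Measurable[pastSigma (A W) k] fun ω =>
      φ (update (A W ω i) k (γ (xv U (W i) (A W ω i) k))) := by
    intro γ hγ
    have : (fun ω => φ (update (A W ω i) k (γ (xv U (W i) (A W ω i) k)))) =
        fun ω => φ (update (msk ω) k (γ (xv U (W i) (msk ω) k))) := by
      funext ω
      refine hdep _ _ fun l hl => ?_
      rw [hxm]
      rcases hl.lt_or_eq with hl | rfl
      · simp [hl.ne, msk, hl]
      · simp
    rw [this]
    exact hφ.comp (measurable_update'.comp (hmsk.prodMk (hγ.comp hxp)))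
  set x : Ω → ℝ := fun ω => xv U (W i) (A W ω i) k with hxdef
  have hη : Measurable fun ω => A W ω i k - x ω := (hmeas i k).sub hx
  have hηi : Integrable (fun ω => A W ω i k - x ω) μ := by
    refine Integrable.of_bound hη.aestronglyMeasurable 1 ?_
    filter_upwards [hor] with ω hω
    exact stoch_bound hω
  have hf : Measurable fun ω => Int.fract (x ω) := measurable_fract.comp hx
  have hfi : Integrable (fun ω => Int.fract (x ω)) μ := by
    refine Integrable.of_bound hf.aestronglyMeasurable 1 (Filter.Eventually.of_forall fun ω => ?_)
    rw [Real.norm_eq_abs, abs_of_nonneg (Int.fract_nonneg _)]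
    exact (Int.fract_lt_one _).le
  have hcneg : μ[(fun ω => -(A W ω i k - x ω)) | pastSigma (A W) k] =ᵐ[μ] 0 := by
    refine (condExp_neg (fun ω => A W ω i k - x ω) (pastSigma (A W) k)).trans ?_
    filter_upwards [hc] with ω hω
    simp only [Pi.neg_apply, Pi.zero_apply, neg_eq_zero]
    exact hω
  have s2 := lintegral_weight hm (g := fun ω => if A W ω i k = ((⌊x ω⌋ : ℤ) : ℝ) then 0 else 1)
    (hGp (fun x => ((⌊x⌋ : ℤ) : ℝ) + 1) (measurable_fl.add_const 1)) hη hf hηi hfi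
    (Filter.Eventually.of_forall fun ω => Int.fract_nonneg _) (by
      filter_upwards [hor] with ω hω
      have := Int.floor_add_fract (x ω)
      change _ ∨ _ at hω
      rcases hω with hω | hω
      · rw [if_pos hω, hω]; simp only [hxdef] at *; linarith
      · rw [if_neg (by rw [hω]; simp [hxdef]), hω]; simp only [hxdef] at *; linarith)
    (Filter.Eventually.of_forall fun ω => by split_ifs <;> norm_num) hc
  have s1 := lintegral_weight hm (g := fun ω => if A W ω i k = ((⌊x ω⌋ : ℤ) : ℝ) then 1 else 0)
    (hGp (fun x => ((⌊x⌋ : ℤ) : ℝ)) measurable_fl) hη.neg (measurable_const.sub hf) hηi.neg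
    ((integrable_const (1 : ℝ)).sub hfi)
    (Filter.Eventually.of_forall fun ω => by
      simp only [Pi.sub_apply, sub_nonneg]; exact (Int.fract_lt_one _).le) (by
      filter_upwards [hor] with ω hω
      have := Int.floor_add_fract (x ω)
      rcases hω with hω | hω
      · rw [if_pos hω]; simp only [Pi.neg_apply, Pi.sub_apply, hω, hxdef] at *; linarith
      · rw [if_neg (by rw [hω]; simp [hxdef])]
        simp only [Pi.neg_apply, Pi.sub_apply, hω, hxdef] at *; linarith)
    (Filter.Eventually.of_forall fun ω => by split_ifs <;> norm_num) hcneg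
  unfold K
  have hGm : ∀ γ : ℝ → ℝ, Measurable γ → Measurable fun ω =>
      φ (update (A W ω i) k (γ (xv U (W i) (A W ω i) k))) := fun γ hγ => (hGp γ hγ).mono hm le_rfl
  refine Eq.trans ?_ (lintegral_add_left
    ((measurable_const.sub hf).ennreal_ofReal.mul (hGm _ measurable_fl)) _).symm
  refine Eq.trans ?_ (congrArg₂ (· + ·) s1 s2)
  have hset : MeasurableSet {ω | A W ω i k = ((⌊x ω⌋ : ℤ) : ℝ)} :=
    measurableSet_eq_fun (hmeas i k) (measurable_fl.comp hx)
  have hmi : Measurable fun ω => if A W ω i k = ((⌊x ω⌋ : ℤ) : ℝ) then (1 : ℝ) else 0 :=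
    Measurable.ite hset measurable_const measurable_const
  refine Eq.trans ?_ (lintegral_add_left (hmi.ennreal_ofReal.mul (hGm _ measurable_fl)) _)
  refine lintegral_congr_ae ?_
  filter_upwards [hor] with ω hω
  change φ (A W ω i) = ENNReal.ofReal (if A W ω i k = ((⌊x ω⌋ : ℤ) : ℝ) then (1 : ℝ) else 0) *
    φ (update (A W ω i) k ((⌊x ω⌋ : ℤ) : ℝ)) +
    ENNReal.ofReal (if A W ω i k = ((⌊x ω⌋ : ℤ) : ℝ) then (0 : ℝ) else 1) *
    φ (update (A W ω i) k (((⌊x ω⌋ : ℤ) : ℝ) + 1))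
  by_cases hc1 : A W ω i k = ((⌊x ω⌋ : ℤ) : ℝ)
  · have e : update (A W ω i) k ((⌊x ω⌋ : ℤ) : ℝ) = A W ω i := by
      rw [← hc1]; exact update_eq_self k _
    rw [if_pos hc1, if_pos hc1, e]; simp
  · have hc2 : A W ω i k = ((⌊x ω⌋ : ℤ) : ℝ) + 1 := hω.resolve_left hc1
    have e : update (A W ω i) k (((⌊x ω⌋ : ℤ) : ℝ) + 1) = A W ω i := by
      rw [← hc2]; exact update_eq_self k _
    rw [if_neg hc1, if_neg hc1, e]; simp

/-- uniform measure on the unit cube (one row) -/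
noncomputable def nu (n : ℕ) : Measure (Fin n → ℝ) :=
  Measure.pi fun _ : Fin n => (volume : Measure ℝ).restrict (Set.Icc 0 1)

instance probIcc : IsProbabilityMeasure ((volume : Measure ℝ).restrict (Set.Icc 0 1)) :=
  ⟨by simp⟩

instance probNu (n : ℕ) : IsProbabilityMeasure (nu n) := by unfold nu; infer_instance

lemma box_restrict (m n : ℕ) :
    (volume : Measure (Fin m → Fin n → ℝ)).restrict (unitBox m n)
      = Measure.pi fun _ : Fin m => nu n := by
  have h : (unitBox m n : Set (Fin m → Fin n → ℝ)) =
      Set.univ.pi fun _ : Fin m => Set.univ.pi fun _ : Fin n => Set.Icc (0 : ℝ) 1 := by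
    refine Set.ext fun W => ?_
    exact ⟨fun h i _ j _ => h i j, fun h i j => h i trivial j trivial⟩
  rw [h, volume_pi, Measure.restrict_pi_pi]
  congr 1
  funext i
  rw [volume_pi, Measure.restrict_pi_pi]
  rfl

lemma box_lintegral_row {m n : ℕ} (i : Fin m) (g : (Fin n → ℝ) → ℝ≥0∞) (hg : Measurable g) :
    ∫⁻ W in unitBox m n, g (W i) = ∫⁻ w, g w ∂(nu n) := by
  change ∫⁻ W, g (W i) ∂((volume : Measure (Fin m → Fin n → ℝ)).restrict (unitBox m n)) = _
  rw [box_restrict]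
  exact (measurePreserving_eval (fun _ : Fin m => nu n) i).lintegral_comp hg

lemma nu_lintegral_coord {n : ℕ} (k : Fin n) (g : (Fin n → ℝ) → ℝ≥0∞) (hg : Measurable g)
    (c : ℝ≥0∞) (hc : ∀ w, ∫⁻ t in Set.Icc (0 : ℝ) 1, g (update w k t) = c) :
    ∫⁻ w, g w ∂(nu n) = c := by
  unfold nu
  rw [lintegral_eq_lmarginal_univ 0, lmarginal_erase' _ hg (Finset.mem_univ k)]
  simp only [hc]
  simp [lmarginal]

noncomputable def psi (p α β : ℝ → ℝ) (x : ℝ) : ℝ :=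
  (1 - p x) * (α x - x) ^ 2 + p x * (β x - x) ^ 2

lemma psi_nonneg {p α β : ℝ → ℝ} (h0 : ∀ x, 0 ≤ p x) (h1 : ∀ x, p x ≤ 1) (x : ℝ) :
    0 ≤ psi p α β x :=
  add_nonneg (mul_nonneg (sub_nonneg.2 (h1 x)) (sq_nonneg _)) (mul_nonneg (h0 x) (sq_nonneg _))

lemma entry {m n : ℕ} {Ω : Type} [MeasurableSpace Ω] {μ : Measure Ω}
    {A : Matrix (Fin m) (Fin n) ℝ → Ω → Matrix (Fin m) (Fin n) ℝ}
    {U : Matrix (Fin n) (Fin n) ℝ} (hU : StrictUpper U) {p α β : ℝ → ℝ}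
    (hK : IsKer μ A U p α β) (h0 : ∀ x, 0 ≤ p x) (h1 : ∀ x, p x ≤ 1)
    (W : Matrix (Fin m) (Fin n) ℝ) (i : Fin m) (k : Fin n) :
    ∫⁻ ω, ENNReal.ofReal ((A W ω i k - xv U (W i) (A W ω i) k) ^ 2) ∂μ =
      ∫⁻ ω, ENNReal.ofReal (psi p α β (xv U (W i) (A W ω i) k)) ∂μ := by
  have := hK W i k (fun a => ENNReal.ofReal ((a k - xv U (W i) a k) ^ 2))
    (((measurable_pi_apply k).sub (measurable_xv_right U (W i) k)).pow_const 2).ennreal_ofReal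
    (fun a b hab => by
      rw [hab k le_rfl, xv_congr hU (W i) a b k fun l hl => hab l hl.le])
  refine this.trans (lintegral_congr fun ω => ?_)
  unfold K psi
  simp only [xv_update_a hU, update_self]
  rw [← ENNReal.ofReal_mul (sub_nonneg.2 (h1 _)), ← ENNReal.ofReal_mul (h0 _),
    ← ENNReal.ofReal_add (mul_nonneg (sub_nonneg.2 (h1 _)) (sq_nonneg _))
      (mul_nonneg (h0 _) (sq_nonneg _))]

lemma avg_aux {m n : ℕ} {Ω : Type} [MeasurableSpace Ω] {μ : Measure Ω} [IsProbabilityMeasure μ]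
    {A : Matrix (Fin m) (Fin n) ℝ → Ω → Matrix (Fin m) (Fin n) ℝ}
    {U : Matrix (Fin n) (Fin n) ℝ} (hU : StrictUpper U) {p α β : ℝ → ℝ}
    (hp : Measurable p) (hα : Measurable α) (hβ : Measurable β)
    (hK : IsKer μ A U p α β) (h0 : ∀ x, 0 ≤ p x) (h1 : ∀ x, p x ≤ 1)
    (i : Fin m) (k : Fin n) (c : ℝ≥0∞) (j : ℕ) : j ≤ k.val →
    ∀ φ : (Fin n → ℝ) → (Fin n → ℝ) → ℝ≥0∞, Measurable (uncurry φ) →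
    (∀ w a b, (∀ l : Fin n, l.val < j → a l = b l) → φ w a = φ w b) →
    (∀ w a, ∫⁻ t in Set.Icc (0 : ℝ) 1, φ (update w k t) a = c) →
    Measurable (fun W : Matrix (Fin m) (Fin n) ℝ => ∫⁻ ω, φ (W i) (A W ω i) ∂μ) ∧
      ∫⁻ W in unitBox m n, ∫⁻ ω, φ (W i) (A W ω i) ∂μ = c := by
  induction j with
  | zero =>
    intro _ φ hφ hdep hc
    have e : ∀ W : Matrix (Fin m) (Fin n) ℝ, ∫⁻ ω, φ (W i) (A W ω i) ∂μ = φ (W i) 0 := by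
      intro W
      rw [lintegral_congr fun ω => hdep (W i) (A W ω i) 0 fun l hl => absurd hl (Nat.not_lt_zero _)]
      simp
    have hm : Measurable fun w => φ w 0 := hφ.comp (measurable_id.prodMk measurable_const)
    simp only [e]
    refine ⟨hm.comp (measurable_pi_apply (X := fun _ : Fin m => Fin n → ℝ) i), ?_⟩
    rw [box_lintegral_row i (fun w => φ w 0) hm]
    exact nu_lintegral_coord k _ hm c fun w => hc w 0
  | succ j ih =>
    intro hj φ hφ hdep hc
    have hjk : j < k.val := hj
    set l : Fin n := ⟨j, hjk.trans k.2⟩ with hl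
    have hlk : l < k := hjk
    have e : ∀ W : Matrix (Fin m) (Fin n) ℝ, ∫⁻ ω, φ (W i) (A W ω i) ∂μ =
        ∫⁻ ω, K U p α β l (W i) (φ (W i)) (A W ω i) ∂μ := by
      intro W
      refine hK W i l (φ (W i)) (hφ.comp (measurable_const.prodMk measurable_id)) ?_
      intro a b hab
      exact hdep _ _ _ fun l' hl' => hab l' (Nat.lt_succ_iff.1 hl')
    simp only [e]
    refine ih hjk.le (fun w a => K U p α β l w (φ w) a) (measurable_K U hp hα hβ l φ hφ) ?_ ?_
    · intro w a b hab
      have hx : xv U w a l = xv U w b l := xv_congr hU _ _ _ _ fun l' hl' => hab l' hl'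
      have hv : ∀ v, φ w (update a l v) = φ w (update b l v) := by
        intro v
        refine hdep _ _ _ fun l' hl' => ?_
        by_cases h : l' = l
        · rw [h]; simp
        · rw [update_of_ne h, update_of_ne h]
          refine hab l' (lt_of_le_of_ne (Nat.lt_succ_iff.1 hl') fun hh => h (Fin.ext hh))
      simp only [K, hx, hv]
    · intro w a
      simp only [K, xv_update_w hU w a k l hlk]
      have hm : ∀ b, Measurable fun t => φ (update w k t) b := fun b =>
        hφ.comp ((measurable_update w).prodMk measurable_const)
      rw [lintegral_add_left ((hm _).const_mul _), lintegral_const_mul _ (hm _),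
        lintegral_const_mul _ (hm _), hc, hc, ← add_mul, ← ENNReal.ofReal_add
          (sub_nonneg.2 (h1 _)) (h0 _)]
      simp

/-- averaged loss of one entry -/
lemma entry_avg {m n : ℕ} {Ω : Type} [MeasurableSpace Ω] {μ : Measure Ω} [IsProbabilityMeasure μ]
    {A : Matrix (Fin m) (Fin n) ℝ → Ω → Matrix (Fin m) (Fin n) ℝ}
    {U : Matrix (Fin n) (Fin n) ℝ} (hU : StrictUpper U) {p α β : ℝ → ℝ}
    (hp : Measurable p) (hα : Measurable α) (hβ : Measurable β)
    (hK : IsKer μ A U p α β) (h0 : ∀ x, 0 ≤ p x) (h1 : ∀ x, p x ≤ 1) (c : ℝ≥0∞)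
    (hc : ∀ g : ℝ, ∫⁻ t in Set.Icc (0 : ℝ) 1, ENNReal.ofReal (psi p α β (t + g)) = c)
    (i : Fin m) (k : Fin n) :
    Measurable (fun W : Matrix (Fin m) (Fin n) ℝ =>
      ∫⁻ ω, ENNReal.ofReal ((A W ω i k - xv U (W i) (A W ω i) k) ^ 2) ∂μ) ∧
    ∫⁻ W in unitBox m n,
      ∫⁻ ω, ENNReal.ofReal ((A W ω i k - xv U (W i) (A W ω i) k) ^ 2) ∂μ = c := by
  simp only [entry hU hK h0 h1]
  have hpsi : Measurable (psi p α β) := by unfold psi; fun_prop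
  refine avg_aux hU hp hα hβ hK h0 h1 i k c k.val le_rfl
    (fun w a => ENNReal.ofReal (psi p α β (xv U w a k)))
    (hpsi.comp (measurable_xv U k)).ennreal_ofReal ?_ ?_
  · intro w a b hab
    rw [xv_congr hU w a b k fun l hl => hab l hl]
  · intro w a
    simp only [xv_update_w_self hU]
    exact hc _

lemma per_lintegral {f : ℝ → ℝ} (hf : Measurable f) (hper : Periodic f 1) (h0 : ∀ x, 0 ≤ f x)
    (C : ℝ) (hC : ∀ x, f x ≤ C) (s c : ℝ) (hs : ∫ x in s..s + 1, f x = c) (g : ℝ) :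
    ∫⁻ t in Set.Icc (0 : ℝ) 1, ENNReal.ofReal (f (t + g)) = ENNReal.ofReal c := by
  have hi : Integrable (fun t => f (t + g)) (volume.restrict (Set.Icc (0 : ℝ) 1)) :=
    Integrable.of_bound (hf.comp (measurable_add_const g)).aestronglyMeasurable C
      (Filter.Eventually.of_forall fun t => by
        rw [Real.norm_eq_abs, abs_of_nonneg (h0 _)]; exact hC _)
  rw [← ofReal_integral_eq_lintegral_ofReal hi (Filter.Eventually.of_forall fun t => h0 _),
    integral_Icc_eq_integral_Ioc, ← intervalIntegral.integral_of_le zero_le_one,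
    intervalIntegral.integral_comp_add_right, zero_add, add_comm 1 g,
    hper.intervalIntegral_add_eq g s, hs]

lemma measurable_rd : Measurable fun x : ℝ => ((round x : ℤ) : ℝ) := by
  simp only [round_eq]
  exact measurable_fl.comp (measurable_add_const _)

lemma psi_near (x : ℝ) : psi (fun _ => 0) (fun x => ((round x : ℤ) : ℝ)) (fun _ => 0) x
    = (((round x : ℤ) : ℝ) - x) ^ 2 := by simp [psi]

lemma psi_stoch (x : ℝ) : psi Int.fract (fun x => ((⌊x⌋ : ℤ) : ℝ)) (fun x => ((⌊x⌋ : ℤ) : ℝ) + 1) x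
    = Int.fract x * (1 - Int.fract x) := by
  have := Int.floor_add_fract x
  have e : ((⌊x⌋ : ℤ) : ℝ) = x - Int.fract x := by linarith
  simp only [psi, e]; ring

lemma near_le (x : ℝ) : (((round x : ℤ) : ℝ) - x) ^ 2 ≤ 1 / 4 := by
  have h := abs_sub_round x
  rw [abs_sub_comm] at h
  have := abs_le.1 h
  nlinarith [this.1, this.2]

lemma stoch_le (x : ℝ) : Int.fract x * (1 - Int.fract x) ≤ 1 / 4 := by
  nlinarith [sq_nonneg (Int.fract x - 1 / 2)]

lemma stoch_nonneg (x : ℝ) : 0 ≤ Int.fract x * (1 - Int.fract x) :=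
  mul_nonneg (Int.fract_nonneg x) (sub_nonneg.2 (Int.fract_lt_one x).le)

lemma near_int (g : ℝ) : ∫⁻ t in Set.Icc (0 : ℝ) 1, ENNReal.ofReal
    (psi (fun _ => 0) (fun x => ((round x : ℤ) : ℝ)) (fun _ => 0) (t + g))
      = ENNReal.ofReal (1 / 12) := by
  simp only [psi_near]
  refine per_lintegral (f := fun x => (((round x : ℤ) : ℝ) - x) ^ 2)
    ((measurable_rd.sub measurable_id).pow_const 2) ?_ (fun x => sq_nonneg _) (1 / 4) near_le
    (-1 / 2) (1 / 12) ?_ g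
  · intro x
    simp
  · have : ∫ x in (-1 / 2 : ℝ)..(-1 / 2 + 1), (((round x : ℤ) : ℝ) - x) ^ 2
        = ∫ x in (-1 / 2 : ℝ)..(-1 / 2 + 1), x ^ 2 := by
      refine intervalIntegral.integral_congr_ae ?_
      have : ∀ᵐ x : ℝ, x ≠ 1 / 2 := by simp [ae_iff]
      filter_upwards [this] with x hx hx2
      rw [Set.uIoc_of_le (by norm_num)] at hx2
      have h2 : x < 1 / 2 := lt_of_le_of_ne (by linarith [hx2.2]) hx
      have : round x = 0 := by
        rw [round_eq, Int.floor_eq_iff]; push_cast; constructor <;> linarith [hx2.1]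
      rw [this]; simp
    rw [this, integral_pow]; norm_num

lemma stoch_int (g : ℝ) : ∫⁻ t in Set.Icc (0 : ℝ) 1, ENNReal.ofReal
    (psi Int.fract (fun x => ((⌊x⌋ : ℤ) : ℝ)) (fun x => ((⌊x⌋ : ℤ) : ℝ) + 1) (t + g))
      = ENNReal.ofReal (1 / 6) := by
  simp only [psi_stoch]
  refine per_lintegral (f := fun x => Int.fract x * (1 - Int.fract x))
    (measurable_fract.mul (measurable_const.sub measurable_fract)) ?_ stoch_nonneg (1 / 4)
    stoch_le 0 (1 / 6) ?_ g
  · intro x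
    simp
  · have : ∫ x in (0 : ℝ)..(0 + 1), Int.fract x * (1 - Int.fract x)
        = ∫ x in (0 : ℝ)..(0 + 1), (x - x ^ 2) := by
      refine intervalIntegral.integral_congr_ae ?_
      have : ∀ᵐ x : ℝ, x ≠ 1 := by simp [ae_iff]
      filter_upwards [this] with x hx hx2
      rw [Set.uIoc_of_le (by norm_num)] at hx2
      have h2 : x < 1 := lt_of_le_of_ne (by linarith [hx2.2]) hx
      rw [Int.fract_eq_self.2 ⟨hx2.1.le, h2⟩]; ring
    rw [this, intervalIntegral.integral_sub (by simp) (by simp), integral_pow, integral_id]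
    norm_num

lemma loss_eq {m n : ℕ} {H U D : Matrix (Fin n) (Fin n) ℝ} (hD : ∀ i j, i ≠ j → D i j = 0)
    (hH : H = (U + 1) * D * (U + 1)ᵀ) (W B : Matrix (Fin m) (Fin n) ℝ) :
    proxyLoss H W B = ∑ i, ∑ k, D k k * (B i k - xv U (W i) (B i) k) ^ 2 := by
  have hdiag : D = diagonal fun k => D k k := by
    ext i j
    by_cases h : i = j
    · subst h; simp
    · rw [hD i j h, diagonal_apply_ne _ h]
  have e : (B - W) * H * (B - W)ᵀ = ((B - W) * (U + 1)) * D * ((B - W) * (U + 1))ᵀ := by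
    rw [hH, Matrix.transpose_mul]
    simp only [Matrix.mul_assoc]
  have e2 : (B - W) * (U + 1) = B - (W + (W - B) * U) := by
    rw [Matrix.mul_add, Matrix.mul_one, Matrix.sub_mul, Matrix.sub_mul]; abel
  have e3 : ∀ i k, ((B - W) * (U + 1) : Matrix (Fin m) (Fin n) ℝ) i k = B i k - xv U (W i) (B i) k := by
    intro i k
    rw [e2, Matrix.sub_apply, xv_eq]
  unfold proxyLoss
  rw [e, hdiag, Matrix.trace]
  refine Finset.sum_congr rfl fun i _ => ?_
  rw [Matrix.diag_apply, Matrix.mul_apply]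
  refine Finset.sum_congr rfl fun k _ => ?_
  rw [Matrix.mul_diagonal, Matrix.transpose_apply, e3, diagonal_apply_eq]
  ring

lemma traceD_le {n : ℕ} {H U D : Matrix (Fin n) (Fin n) ℝ} (hU : StrictUpper U)
    (hD : ∀ i j, i ≠ j → D i j = 0) (hD0 : ∀ i, 0 ≤ D i i)
    (hH : H = (U + 1) * D * (U + 1)ᵀ) : ∑ k, D k k ≤ H.trace := by
  have hdiag : D = diagonal fun k => D k k := by
    ext i j
    by_cases h : i = j
    · subst h; simp
    · rw [hD i j h, diagonal_apply_ne _ h]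
  refine Finset.sum_le_sum fun k _ => ?_
  have e : H.diag k = ∑ j, D j j * ((U + 1) k j) ^ 2 := by
    rw [hH, hdiag, Matrix.diag_apply, Matrix.mul_apply]
    refine Finset.sum_congr rfl fun j _ => ?_
    rw [Matrix.mul_diagonal, Matrix.transpose_apply, diagonal_apply_eq]
    ring
  rw [e]
  have h1 : (U + 1) k k = 1 := by simp [Matrix.add_apply, hU k k le_rfl]
  calc D k k = D k k * ((U + 1) k k) ^ 2 := by rw [h1]; ring
    _ ≤ _ := Finset.single_le_sum (f := fun j => D j j * ((U + 1) k j) ^ 2)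
      (fun j _ => mul_nonneg (hD0 j) (sq_nonneg _)) (Finset.mem_univ k)

lemma loss_lintegral {m n : ℕ} {Ω : Type} [MeasurableSpace Ω] {μ : Measure Ω}
    {A : Matrix (Fin m) (Fin n) ℝ → Ω → Matrix (Fin m) (Fin n) ℝ}
    {H U D : Matrix (Fin n) (Fin n) ℝ} (hD : ∀ i j, i ≠ j → D i j = 0) (hD0 : ∀ i, 0 ≤ D i i)
    (hH : H = (U + 1) * D * (U + 1)ᵀ) (W : Matrix (Fin m) (Fin n) ℝ)
    (hA : ∀ i k, Measurable fun ω => A W ω i k) :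
    ∫⁻ ω, ENNReal.ofReal (proxyLoss H W (A W ω)) ∂μ = ∑ i, ∑ k, ENNReal.ofReal (D k k) *
      ∫⁻ ω, ENNReal.ofReal ((A W ω i k - xv U (W i) (A W ω i) k) ^ 2) ∂μ := by
  have hm : ∀ i k, Measurable fun ω =>
      ENNReal.ofReal ((A W ω i k - xv U (W i) (A W ω i) k) ^ 2) := fun i k =>
    (((hA i k).sub ((measurable_xv_right U (W i) k).comp
      (measurable_pi_lambda (fun ω => A W ω i) fun j => hA i j))).pow_const 2).ennreal_ofReal
  have e : ∀ ω, ENNReal.ofReal (proxyLoss H W (A W ω)) = ∑ i, ∑ k, ENNReal.ofReal (D k k) *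
      ENNReal.ofReal ((A W ω i k - xv U (W i) (A W ω i) k) ^ 2) := by
    intro ω
    rw [loss_eq hD hH, ENNReal.ofReal_sum_of_nonneg fun i _ => Finset.sum_nonneg fun k _ =>
      mul_nonneg (hD0 k) (sq_nonneg _)]
    refine Finset.sum_congr rfl fun i _ => ?_
    rw [ENNReal.ofReal_sum_of_nonneg fun k _ => mul_nonneg (hD0 k) (sq_nonneg _)]
    exact Finset.sum_congr rfl fun k _ => ENNReal.ofReal_mul (hD0 k)
  simp only [e]
  rw [lintegral_finsetSum _ fun i _ => Finset.measurable_sum _ fun k _ => (hm i k).const_mul _]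
  refine Finset.sum_congr rfl fun i _ => ?_
  rw [lintegral_finsetSum _ fun k _ => (hm i k).const_mul _]
  exact Finset.sum_congr rfl fun k _ => lintegral_const_mul _ (hm i k)

lemma sum_const_eq {m n : ℕ} (d : Fin n → ℝ) (hd : ∀ k, 0 ≤ d k) (c : ℝ) :
    ∑ _i : Fin m, ∑ k, ENNReal.ofReal (d k) * ENNReal.ofReal c
      = ENNReal.ofReal (m * c * ∑ k, d k) := by
  rw [← Finset.sum_mul]
  rw [Finset.sum_const, Finset.card_univ, Fintype.card_fin, nsmul_eq_mul,
    ← ENNReal.ofReal_sum_of_nonneg fun k _ => hd k,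
    ← ENNReal.ofReal_mul (Finset.sum_nonneg fun k _ => hd k), ← ENNReal.ofReal_natCast,
    ← ENNReal.ofReal_mul (Nat.cast_nonneg m)]
  congr 1; ring

lemma worst_le {m n : ℕ} {Ω : Type} [MeasurableSpace Ω] {μ : Measure Ω} [IsProbabilityMeasure μ]
    {A : Matrix (Fin m) (Fin n) ℝ → Ω → Matrix (Fin m) (Fin n) ℝ}
    {H U D : Matrix (Fin n) (Fin n) ℝ} (hU : StrictUpper U)
    (hD : ∀ i j, i ≠ j → D i j = 0) (hD0 : ∀ i, 0 ≤ D i i)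
    (hH : H = (U + 1) * D * (U + 1)ᵀ) {p α β : ℝ → ℝ}
    (hA : ∀ W i k, Measurable fun ω => A W ω i k)
    (hK : IsKer μ A U p α β) (h0 : ∀ x, 0 ≤ p x) (h1 : ∀ x, p x ≤ 1)
    (hq : ∀ x, psi p α β x ≤ 1 / 4) :
    Lworst μ A H ≤ ENNReal.ofReal ((m : ℝ) / 4 * H.trace) := by
  refine iSup_le fun W => ?_
  rw [loss_lintegral hD hD0 hH W (hA W)]
  calc _ ≤ ∑ _i : Fin m, ∑ k, ENNReal.ofReal (D k k) * ENNReal.ofReal (1 / 4) := by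
        refine Finset.sum_le_sum fun i _ => Finset.sum_le_sum fun k _ => ?_
        gcongr
        rw [entry hU hK h0 h1]
        calc _ ≤ ∫⁻ _ω, ENNReal.ofReal (1 / 4) ∂μ :=
              lintegral_mono fun ω => ENNReal.ofReal_le_ofReal (hq _)
          _ = _ := by simp
    _ = _ := sum_const_eq _ hD0 _
    _ ≤ _ := by
        refine ENNReal.ofReal_le_ofReal ?_
        have := mul_le_mul_of_nonneg_left (traceD_le hU hD hD0 hH)
          (by positivity : (0 : ℝ) ≤ m * (1 / 4))
        linarith

lemma avg_le {m n : ℕ} {Ω : Type} [MeasurableSpace Ω] {μ : Measure Ω} [IsProbabilityMeasure μ]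
    {A : Matrix (Fin m) (Fin n) ℝ → Ω → Matrix (Fin m) (Fin n) ℝ}
    {H U D : Matrix (Fin n) (Fin n) ℝ} (hU : StrictUpper U)
    (hD : ∀ i j, i ≠ j → D i j = 0) (hD0 : ∀ i, 0 ≤ D i i)
    (hH : H = (U + 1) * D * (U + 1)ᵀ) {p α β : ℝ → ℝ}
    (hA : ∀ W i k, Measurable fun ω => A W ω i k)
    (hp : Measurable p) (hα : Measurable α) (hβ : Measurable β)
    (hK : IsKer μ A U p α β) (h0 : ∀ x, 0 ≤ p x) (h1 : ∀ x, p x ≤ 1) (c : ℝ) (hc0 : 0 ≤ c)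
    (hc : ∀ g : ℝ, ∫⁻ t in Set.Icc (0 : ℝ) 1, ENNReal.ofReal (psi p α β (t + g))
      = ENNReal.ofReal c) :
    Lavg μ A H ≤ ENNReal.ofReal ((m : ℝ) * c * H.trace) := by
  unfold Lavg
  have hE := entry_avg hU hp hα hβ hK h0 h1 _ hc
  simp only [fun W => loss_lintegral (μ := μ) hD hD0 hH W (hA W)]
  rw [lintegral_finsetSum _ fun i _ => Finset.measurable_sum _ fun k _ => (hE i k).1.const_mul _]
  calc _ = ∑ _i : Fin m, ∑ k, ENNReal.ofReal (D k k) * ENNReal.ofReal c := by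
        refine Finset.sum_congr rfl fun i _ => ?_
        rw [lintegral_finsetSum _ fun k _ => (hE i k).1.const_mul _]
        refine Finset.sum_congr rfl fun k _ => ?_
        rw [lintegral_const_mul _ (hE i k).1, (hE i k).2]
    _ = _ := sum_const_eq _ hD0 _
    _ ≤ _ := ENNReal.ofReal_le_ofReal
        (mul_le_mul_of_nonneg_left (traceD_le hU hD hD0 hH) (by positivity))

/-- the quadratic form of one row -/
noncomputable def qf {n : ℕ} (H : Matrix (Fin n) (Fin n) ℝ) (e : Fin n → ℝ) : ℝ :=
  ∑ j, ∑ k, H j k * (e j * e k)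

lemma qf_nonneg {n : ℕ} {H : Matrix (Fin n) (Fin n) ℝ} (hH : H.PosSemidef) (e : Fin n → ℝ) :
    0 ≤ qf H e := by
  have h := hH.dotProduct_mulVec_nonneg e
  have : star e ⬝ᵥ H *ᵥ e = qf H e := by
    simp only [qf, dotProduct, mulVec, Finset.mul_sum, Pi.star_apply, star_trivial]
    exact Finset.sum_congr rfl fun j _ => Finset.sum_congr rfl fun k _ => by ring
  rwa [this] at h

lemma loss_qf {m n : ℕ} (H : Matrix (Fin n) (Fin n) ℝ) (W B : Matrix (Fin m) (Fin n) ℝ) :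
    proxyLoss H W B = ∑ i, qf H fun k => B i k - W i k := by
  unfold proxyLoss qf
  rw [Matrix.trace]
  refine Finset.sum_congr rfl fun i _ => ?_
  simp only [Matrix.diag_apply, Matrix.mul_apply, Matrix.transpose_apply, Matrix.sub_apply,
    Finset.sum_mul]
  rw [Finset.sum_comm]
  exact Finset.sum_congr rfl fun j _ => Finset.sum_congr rfl fun k _ => by ring

/-- integral of the quadratic form for uncorrelated errors -/
lemma qf_integral {n : ℕ} {X : Type} [MeasurableSpace X] {μ : Measure X} [IsProbabilityMeasure μ]
    (H : Matrix (Fin n) (Fin n) ℝ) (e : X → Fin n → ℝ) (v : Fin n → ℝ)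
    (he : ∀ k, Measurable fun x => e x k) (hb : ∀ k, ∀ᵐ x ∂μ, |e x k| ≤ 1)
    (hv : ∀ k, ∫ x, e x k ^ 2 ∂μ = v k)
    (hc : ∀ j k, j < k → ∫ x, e x j * e x k ∂μ = 0) :
    Integrable (fun x => qf H (e x)) μ ∧ ∫ x, qf H (e x) ∂μ = ∑ k, H k k * v k := by
  have hi : ∀ j k, Integrable (fun x => e x j * e x k) μ := by
    intro j k
    refine Integrable.of_bound ((he j).mul (he k)).aestronglyMeasurable 1 ?_
    filter_upwards [hb j, hb k] with x h1 h2
    rw [Real.norm_eq_abs, abs_mul]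
    exact mul_le_one₀ h1 (abs_nonneg _) h2
  unfold qf
  have hI2 : ∀ j k, Integrable (fun x => H j k * (e x j * e x k)) μ :=
    fun j k => (hi j k).const_mul _
  have hI : ∀ j, Integrable (fun x => ∑ k, H j k * (e x j * e x k)) μ :=
    fun j => integrable_finsetSum _ fun k _ => hI2 j k
  refine ⟨integrable_finsetSum _ fun j _ => hI j, ?_⟩
  rw [integral_finsetSum _ fun j _ => hI j]
  refine Finset.sum_congr rfl fun j _ => ?_
  rw [integral_finsetSum _ fun k _ => hI2 j k, Finset.sum_eq_single j]
  · rw [integral_const_mul, ← hv j]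
    simp only [sq]
  · intro k _ hk
    rw [integral_const_mul]
    rcases lt_or_gt_of_ne hk with h | h
    · simp only [mul_comm (e _ j)]
      rw [hc k j h, mul_zero]
    · rw [hc j k h, mul_zero]
  · intro h; exact absurd (Finset.mem_univ j) h

lemma strictUpper_zero {n : ℕ} : StrictUpper (0 : Matrix (Fin n) (Fin n) ℝ) := fun _ _ _ => rfl

lemma xv_zero {n : ℕ} (w a : Fin n → ℝ) (k : Fin n) : xv 0 w a k = w k := by simp [xv]

lemma stoch_plain {m n : ℕ} {Ω : Type} [MeasurableSpace Ω] {μ : Measure Ω}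
    [IsProbabilityMeasure μ] {S : Matrix (Fin m) (Fin n) ℝ → Ω → Matrix (Fin m) (Fin n) ℝ}
    (hS : IsStochMethod μ S 0) {H : Matrix (Fin n) (Fin n) ℝ} (hH : H.PosSemidef)
    (W : Matrix (Fin m) (Fin n) ℝ) :
    ∫⁻ ω, ENNReal.ofReal (proxyLoss H W (S W ω)) ∂μ =
      ∑ i, ∑ k, ENNReal.ofReal (H k k) *
        ENNReal.ofReal (Int.fract (W i k) * (1 - Int.fract (W i k))) := by
  have hK := isKer_stoch strictUpper_zero hS
  obtain ⟨hmeas, hor, hc⟩ := hS W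
  simp only [xv_eq, xv_zero] at hor hc
  have hem : ∀ i k, Measurable fun ω => S W ω i k - W i k := fun i k =>
    (hmeas i k).sub_const _
  have hb : ∀ i k, ∀ᵐ ω ∂μ, |S W ω i k - W i k| ≤ 1 := fun i k => by
    filter_upwards [hor i k] with ω hω
    exact stoch_bound hω
  have hIntg : ∀ i k, Integrable (fun ω => S W ω i k - W i k) μ := fun i k =>
    Integrable.of_bound (hem i k).aestronglyMeasurable 1 (hb i k)
  have key : ∀ i, Integrable (fun ω => qf H fun k => S W ω i k - W i k) μ ∧
      ∫ ω, qf H (fun k => S W ω i k - W i k) ∂μ =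
        ∑ k, H k k * (Int.fract (W i k) * (1 - Int.fract (W i k))) := by
    intro i
    refine qf_integral H (fun ω k => S W ω i k - W i k) _ (hem i) (hb i) ?_ ?_
    · intro k
      have h := entry strictUpper_zero hK (fun x => Int.fract_nonneg x)
        (fun x => (Int.fract_lt_one x).le) W i k
      simp only [xv_zero, psi_stoch, lintegral_const, measure_univ, mul_one] at h
      rw [integral_eq_lintegral_of_nonneg_ae (Filter.Eventually.of_forall fun ω => sq_nonneg _)
        ((hem i k).pow_const 2).aestronglyMeasurable, h, ENNReal.toReal_ofReal (stoch_nonneg _)]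
    · intro j k hjk
      have hm := pastSigma_le hmeas k
      have hsm : StronglyMeasurable[pastSigma (S W) k] fun ω => S W ω i j - W i j :=
        ((measurable_past (S W) k j hjk i).sub_const _).stronglyMeasurable
      have hprod : Integrable
          ((fun ω => S W ω i j - W i j) * fun ω => S W ω i k - W i k) μ := by
        refine Integrable.of_bound ((hem i j).mul (hem i k)).aestronglyMeasurable 1 ?_
        filter_upwards [hb i j, hb i k] with x h1 h2
        rw [Real.norm_eq_abs, Pi.mul_apply, abs_mul]
        exact mul_le_one₀ h1 (abs_nonneg _) h2
      have h := condExp_mul_of_stronglyMeasurable_left hsm hprod (hIntg i k)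
      have h2 := integral_condExp (μ := μ) hm
        (f := (fun ω => S W ω i j - W i j) * fun ω => S W ω i k - W i k)
      change ∫ ω, ((fun ω => S W ω i j - W i j) * fun ω => S W ω i k - W i k) ω ∂μ = 0
      rw [← h2, integral_congr_ae h]
      rw [integral_congr_ae (g := fun _ => (0 : ℝ))]
      · simp
      · filter_upwards [hc i k] with ω hω
        rw [Pi.mul_apply, hω]; simp
  simp only [loss_qf]
  rw [← ofReal_integral_eq_lintegral_ofReal (integrable_finsetSum _ fun i _ => (key i).1)
    (Filter.Eventually.of_forall fun ω => Finset.sum_nonneg fun i _ => qf_nonneg hH _),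
    integral_finsetSum _ fun i _ => (key i).1]
  have hnn : ∀ i k, 0 ≤ H k k * (Int.fract (W i k) * (1 - Int.fract (W i k))) := fun i k =>
    mul_nonneg hH.diag_nonneg (stoch_nonneg _)
  rw [ENNReal.ofReal_sum_of_nonneg fun i _ => by
    rw [(key i).2]; exact Finset.sum_nonneg fun k _ => hnn i k]
  refine Finset.sum_congr rfl fun i _ => ?_
  rw [(key i).2, ENNReal.ofReal_sum_of_nonneg fun k _ => hnn i k]
  exact Finset.sum_congr rfl fun k _ => ENNReal.ofReal_mul hH.diag_nonneg

lemma stoch_plain_worst {m n : ℕ} {Ω : Type} [MeasurableSpace Ω] {μ : Measure Ω}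
    [IsProbabilityMeasure μ] {S : Matrix (Fin m) (Fin n) ℝ → Ω → Matrix (Fin m) (Fin n) ℝ}
    (hS : IsStochMethod μ S 0) {H : Matrix (Fin n) (Fin n) ℝ} (hH : H.PosSemidef) :
    Lworst μ S H = ENNReal.ofReal ((m : ℝ) / 4 * H.trace) := by
  have e : ENNReal.ofReal ((m : ℝ) / 4 * H.trace) =
      ∑ _i : Fin m, ∑ k, ENNReal.ofReal (H k k) * ENNReal.ofReal (1 / 4) := by
    rw [sum_const_eq (fun k => H k k) (fun k => hH.diag_nonneg) (1 / 4)]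
    congr 1
    simp only [Matrix.trace, Matrix.diag_apply]; ring
  unfold Lworst
  simp only [stoch_plain hS hH]
  rw [e]
  apply le_antisymm
  · refine iSup_le fun W => Finset.sum_le_sum fun i _ => Finset.sum_le_sum fun k _ => ?_
    gcongr
    exact stoch_le _
  · refine le_iSup_of_le (Matrix.of fun _ _ => 1 / 2) ?_
    refine Finset.sum_le_sum fun i _ => Finset.sum_le_sum fun k _ => ?_
    have : Int.fract (1 / 2 : ℝ) = 1 / 2 := Int.fract_eq_self.2 ⟨by norm_num, by norm_num⟩
    simp only [Matrix.of_apply, this]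
    norm_num

lemma stoch_plain_avg {m n : ℕ} {Ω : Type} [MeasurableSpace Ω] {μ : Measure Ω}
    [IsProbabilityMeasure μ] {S : Matrix (Fin m) (Fin n) ℝ → Ω → Matrix (Fin m) (Fin n) ℝ}
    (hS : IsStochMethod μ S 0) {H : Matrix (Fin n) (Fin n) ℝ} (hH : H.PosSemidef) :
    Lavg μ S H = ENNReal.ofReal ((m : ℝ) / 6 * H.trace) := by
  have e : ENNReal.ofReal ((m : ℝ) / 6 * H.trace) =
      ∑ _i : Fin m, ∑ k, ENNReal.ofReal (H k k) * ENNReal.ofReal (1 / 6) := by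
    rw [sum_const_eq (fun k => H k k) (fun k => hH.diag_nonneg) (1 / 6)]
    congr 1
    simp only [Matrix.trace, Matrix.diag_apply]; ring
  unfold Lavg
  simp only [stoch_plain hS hH]
  rw [e]
  have hg : ∀ k : Fin n, Measurable fun w : Fin n → ℝ =>
      ENNReal.ofReal (H k k) * ENNReal.ofReal (Int.fract (w k) * (1 - Int.fract (w k))) := by
    intro k
    have := (measurable_fract (R := ℝ)).comp (measurable_pi_apply (X := fun _ : Fin n => ℝ) k)
    exact ((this.mul (measurable_const.sub this)).ennreal_ofReal).const_mul _
  have hrow : ∀ (i : Fin m) (k : Fin n), Measurable fun W : Matrix (Fin m) (Fin n) ℝ =>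
      ENNReal.ofReal (H k k) * ENNReal.ofReal (Int.fract (W i k) * (1 - Int.fract (W i k))) :=
    fun i k => (hg k).comp (measurable_pi_apply (X := fun _ : Fin m => Fin n → ℝ) i)
  rw [lintegral_finsetSum _ fun i _ => Finset.measurable_sum _ fun k _ => hrow i k]
  refine Finset.sum_congr rfl fun i _ => ?_
  rw [lintegral_finsetSum _ fun k _ => hrow i k]
  refine Finset.sum_congr rfl fun k _ => ?_
  refine (box_lintegral_row i _ (hg k)).trans (nu_lintegral_coord k _ (hg k) _ fun w => ?_)
  have := stoch_int 0
  simp only [psi_stoch, add_zero] at this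
  simp only [update_self]
  rw [lintegral_const_mul, this]
  exact (measurable_fract.mul (measurable_const.sub measurable_fract)).ennreal_ofReal

lemma er_bound (x : ℝ) : |((round x : ℤ) : ℝ) - x| ≤ 1 := by
  rw [abs_sub_comm]; linarith [abs_sub_round x]

lemma measurable_er : Measurable fun x : ℝ => ((round x : ℤ) : ℝ) - x :=
  measurable_rd.sub measurable_id

lemma er_mean : ∫ x in Set.Icc (0 : ℝ) 1, (((round x : ℤ) : ℝ) - x) = 0 := by
  have hper : Periodic (fun x : ℝ => ((round x : ℤ) : ℝ) - x) 1 := by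
    intro x; simp
  have h := hper.intervalIntegral_add_eq 0 (-1 / 2)
  rw [integral_Icc_eq_integral_Ioc, ← intervalIntegral.integral_of_le zero_le_one]
  rw [zero_add] at h
  rw [h]
  have : ∫ x in (-1 / 2 : ℝ)..(-1 / 2 + 1), (((round x : ℤ) : ℝ) - x)
      = ∫ x in (-1 / 2 : ℝ)..(-1 / 2 + 1), -x := by
    refine intervalIntegral.integral_congr_ae ?_
    have : ∀ᵐ x : ℝ, x ≠ 1 / 2 := by simp [ae_iff]
    filter_upwards [this] with x hx hx2
    rw [Set.uIoc_of_le (by norm_num)] at hx2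
    have h2 : x < 1 / 2 := lt_of_le_of_ne (by linarith [hx2.2]) hx
    have : round x = 0 := by
      rw [round_eq, Int.floor_eq_iff]; push_cast; constructor <;> linarith [hx2.1]
    rw [this]; simp
  rw [this, intervalIntegral.integral_neg, integral_id]; norm_num

lemma er_sq : ∫ x in Set.Icc (0 : ℝ) 1, (((round x : ℤ) : ℝ) - x) ^ 2 = 1 / 12 := by
  have h := near_int 0
  simp only [psi_near, add_zero] at h
  rw [integral_eq_lintegral_of_nonneg_ae (Filter.Eventually.of_forall fun ω => sq_nonneg _)
    (measurable_er.pow_const 2).aestronglyMeasurable, h, ENNReal.toReal_ofReal (by norm_num)]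

lemma near_plain_avg {m n : ℕ} {Ω : Type} [MeasurableSpace Ω] {μ : Measure Ω}
    [IsProbabilityMeasure μ] {S : Matrix (Fin m) (Fin n) ℝ → Ω → Matrix (Fin m) (Fin n) ℝ}
    (hS : IsNearestMethod μ S 0) {H : Matrix (Fin n) (Fin n) ℝ} (hH : H.PosSemidef) :
    Lavg μ S H = ENNReal.ofReal ((m : ℝ) / 12 * H.trace) := by
  have e : ∀ W : Matrix (Fin m) (Fin n) ℝ, ∫⁻ ω, ENNReal.ofReal (proxyLoss H W (S W ω)) ∂μ =
      ∑ i, ENNReal.ofReal (qf H fun k => ((round (W i k) : ℤ) : ℝ) - W i k) := by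
    intro W
    rw [← ENNReal.ofReal_sum_of_nonneg fun i _ => qf_nonneg hH _]
    rw [lintegral_congr_ae (g := fun _ => ENNReal.ofReal
      (∑ i, qf H fun k => ((round (W i k) : ℤ) : ℝ) - W i k))]
    · simp
    · filter_upwards [(hS W).2] with ω hω
      simp only [xv_eq, xv_zero] at hω
      simp only [loss_qf, hω]
  have key := qf_integral (μ := nu n) H (fun w k => ((round (w k) : ℤ) : ℝ) - w k)
    (fun _ => 1 / 12) (fun k => measurable_er.comp (measurable_pi_apply k))
    (fun k => Filter.Eventually.of_forall fun w => er_bound _)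
    (fun k => by
      unfold nu
      exact (integral_comp_eval (X := fun _ : Fin n => ℝ)
        (μ := fun _ : Fin n => (volume : Measure ℝ).restrict (Set.Icc 0 1)) (i := k)
        (f := fun x : ℝ => (((round x : ℤ) : ℝ) - x) ^ 2)
        (measurable_er.pow_const 2).aestronglyMeasurable).trans er_sq)
    (fun j k hjk => by
      have hI := ProbabilityTheory.iIndepFun_pi
        (μ := fun _ : Fin n => (volume : Measure ℝ).restrict (Set.Icc 0 1))
        (X := fun _ x => ((round x : ℤ) : ℝ) - x) (fun _ => measurable_er.aemeasurable)
      have h2 := (hI.indepFun hjk.ne).integral_mul_eq_mul_integral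
        (measurable_er.comp (measurable_pi_apply j)).aestronglyMeasurable
        (measurable_er.comp (measurable_pi_apply k)).aestronglyMeasurable
      unfold nu
      have h3 := (integral_comp_eval (X := fun _ : Fin n => ℝ)
        (μ := fun _ : Fin n => (volume : Measure ℝ).restrict (Set.Icc 0 1)) (i := j)
        (f := fun x : ℝ => (((round x : ℤ) : ℝ) - x))
        measurable_er.aestronglyMeasurable).trans er_mean
      refine h2.trans ?_
      rw [h3, zero_mul])
  have hqm : Measurable fun w : Fin n → ℝ =>
      ENNReal.ofReal (qf H fun k => ((round (w k) : ℤ) : ℝ) - w k) := by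
    have : ∀ k : Fin n, Measurable fun w : Fin n → ℝ => ((round (w k) : ℤ) : ℝ) - w k :=
      fun k => measurable_er.comp (measurable_pi_apply k)
    unfold qf
    exact (Finset.measurable_sum _ fun j _ => Finset.measurable_sum _ fun k _ =>
      ((this j).mul (this k)).const_mul _).ennreal_ofReal
  unfold Lavg
  simp only [e]
  have hrow : ∀ i : Fin m, Measurable fun W : Matrix (Fin m) (Fin n) ℝ =>
      ENNReal.ofReal (qf H fun k => ((round (W i k) : ℤ) : ℝ) - W i k) :=
    fun i => hqm.comp (measurable_pi_apply (X := fun _ : Fin m => Fin n → ℝ) i)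
  rw [lintegral_finsetSum _ fun i _ => hrow i]
  have e2 : ∀ i : Fin m, ∫⁻ W in unitBox m n,
      ENNReal.ofReal (qf H fun k => ((round (W i k) : ℤ) : ℝ) - W i k)
      = ENNReal.ofReal (∑ k, H k k * (1 / 12)) := by
    intro i
    refine (box_lintegral_row i _ hqm).trans ?_
    rw [← ofReal_integral_eq_lintegral_ofReal key.1
      (Filter.Eventually.of_forall fun w => qf_nonneg hH _), key.2]
  rw [Finset.sum_congr rfl fun i _ => e2 i, Finset.sum_const, Finset.card_univ, Fintype.card_fin,
    nsmul_eq_mul, ← ENNReal.ofReal_natCast, ← ENNReal.ofReal_mul (Nat.cast_nonneg m),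
    ← Finset.sum_mul]
  congr 1
  simp only [Matrix.trace, Matrix.diag_apply]; ring

lemma trace_eq_of_charpoly {n : ℕ} {H H' : Matrix (Fin n) (Fin n) ℝ}
    (h : H'.charpoly = H.charpoly) : H'.trace = H.trace := by
  rcases Nat.eq_zero_or_pos n with rfl | hn
  · simp [Matrix.trace]
  · have : Nonempty (Fin n) := ⟨⟨0, hn⟩⟩
    rw [trace_eq_neg_charpoly_coeff, trace_eq_neg_charpoly_coeff, h]

lemma exists_diag {n : ℕ} {H : Matrix (Fin n) (Fin n) ℝ} (hH : H.PosSemidef) :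
    ∃ D : Matrix (Fin n) (Fin n) ℝ, D.PosSemidef ∧ D.charpoly = H.charpoly ∧
      (∀ i j, i ≠ j → D i j = 0) ∧ (∀ i, 0 ≤ D i i) ∧
      D = ((0 : Matrix (Fin n) (Fin n) ℝ) + 1) * D * ((0 : Matrix (Fin n) (Fin n) ℝ) + 1)ᵀ := by
  have hnn : ∀ i, 0 ≤ hH.1.eigenvalues i := hH.eigenvalues_nonneg
  refine ⟨diagonal hH.1.eigenvalues, Matrix.PosSemidef.diagonal hnn, ?_, ?_, ?_, ?_⟩
  · rw [charpoly_diagonal, hH.1.charpoly_eq]; rfl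
  · intro i j h; exact diagonal_apply_ne _ h
  · intro i; rw [diagonal_apply_eq]; exact hnn i
  · simp

end QuIPProof

/-- For any positive semidefinite `H`, the supremum (a maximum)
over all positive semidefinite `H̃` with the same eigenvalues (with multiplicity)
as `H` of the worst-case proxy loss of LDLQ equals `(m/4)·tr H`, which is the
worst-case proxy loss of plain stochastic rounding on `H`; and the corresponding
supremum of the average-case proxy loss of LDLQ equals `(m/c)·tr H`, with `c = 12`
for nearest rounding (matching plain nearest rounding on `H`) and `c = 6` for
standard unbiased stochastic rounding (matching plain stochastic rounding on `H`). -/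
theorem ldlq_spectral_sup_matches_plain_rounding {m n : ℕ}
    (H : Matrix (Fin n) (Fin n) ℝ) (hH : H.PosSemidef)
    {Ω : Type} [MeasurableSpace Ω] (μ : Measure Ω) [IsProbabilityMeasure μ]
    (Stoch : Matrix (Fin m) (Fin n) ℝ → Ω → Matrix (Fin m) (Fin n) ℝ)
    (hStoch : IsStochMethod μ Stoch 0)
    {Ω' : Type} [MeasurableSpace Ω'] (μ' : Measure Ω') [IsProbabilityMeasure μ']
    (Near : Matrix (Fin m) (Fin n) ℝ → Ω' → Matrix (Fin m) (Fin n) ℝ)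
    (hNear : IsNearestMethod μ' Near 0) :
    IsGreatest (ldlqWorstLosses m n H) (ENNReal.ofReal ((m : ℝ) / 4 * H.trace)) ∧
    Lworst μ Stoch H = ENNReal.ofReal ((m : ℝ) / 4 * H.trace) ∧
    IsGreatest (ldlqAvgLosses m n H true) (ENNReal.ofReal ((m : ℝ) / 12 * H.trace)) ∧
    Lavg μ' Near H = ENNReal.ofReal ((m : ℝ) / 12 * H.trace) ∧
    IsGreatest (ldlqAvgLosses m n H false) (ENNReal.ofReal ((m : ℝ) / 6 * H.trace)) ∧
    Lavg μ Stoch H = ENNReal.ofReal ((m : ℝ) / 6 * H.trace) := by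
  obtain ⟨D, hDp, hDc, hDo, hD0, hDe⟩ := QuIPProof.exists_diag hH
  have hDt := QuIPProof.trace_eq_of_charpoly hDc
  refine ⟨⟨?_, ?_⟩, QuIPProof.stoch_plain_worst hStoch hH, ⟨?_, ?_⟩,
    QuIPProof.near_plain_avg hNear hH, ⟨?_, ?_⟩, QuIPProof.stoch_plain_avg hStoch hH⟩
  · refine ⟨D, 0, D, Ω, inferInstance, μ, Stoch, inferInstance, hDp, hDc,
      QuIPProof.strictUpper_zero, hDo, hD0, hDe, Or.inr hStoch, ?_⟩
    rw [QuIPProof.stoch_plain_worst hStoch hDp, hDt]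
  · rintro x ⟨H', U, D', Ω₁, _, μ₁, A, _, _, hc, hU, hDo', hD0', he, hA, rfl⟩
    rw [← QuIPProof.trace_eq_of_charpoly hc]
    rcases hA with hA | hA
    · exact QuIPProof.worst_le hU hDo' hD0' he (fun W => (hA W).1) (QuIPProof.isKer_near hA)
        (fun _ => le_rfl) (fun _ => zero_le_one)
        (fun x => (QuIPProof.psi_near x).le.trans (QuIPProof.near_le x))
    · exact QuIPProof.worst_le hU hDo' hD0' he (fun W => (hA W).1) (QuIPProof.isKer_stoch hU hA)
        (fun x => Int.fract_nonneg x) (fun x => (Int.fract_lt_one x).le)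
        (fun x => (QuIPProof.psi_stoch x).le.trans (QuIPProof.stoch_le x))
  · refine ⟨D, 0, D, Ω', inferInstance, μ', Near, inferInstance, hDp, hDc,
      QuIPProof.strictUpper_zero, hDo, hD0, hDe, by simpa using hNear, ?_⟩
    rw [QuIPProof.near_plain_avg hNear hDp, hDt]
  · rintro x ⟨H', U, D', Ω₁, _, μ₁, A, _, _, hc, hU, hDo', hD0', he, hA, rfl⟩
    rw [← QuIPProof.trace_eq_of_charpoly hc]
    have hA : IsNearestMethod μ₁ A U := by simpa using hA
    have := QuIPProof.avg_le hU hDo' hD0' he (fun W => (hA W).1) measurable_const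
      QuIPProof.measurable_rd measurable_const (QuIPProof.isKer_near hA)
      (fun _ => le_rfl) (fun _ => zero_le_one) (1 / 12) (by norm_num) QuIPProof.near_int
    rwa [mul_one_div] at this
  · refine ⟨D, 0, D, Ω, inferInstance, μ, Stoch, inferInstance, hDp, hDc,
      QuIPProof.strictUpper_zero, hDo, hD0, hDe, by simpa using hStoch, ?_⟩
    rw [QuIPProof.stoch_plain_avg hStoch hDp, hDt]
  · rintro x ⟨H', U, D', Ω₁, _, μ₁, A, _, _, hc, hU, hDo', hD0', he, hA, rfl⟩
    rw [← QuIPProof.trace_eq_of_charpoly hc]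
    have hA : IsStochMethod μ₁ A U := by simpa using hA
    have := QuIPProof.avg_le hU hDo' hD0' he (fun W => (hA W).1) measurable_fract
      QuIPProof.measurable_fl (QuIPProof.measurable_fl.add_const 1) (QuIPProof.isKer_stoch hU hA)
      (fun x => Int.fract_nonneg x) (fun x => (Int.fract_lt_one x).le) (1 / 6) (by norm_num)
      QuIPProof.stoch_int
    rwa [mul_one_div] at this
end

section
/- Let H ∈ ℝ^{n×n} be a positive semidefinite symmetric matrix with n = q_1·q_2···q_k, and let V_1, …, V_k be independent Haar-uniform random orthogonal matrices with V_i ∈ ℝ^{q_i×q_i}; set V = V_1 ⊗ V_2 ⊗ ⋯ ⊗ V_k. Then there exist global constants A and C, independent of n and k, such that for every δ ∈ (0,1], with probability at least 1 − δ the matrix V H V^T is μ_H-incoherent with μ_H = A^{k/2}·(log(Ckn²/δ))^{k/2}. -/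
open MeasureTheory Matrix

instance matMeasurableSpace {ι κ : Type*} : MeasurableSpace (Matrix ι κ ℝ) :=
  inferInstanceAs (MeasurableSpace (ι → κ → ℝ))

/-- A symmetric matrix `H` is `μc`-incoherent if it has an eigendecomposition
`H = Q Λ Qᵀ` (`Q` orthogonal, `Λ` diagonal) with `|Q i j| ≤ μc / √n`. -/
def IncoherentH {ι : Type*} [Fintype ι] [DecidableEq ι]
    (H : Matrix ι ι ℝ) (μc : ℝ) : Prop :=
  ∃ Q Λ : Matrix ι ι ℝ,
    Q * Qᵀ = 1 ∧ (∀ i j, i ≠ j → Λ i j = 0) ∧ H = Q * Λ * Qᵀ ∧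
    ∀ i j, |Q i j| ≤ μc / Real.sqrt (Fintype.card ι)

/-- `ν` is the Haar probability measure on the orthogonal group `O(q)`, viewed
as a measure on `q × q` real matrices: it is a probability measure carried by
the orthogonal matrices and invariant under left translation by any orthogonal
matrix. -/
def IsHaarOrthogonal {q : ℕ} (ν : Measure (Matrix (Fin q) (Fin q) ℝ)) : Prop :=
  IsProbabilityMeasure ν ∧
  ν {V | V * Vᵀ = 1} = 1 ∧
  ∀ O : Matrix (Fin q) (Fin q) ℝ, O * Oᵀ = 1 → ν.map (fun V => O * V) = ν

/-- The Kronecker product `V_1 ⊗ V_2 ⊗ ⋯ ⊗ V_k` of a family of square matrices,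
as a matrix indexed by tuples. -/
def kronFamily {k : ℕ} {q : Fin k → ℕ}
    (V : ∀ i, Matrix (Fin (q i)) (Fin (q i)) ℝ) :
    Matrix (∀ i, Fin (q i)) (∀ i, Fin (q i)) ℝ :=
  Matrix.of fun a b => ∏ i, V i (a i) (b i)


lemma khin {q : ℕ} (m : ℕ) (hm : 0 < m) (z : Fin q → ℝ) :
    ∑ ε ∈ Fintype.piFinset (fun _ : Fin q => ({1, -1} : Finset ℝ)), (∑ c, ε c * z c) ^ (2 * m)
      ≤ 2 ^ q * ((4 * Real.exp 1 * m) ^ m * (∑ c, z c ^ 2) ^ m) := by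
  have hmR : (0 : ℝ) < m := by exact_mod_cast hm
  have hm1 : (1 : ℝ) ≤ m := by exact_mod_cast hm
  set Z := ∑ c, z c ^ 2 with hZ
  have hZ0 : 0 ≤ Z := Finset.sum_nonneg fun _ _ => sq_nonneg _
  rcases hZ0.eq_or_lt with h0 | hpos
  · have hz : ∀ c, z c = 0 := by
      intro c
      have := (Finset.sum_eq_zero_iff_of_nonneg (s := Finset.univ) (f := fun c => z c ^ 2)
        (fun _ _ => sq_nonneg _)).1 (by rw [← hZ]; exact h0.symm) c (Finset.mem_univ _)
      simpa using this
    have : ∀ ε : Fin q → ℝ, (∑ c, ε c * z c) ^ (2 * m) = 0 := by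
      intro ε
      simp [hz, hm.ne']
    simp only [this, Finset.sum_const_zero]
    positivity
  set t := Real.sqrt (2 * m / Z) with ht
  have ht2 : t ^ 2 = 2 * m / Z := Real.sq_sqrt (by positivity)
  have htm : t ^ (2 * m) = (2 * m / Z) ^ m := by rw [pow_mul, ht2]
  have hexp : ∀ s : ℝ, s ^ 2 = 2 * m / Z →
      ∑ ε ∈ Fintype.piFinset (fun _ : Fin q => ({1, -1} : Finset ℝ)),
        Real.exp (s * ∑ c, ε c * z c) ≤ 2 ^ q * Real.exp m := by
    intro s hs
    have h1 : ∀ ε : Fin q → ℝ, Real.exp (s * ∑ c, ε c * z c) =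
        ∏ c, Real.exp (s * (ε c * z c)) := by
      intro ε
      rw [Finset.mul_sum, Real.exp_sum]
    simp only [h1]
    rw [← Finset.prod_univ_sum (fun _ : Fin q => ({1, -1} : Finset ℝ))
      (fun c e => Real.exp (s * (e * z c)))]
    have h2 : ∀ c, ∑ e ∈ ({1, -1} : Finset ℝ), Real.exp (s * (e * z c))
        ≤ 2 * Real.exp ((s * z c) ^ 2 / 2) := by
      intro c
      rw [Finset.sum_pair (by norm_num)]
      have := Real.cosh_le_exp_half_sq (s * z c)
      rw [Real.cosh_eq] at this
      have e1 : s * (1 * z c) = s * z c := by ring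
      have e2 : s * (-1 * z c) = -(s * z c) := by ring
      rw [e1, e2]; linarith
    calc _ ≤ ∏ c, (2 * Real.exp ((s * z c) ^ 2 / 2)) :=
          Finset.prod_le_prod (fun c _ => Finset.sum_nonneg fun _ _ => (Real.exp_pos _).le)
            (fun c _ => h2 c)
      _ = 2 ^ q * Real.exp m := by
          rw [Finset.prod_mul_distrib, ← Real.exp_sum]
          simp only [Finset.prod_const, Finset.card_univ, Fintype.card_fin, mul_pow]
          rw [← Finset.sum_div, ← Finset.mul_sum, ← hZ, hs]
          congr 2
          field_simp
  have hpt : ∀ x : ℝ, x ^ (2 * m) ≤ ((2 * m).factorial : ℝ) * (Real.exp x + Real.exp (-x)) := by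
    intro x
    have h := Real.pow_div_factorial_le_exp |x| (abs_nonneg x) (2 * m)
    rw [div_le_iff₀ (by positivity), (even_two_mul m).pow_abs] at h
    have : Real.exp |x| ≤ Real.exp x + Real.exp (-x) := by
      rcases abs_choice x with h | h <;> rw [h] <;> linarith [Real.exp_pos x, Real.exp_pos (-x)]
    calc _ ≤ _ := h
      _ ≤ _ := by rw [mul_comm]; gcongr
  have hS : (∑ ε ∈ Fintype.piFinset (fun _ : Fin q => ({1, -1} : Finset ℝ)),
      (∑ c, ε c * z c) ^ (2 * m)) * (2 * m / Z) ^ m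
      ≤ (2 * m : ℝ) ^ (2 * m) * (2 * (2 ^ q * Real.exp m)) := by
    rw [← htm, Finset.sum_mul]
    calc _ ≤ ∑ ε ∈ Fintype.piFinset (fun _ : Fin q => ({1, -1} : Finset ℝ)),
          ((2 * m).factorial : ℝ) * (Real.exp (t * ∑ c, ε c * z c)
            + Real.exp ((-t) * ∑ c, ε c * z c)) := by
          refine Finset.sum_le_sum fun ε _ => ?_
          have := hpt (t * ∑ c, ε c * z c)
          rw [mul_pow, mul_comm] at this
          rwa [neg_mul]
      _ ≤ ((2 * m).factorial : ℝ) * (2 * (2 ^ q * Real.exp m)) := by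
          rw [← Finset.mul_sum, Finset.sum_add_distrib]
          have a1 := hexp t ht2
          have a2 := hexp (-t) (by rw [neg_sq, ht2])
          gcongr
          linarith
      _ ≤ _ := by
          gcongr
          exact_mod_cast Nat.factorial_le_pow (2 * m)
  rw [div_pow, mul_div_assoc', div_le_iff₀ (by positivity)] at hS
  have h2m : (0:ℝ) < (2 * m) ^ m := by positivity
  refine le_of_mul_le_mul_right (hS.trans ?_) h2m
  have e1 : Real.exp m = Real.exp 1 ^ m := by rw [← Real.exp_nat_mul, mul_one]
  have e2 : (2:ℝ) ≤ 2 ^ m := by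
    calc (2:ℝ) = 2 ^ 1 := by norm_num
      _ ≤ 2 ^ m := pow_le_pow_right₀ (by norm_num) hm
  have e3 : (4 * Real.exp 1 * m) ^ m = 2 ^ m * ((2 * m) ^ m * Real.exp 1 ^ m) := by
    rw [← mul_pow, ← mul_pow]; ring
  rw [e1, e3, two_mul m, pow_add]
  calc _ = (2:ℝ) * ((2 * m) ^ m * (2 * m) ^ m * 2 ^ q * Real.exp 1 ^ m * Z ^ m) := by ring
    _ ≤ 2 ^ m * ((2 * m) ^ m * (2 * m) ^ m * 2 ^ q * Real.exp 1 ^ m * Z ^ m) := by gcongr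
    _ = _ := by ring

/-- Householder -/
lemma exists_orth {q : ℕ} (a : Fin q) (x : Fin q → ℝ) (hx : ∑ c, x c ^ 2 = 1) :
    ∃ O : Matrix (Fin q) (Fin q) ℝ, O * Oᵀ = 1 ∧ ∀ c, O a c = x c := by
  set v : Fin q → ℝ := x - Pi.single a 1 with hv
  have hvv : v ⬝ᵥ v = 2 - 2 * x a := by
    have : x ⬝ᵥ x = 1 := by rw [← hx]; simp [dotProduct, sq]
    simp [hv, sub_dotProduct, dotProduct_sub, this]; ring
  by_cases h0 : v ⬝ᵥ v = 0
  · refine ⟨1, by simp, fun c => ?_⟩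
    have : v = 0 := dotProduct_self_eq_zero.1 h0
    have : x c - (Pi.single a 1 : Fin q → ℝ) c = 0 := congrFun this c
    simp [Matrix.one_apply, Pi.single_apply] at this ⊢
    rw [← sub_eq_zero, ← neg_eq_zero]; simp only [eq_comm] at this ⊢; linarith
  · refine ⟨1 - (2 / (v ⬝ᵥ v)) • vecMulVec v v, ?_, fun c => ?_⟩
    · have ht : (1 - (2 / (v ⬝ᵥ v)) • vecMulVec v v)ᵀ = 1 - (2 / (v ⬝ᵥ v)) • vecMulVec v v := by
        simp [transpose_sub, transpose_smul, transpose_vecMulVec]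
      rw [ht]
      simp only [sub_mul, mul_sub, one_mul, mul_one, smul_mul_smul_comm, vecMulVec_mul_vecMulVec]
      rw [vecMulVec_smul, smul_smul]
      have : 2 / (v ⬝ᵥ v) * (2 / (v ⬝ᵥ v)) * (v ⬝ᵥ v) = 2 / (v ⬝ᵥ v) + 2 / (v ⬝ᵥ v) := by
        field_simp; ring
      rw [this, add_smul]; abel
    · have hva : v a = x a - 1 := by simp [hv]
      simp only [Matrix.sub_apply, Matrix.smul_apply, vecMulVec_apply, smul_eq_mul, hva]
      have : 2 / (v ⬝ᵥ v) * ((x a - 1) * v c) = - v c := by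
        rw [div_mul_eq_mul_div, div_eq_iff h0, hvv]; ring
      rw [this]
      simp [hv, Matrix.one_apply, Pi.single_apply, eq_comm]

lemma meas_entry {ι κ : Type*} (i : ι) (j : κ) : Measurable (fun V : Matrix ι κ ℝ => V i j) :=
  (measurable_pi_apply j).comp (measurable_pi_apply (X := fun _ : ι => κ → ℝ) i)

lemma meas_lmul {q : ℕ} (O : Matrix (Fin q) (Fin q) ℝ) :
    Measurable (fun V : Matrix (Fin q) (Fin q) ℝ => O * V) := by
  refine measurable_pi_iff.2 fun i => measurable_pi_iff.2 fun j => ?_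
  simp only [Matrix.mul_apply]
  exact Finset.measurable_sum _ fun c _ => (meas_entry c j).const_mul _

lemma haar_ae {q : ℕ} {ν : Measure (Matrix (Fin q) (Fin q) ℝ)} (h : IsHaarOrthogonal ν) :
    ∀ᵐ V ∂ν, V * Vᵀ = 1 := by
  have := h.1
  have hs : MeasurableSet {V : Matrix (Fin q) (Fin q) ℝ | V * Vᵀ = 1} := by
    have : {V : Matrix (Fin q) (Fin q) ℝ | V * Vᵀ = 1} =
        ⋂ i, ⋂ j, {V | ∑ c, V i c * V j c = (1 : Matrix (Fin q) (Fin q) ℝ) i j} := by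
      ext V
      simp only [Set.mem_ofPred_eq, Set.mem_iInter, ← Matrix.ext_iff, Matrix.mul_apply,
        Matrix.transpose_apply]
    rw [this]
    refine MeasurableSet.iInter fun i => MeasurableSet.iInter fun j => ?_
    exact measurableSet_eq_fun
      (Finset.measurable_sum _ fun c _ => (meas_entry i c).mul (meas_entry j c)) measurable_const
  exact (prob_compl_eq_zero_iff hs).2 h.2.1

lemma meas_row {q : ℕ} (a : Fin q) (w : Fin q → ℝ) :
    Measurable (fun V : Matrix (Fin q) (Fin q) ℝ => ∑ b, V a b * w b) :=
  Finset.measurable_sum _ fun b _ => (meas_entry a b).mul_const _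

lemma moment_one {q : ℕ} {ν : Measure (Matrix (Fin q) (Fin q) ℝ)} (h : IsHaarOrthogonal ν)
    (a : Fin q) (w : Fin q → ℝ) (m : ℕ) (hm : 0 < m) :
    ∫⁻ V, ENNReal.ofReal ((∑ b, V a b * w b) ^ (2 * m)) ∂ν ≤
      ENNReal.ofReal ((4 * Real.exp 1 * m / q) ^ m * (∑ b, w b ^ 2) ^ m) := by
  have := h.1
  have hq : 0 < q := a.pos
  have hqR : (0 : ℝ) < q := by exact_mod_cast hq
  set S := Fintype.piFinset (fun _ : Fin q => ({1, -1} : Finset ℝ)) with hS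
  have hcard : S.card = 2 ^ q := by
    rw [hS, Fintype.card_piFinset]
    have : ({1, -1} : Finset ℝ).card = 2 := Finset.card_pair (by norm_num)
    simp [this]
  set I := ∫⁻ V, ENNReal.ofReal ((∑ b, V a b * w b) ^ (2 * m)) ∂ν with hI
  have hε : ∀ ε ∈ S, I = ∫⁻ V, ENNReal.ofReal
      ((∑ c, ε c * (∑ b, V c b * w b)) ^ (2 * m) / (q : ℝ) ^ m) ∂ν := by
    intro ε hε
    have hsq : ∀ c, ε c ^ 2 = 1 := by
      intro c
      have := Fintype.mem_piFinset.1 hε c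
      simp only [Finset.mem_insert, Finset.mem_singleton] at this
      rcases this with h | h <;> rw [h] <;> norm_num
    obtain ⟨O, hO, hOa⟩ := exists_orth a (fun c => ε c / Real.sqrt q) (by
      simp only [div_pow, hsq, Real.sq_sqrt hqR.le]
      simp; field_simp)
    rw [hI]
    conv_lhs => rw [← h.2.2 O hO]
    rw [lintegral_map (((meas_row a w).pow_const _).ennreal_ofReal) (meas_lmul O)]
    refine lintegral_congr fun V => ?_
    congr 1
    have : ∑ b, (O * V) a b * w b = (∑ c, ε c * (∑ b, V c b * w b)) / Real.sqrt q := by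
      simp only [Matrix.mul_apply, hOa, Finset.sum_mul, Finset.mul_sum, Finset.sum_div]
      rw [Finset.sum_comm]
      refine Finset.sum_congr rfl fun c _ => Finset.sum_congr rfl fun b _ => ?_
      ring
    rw [this, div_pow, pow_mul (Real.sqrt q), Real.sq_sqrt hqR.le]
  have hmeas : ∀ ε : Fin q → ℝ, Measurable (fun V : Matrix (Fin q) (Fin q) ℝ => ENNReal.ofReal
      ((∑ c, ε c * (∑ b, V c b * w b)) ^ (2 * m) / (q : ℝ) ^ m)) := by
    intro ε
    exact (((Finset.measurable_sum _ fun c _ => (meas_row c w).const_mul _).pow_const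
      _).div_const _).ennreal_ofReal
  have hsum : (2 : ENNReal) ^ q * I ≤ 2 ^ q * ENNReal.ofReal
      ((4 * Real.exp 1 * m / q) ^ m * (∑ b, w b ^ 2) ^ m) := by
    calc (2 : ENNReal) ^ q * I = ∑ ε ∈ S, I := by simp [hcard]
      _ = ∑ ε ∈ S, ∫⁻ V, ENNReal.ofReal
            ((∑ c, ε c * (∑ b, V c b * w b)) ^ (2 * m) / (q : ℝ) ^ m) ∂ν :=
          Finset.sum_congr rfl hε
      _ = ∫⁻ V, ∑ ε ∈ S, ENNReal.ofReal
            ((∑ c, ε c * (∑ b, V c b * w b)) ^ (2 * m) / (q : ℝ) ^ m) ∂ν :=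
          (lintegral_finsetSum _ fun ε _ => hmeas ε).symm
      _ ≤ ∫⁻ V, 2 ^ q * ENNReal.ofReal
            ((4 * Real.exp 1 * m / q) ^ m * (∑ b, w b ^ 2) ^ m) ∂ν := by
          refine lintegral_mono_ae ?_
          filter_upwards [haar_ae h] with V hV
          rw [← ENNReal.ofReal_sum_of_nonneg (fun ε _ => by
            have : 0 ≤ (∑ c, ε c * (∑ b, V c b * w b)) ^ (2 * m) := (even_two_mul m).pow_nonneg _
            positivity)]
          have h2 : (2 : ENNReal) ^ q = ENNReal.ofReal (2 ^ q) := by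
            rw [ENNReal.ofReal_pow (by norm_num)]; simp
          rw [h2, ← ENNReal.ofReal_mul (by positivity), ← Finset.sum_div]
          refine ENNReal.ofReal_le_ofReal ?_
          have hk := khin m hm (fun c => ∑ b, V c b * w b)
          have hV' : Vᵀ * V = 1 := mul_eq_one_comm.1 hV
          have hn : ∑ c, (∑ b, V c b * w b) ^ 2 = ∑ b, w b ^ 2 := by
            have h1 : (V *ᵥ w) ⬝ᵥ (V *ᵥ w) = w ⬝ᵥ w := by
              rw [Matrix.dotProduct_mulVec, Matrix.vecMul_mulVec, hV']
              simp
            simpa [dotProduct, Matrix.mulVec, sq] using h1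
          rw [hn] at hk
          rw [div_le_iff₀ (by positivity)]
          refine hk.trans (le_of_eq ?_)
          rw [div_pow]
          field_simp
      _ = _ := by simp
  exact (ENNReal.mul_le_mul_iff_right (by positivity) (by simp)).1 hsum

lemma jensen {ι : Type*} [Fintype ι] (s y : ι → ℝ) (hs : ∀ i, 0 ≤ s i) (hy : ∀ i, 0 ≤ y i)
    (m : ℕ) (hm : 0 < m) :
    (∑ i, s i * y i) ^ m ≤ (∑ i, s i) ^ (m - 1) * ∑ i, s i * y i ^ m := by
  rcases (Finset.sum_nonneg fun i (_ : i ∈ Finset.univ) => hs i).eq_or_lt with h0 | hpos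
  · have : ∀ i, s i = 0 := fun i =>
      (Finset.sum_eq_zero_iff_of_nonneg fun i _ => hs i).1 h0.symm i (Finset.mem_univ _)
    simp [this, hm.ne']
  · set T := ∑ i, s i with hT
    have h := Real.pow_arith_mean_le_arith_mean_pow Finset.univ (fun i => s i / T) y
      (fun i _ => div_nonneg (hs i) hpos.le) (by rw [← Finset.sum_div, ← hT, div_self hpos.ne'])
      (fun i _ => hy i) m
    simp only [div_mul_eq_mul_div, ← Finset.sum_div] at h
    rw [div_pow, div_le_iff₀ (by positivity)] at h
    refine h.trans (le_of_eq ?_)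
    obtain ⟨n, rfl⟩ : ∃ n, m = n + 1 := ⟨m - 1, by omega⟩
    simp only [Nat.add_sub_cancel, pow_succ T]
    field_simp

/-- Minkowski replacement -/
lemma mink {Ω ι : Type*} [Fintype ι] [MeasurableSpace Ω] (μ : Measure Ω) (w : ι → Ω → ℝ)
    (hw : ∀ i, Measurable (w i)) (s : ι → ℝ) (hs : ∀ i, 0 ≤ s i) (R : ℝ) (hR : 0 ≤ R)
    (m : ℕ) (hm : 0 < m)
    (h : ∀ i, ∫⁻ x, ENNReal.ofReal (w i x ^ (2 * m)) ∂μ ≤ ENNReal.ofReal (R * s i ^ m)) :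
    ∫⁻ x, ENNReal.ofReal ((∑ i, w i x ^ 2) ^ m) ∂μ ≤ ENNReal.ofReal (R * (∑ i, s i) ^ m) := by
  have hae : ∀ᵐ x ∂μ, ∀ i, s i = 0 → w i x = 0 := by
    rw [ae_all_iff]
    intro i
    by_cases h0 : s i = 0
    · have := h i
      rw [h0, zero_pow hm.ne', mul_zero, ENNReal.ofReal_zero, nonpos_iff_eq_zero,
        lintegral_eq_zero_iff (((hw i).pow_const _).ennreal_ofReal)] at this
      filter_upwards [this] with x hx _
      have h1 : w i x ^ (2 * m) ≤ 0 := by simpa using hx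
      have h2 := le_antisymm h1 ((even_two_mul m).pow_nonneg _)
      exact pow_eq_zero_iff (by omega) |>.1 h2
    · filter_upwards with x hx
      exact absurd hx h0
  have hT : 0 ≤ ∑ i, s i := Finset.sum_nonneg fun i _ => hs i
  calc _ ≤ ∫⁻ x, ∑ i, ENNReal.ofReal ((∑ i, s i) ^ (m - 1) * (s i / s i ^ m)) *
          ENNReal.ofReal (w i x ^ (2 * m)) ∂μ := by
        refine lintegral_mono_ae ?_
        filter_upwards [hae] with x hx
        have hj := jensen s (fun i => w i x ^ 2 / s i) hs
          (fun i => div_nonneg (sq_nonneg _) (hs i)) m hm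
        have e1 : ∀ i, s i * (w i x ^ 2 / s i) = w i x ^ 2 := by
          intro i
          by_cases h0 : s i = 0
          · simp [h0, hx i h0]
          · field_simp
        simp only [e1] at hj
        have e2 : ∀ i, ENNReal.ofReal ((∑ i, s i) ^ (m - 1) * (s i / s i ^ m)) *
          ENNReal.ofReal (w i x ^ (2 * m)) = ENNReal.ofReal ((∑ i, s i) ^ (m - 1) *
            (s i * (w i x ^ 2 / s i) ^ m)) := by
          intro i
          have := hs i
          rw [← ENNReal.ofReal_mul (by positivity)]
          congr 1
          rw [div_pow, pow_mul]; ring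
        simp only [e2]
        rw [← ENNReal.ofReal_sum_of_nonneg (fun i _ => by have := hs i; positivity),
          ← Finset.mul_sum]
        exact ENNReal.ofReal_le_ofReal hj
    _ = ∑ i, ENNReal.ofReal ((∑ i, s i) ^ (m - 1) * (s i / s i ^ m)) *
          ∫⁻ x, ENNReal.ofReal (w i x ^ (2 * m)) ∂μ := by
        rw [lintegral_finsetSum _ fun i _ =>
          (((hw i).pow_const _).ennreal_ofReal).const_mul _]
        refine Finset.sum_congr rfl fun i _ => ?_
        rw [lintegral_const_mul _ (((hw i).pow_const _).ennreal_ofReal)]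
    _ ≤ ∑ i, ENNReal.ofReal ((∑ i, s i) ^ (m - 1) * (s i / s i ^ m)) *
          ENNReal.ofReal (R * s i ^ m) := by
        gcongr with i
        exact h i
    _ = ENNReal.ofReal (R * (∑ i, s i) ^ m) := by
        have e : ∀ i, ENNReal.ofReal ((∑ i, s i) ^ (m - 1) * (s i / s i ^ m)) *
          ENNReal.ofReal (R * s i ^ m) = ENNReal.ofReal ((∑ i, s i) ^ (m - 1) * R * s i) := by
          intro i
          have := hs i
          rw [← ENNReal.ofReal_mul (by positivity)]
          congr 1
          by_cases h0 : s i = 0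
          · simp [h0]
          · field_simp
        simp only [e]
        rw [← ENNReal.ofReal_sum_of_nonneg (fun i _ => by have := hs i; positivity),
          ← Finset.mul_sum]
        congr 1
        obtain ⟨n, rfl⟩ : ∃ n, m = n + 1 := ⟨m - 1, by omega⟩
        simp only [Nat.add_sub_cancel, pow_succ]
        ring

lemma meas_form {k : ℕ} {q : Fin k → ℕ} (a : ∀ i, Fin (q i)) (u : (∀ i, Fin (q i)) → ℝ) :
    Measurable (fun V : ∀ i, Matrix (Fin (q i)) (Fin (q i)) ℝ =>
      ∑ b : ∀ i, Fin (q i), (∏ i, V i (a i) (b i)) * u b) :=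
  Finset.measurable_sum _ fun b _ => (Finset.measurable_prod _ fun i _ =>
    (meas_entry (a i) (b i)).comp (measurable_pi_apply i)).mul_const _

lemma moment_k (m : ℕ) (hm : 0 < m) : ∀ (k : ℕ) (q : Fin k → ℕ)
    (ν : ∀ i, Measure (Matrix (Fin (q i)) (Fin (q i)) ℝ)), (∀ i, IsHaarOrthogonal (ν i)) →
    ∀ (a : ∀ i, Fin (q i)) (u : (∀ i, Fin (q i)) → ℝ),
    ∫⁻ V, ENNReal.ofReal ((∑ b : ∀ i, Fin (q i), (∏ i, V i (a i) (b i)) * u b) ^ (2 * m))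
      ∂(Measure.pi ν) ≤
      ENNReal.ofReal ((∏ i, (4 * Real.exp 1 * m / q i) ^ m) * (∑ b, u b ^ 2) ^ m) := by
  intro k
  induction k with
  | zero =>
    intro q ν hν a u
    have := fun i => (hν i).1
    simp [pow_mul]
  | succ k ih =>
    intro q ν hν a u
    have := fun i => (hν i).1
    set e := MeasurableEquiv.piFinSuccAbove
      (fun i => Matrix (Fin (q i)) (Fin (q i)) ℝ) (0 : Fin (k + 1)) with he
    have hmp := (measurePreserving_piFinSuccAbove ν (0 : Fin (k + 1))).symm
    have hF := ((meas_form a u).pow_const (2 * m)).ennreal_ofReal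
    refine (le_of_eq (hmp.lintegral_comp hF).symm).trans ?_
    refine (le_of_eq (lintegral_prod_symm _ (hF.comp hmp.measurable).aemeasurable)).trans ?_
    set q' : Fin k → ℕ := fun j => q (Fin.succAbove 0 j) with hq'
    set a' : ∀ j, Fin (q' j) := fun j => a (Fin.succAbove 0 j) with ha'
    set u' : Fin (q 0) → (∀ j, Fin (q' j)) → ℝ :=
      fun c b => u (Fin.insertNthEquiv (fun i => Fin (q i)) 0 (c, b)) with hu'
    have key : ∀ (x : Matrix (Fin (q 0)) (Fin (q 0)) ℝ)
        (y : ∀ j, Matrix (Fin (q' j)) (Fin (q' j)) ℝ),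
        ∑ b : ∀ i, Fin (q i), (∏ i, (e.symm (x, y)) i (a i) (b i)) * u b
        = ∑ c, x (a 0) c * ∑ b : ∀ j, Fin (q' j), (∏ j, y j (a' j) (b j)) * u' c b := by
      intro x y
      rw [← (Fin.insertNthEquiv (fun i => Fin (q i)) 0).sum_comp, Fintype.sum_prod_type]
      refine Finset.sum_congr rfl fun c _ => ?_
      rw [Finset.mul_sum]
      refine Finset.sum_congr rfl fun b _ => ?_
      rw [Fin.prod_univ_succAbove _ 0, ← mul_assoc]
      have h0 : (e.symm (x, y)) 0 = x := by
        exact Fin.insertNth_apply_same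
          (α := fun i => Matrix (Fin (q i)) (Fin (q i)) ℝ) 0 x y
      have h1 : ∀ j, (e.symm (x, y)) (Fin.succAbove 0 j) = y j := by
        intro j
        exact Fin.insertNth_apply_succAbove
          (α := fun i => Matrix (Fin (q i)) (Fin (q i)) ℝ) 0 x y j
      have h2 : ∀ j, (Fin.insertNthEquiv (fun i => Fin (q i)) 0 (c, b)) (Fin.succAbove 0 j)
          = b j := fun j => Fin.insertNth_apply_succAbove (α := fun i => Fin (q i)) 0 c b j
      have h3 : (Fin.insertNthEquiv (fun i => Fin (q i)) 0 (c, b)) 0 = c :=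
        Fin.insertNth_apply_same (α := fun i => Fin (q i)) 0 c b
      rw [h0, h3]
      simp only [h1, h2]
      rfl
    have hsplit : ∑ b, u b ^ 2 = ∑ c, ∑ b, u' c b ^ 2 := by
      rw [← (Fin.insertNthEquiv (fun i => Fin (q i)) 0).sum_comp, Fintype.sum_prod_type]
    have hP : 0 ≤ ∏ j, (4 * Real.exp 1 * m / (q' j : ℝ)) ^ m := by positivity
    calc _ ≤ ∫⁻ y, ENNReal.ofReal ((4 * Real.exp 1 * m / q 0) ^ m) * ENNReal.ofReal
          ((∑ c, (∑ b : ∀ j, Fin (q' j), (∏ j, y j (a' j) (b j)) * u' c b) ^ 2) ^ m)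
          ∂(Measure.pi fun j => ν (Fin.succAbove 0 j)) := by
          refine lintegral_mono fun y => ?_
          have h1 := moment_one (hν 0) (a 0)
            (fun c => ∑ b : ∀ j, Fin (q' j), (∏ j, y j (a' j) (b j)) * u' c b) m hm
          rw [ENNReal.ofReal_mul (by positivity)] at h1
          refine le_trans (le_of_eq ?_) h1
          refine lintegral_congr fun x => ?_
          exact congrArg (fun r : ℝ => ENNReal.ofReal (r ^ (2 * m))) (key x y)
      _ = ENNReal.ofReal ((4 * Real.exp 1 * m / q 0) ^ m) * ∫⁻ y, ENNReal.ofReal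
          ((∑ c, (∑ b : ∀ j, Fin (q' j), (∏ j, y j (a' j) (b j)) * u' c b) ^ 2) ^ m)
          ∂(Measure.pi fun j => ν (Fin.succAbove 0 j)) := by
          refine lintegral_const_mul _ ?_
          exact ((Finset.measurable_sum _ fun c _ =>
            (meas_form a' (u' c)).pow_const 2).pow_const m).ennreal_ofReal
      _ ≤ ENNReal.ofReal ((4 * Real.exp 1 * m / q 0) ^ m) *
          ENNReal.ofReal ((∏ j, (4 * Real.exp 1 * m / q' j) ^ m) *
            (∑ c, ∑ b, u' c b ^ 2) ^ m) := by
          gcongr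
          exact mink _ _ (fun c => meas_form a' (u' c)) (fun c => ∑ b, u' c b ^ 2)
            (fun c => Finset.sum_nonneg fun _ _ => sq_nonneg _) _ hP m hm
            (fun c => ih q' _ (fun j => hν _) a' (u' c))
      _ = _ := by
          rw [← ENNReal.ofReal_mul (by positivity), hsplit, Fin.prod_univ_succAbove _ 0,
            ← mul_assoc (_ ^ m)]

lemma kron_orth {k : ℕ} {q : Fin k → ℕ} (V : ∀ i, Matrix (Fin (q i)) (Fin (q i)) ℝ)
    (h : ∀ i, V i * (V i)ᵀ = 1) : kronFamily V * (kronFamily V)ᵀ = 1 := by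
  ext a a'
  simp only [Matrix.mul_apply, Matrix.transpose_apply, kronFamily, Matrix.of_apply,
    ← Finset.prod_mul_distrib]
  rw [← Fintype.piFinset_univ, ← Finset.prod_univ_sum (fun _ => Finset.univ)
    (fun i c => V i (a i) c * V i (a' i) c)]
  have : ∀ i, ∑ c, V i (a i) c * V i (a' i) c = if a i = a' i then 1 else 0 := by
    intro i
    have := congrFun (congrFun (h i) (a i)) (a' i)
    simpa [Matrix.mul_apply, Matrix.one_apply] using this
  simp only [this, Matrix.one_apply]
  by_cases hh : a = a'
  · simp [hh]
  · rw [if_neg hh]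
    obtain ⟨i, hi⟩ := Function.ne_iff.1 hh
    exact Finset.prod_eq_zero (Finset.mem_univ i) (if_neg hi)

lemma spectral {ι : Type*} [Fintype ι] [DecidableEq ι] (H : Matrix ι ι ℝ) (hH : H.PosSemidef) :
    ∃ Q Λ : Matrix ι ι ℝ, Q * Qᵀ = 1 ∧ (∀ i j, i ≠ j → Λ i j = 0) ∧ H = Q * Λ * Qᵀ := by
  have hA := hH.isHermitian
  refine ⟨hA.eigenvectorUnitary, diagonal hA.eigenvalues, ?_, fun i j h => ?_, ?_⟩
  · have := Unitary.coe_mul_star_self hA.eigenvectorUnitary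
    rwa [Unitary.coe_star, Matrix.star_eq_conjTranspose, Matrix.conjTranspose_eq_transpose_of_trivial] at this
  · exact Matrix.diagonal_apply_ne _ h
  · have := hA.spectral_theorem
    rw [Unitary.conjStarAlgAut_apply, Matrix.star_eq_conjTranspose,
      Matrix.conjTranspose_eq_transpose_of_trivial] at this
    exact this

lemma numeric (k n : ℕ) (hk : 0 < k) (hn : 0 < n) (δ : ℝ) (hδ : 0 < δ) (hδ1 : δ ≤ 1) :
    1 ≤ Real.log (Real.exp 1 * k * (n : ℝ) ^ 2 / δ) ∧
    ∃ m : ℕ, 0 < m ∧ (4 * Real.exp 1 * m) ^ (k * m) ≤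
      δ / (n : ℝ) ^ 2 * (8 * Real.exp 1 ^ 2 *
        Real.log (Real.exp 1 * k * (n : ℝ) ^ 2 / δ)) ^ (k * m) := by
  have hkR : (1 : ℝ) ≤ k := by exact_mod_cast hk
  have hnR : (1 : ℝ) ≤ n := by exact_mod_cast hn
  have hn2 : (1 : ℝ) ≤ (n : ℝ) ^ 2 := one_le_pow₀ hnR
  have he : (1 : ℝ) ≤ Real.exp 1 := Real.one_le_exp (by norm_num)
  set X := Real.exp 1 * k * (n : ℝ) ^ 2 / δ with hX
  have hXe : Real.exp 1 ≤ X := by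
    rw [hX, le_div_iff₀ hδ]
    calc Real.exp 1 * δ ≤ Real.exp 1 * 1 := by gcongr
      _ = Real.exp 1 * 1 * 1 := by ring
      _ ≤ Real.exp 1 * k * (n : ℝ) ^ 2 := by gcongr
  have hX0 : 0 < X := (Real.exp_pos 1).trans_le hXe
  set L := Real.log X with hL
  have hL1 : 1 ≤ L := (Real.le_log_iff_exp_le hX0).2 hXe
  refine ⟨hL1, ⌈L⌉₊, Nat.ceil_pos.2 (by linarith), ?_⟩
  set m := ⌈L⌉₊ with hm
  have h1 : L ≤ m := Nat.le_ceil _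
  have h2 : (m : ℝ) ≤ 2 * L := by
    have := Nat.ceil_lt_add_one (a := L) (by linarith)
    linarith
  have h3 : (1 : ℝ) ≤ δ / (n : ℝ) ^ 2 * Real.exp 1 ^ (k * m) := by
    have : Real.exp L ≤ Real.exp 1 ^ (k * m) := by
      rw [← Real.exp_nat_mul, mul_one]
      refine Real.exp_le_exp.2 (h1.trans ?_)
      push_cast
      nlinarith [Nat.cast_nonneg (α := ℝ) m]
    rw [hL, Real.exp_log hX0] at this
    calc (1 : ℝ) = δ / (n : ℝ) ^ 2 * (1 * 1 * (n : ℝ) ^ 2 / δ) := by field_simp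
      _ ≤ δ / (n : ℝ) ^ 2 * X := by rw [hX]; gcongr
      _ ≤ _ := by gcongr
  calc (4 * Real.exp 1 * m) ^ (k * m) ≤ (4 * Real.exp 1 * (2 * L)) ^ (k * m) := by gcongr
    _ = 1 * (4 * Real.exp 1 * (2 * L)) ^ (k * m) := by ring
    _ ≤ (δ / (n : ℝ) ^ 2 * Real.exp 1 ^ (k * m)) * (4 * Real.exp 1 * (2 * L)) ^ (k * m) := by
        gcongr
    _ = _ := by
        rw [mul_assoc, ← mul_pow]
        congr 2
        ring

theorem kron_orthogonal_incoherence_H :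
    ∃ A C : ℝ, 0 < A ∧ 0 < C ∧
      ∀ (k : ℕ) (q : Fin k → ℕ)
        (H : Matrix (∀ i, Fin (q i)) (∀ i, Fin (q i)) ℝ), H.PosSemidef →
        ∀ ν : ∀ i, Measure (Matrix (Fin (q i)) (Fin (q i)) ℝ),
          (∀ i, IsHaarOrthogonal (ν i)) →
          ∀ δ : ℝ, δ ∈ Set.Ioc (0 : ℝ) 1 →
          Measure.pi ν
            {V | ¬ IncoherentH (kronFamily V * H * (kronFamily V)ᵀ)
                (A ^ ((k : ℝ) / 2) *
                  (Real.log (C * k * (Fintype.card (∀ i, Fin (q i)) : ℝ) ^ 2 / δ))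
                    ^ ((k : ℝ) / 2))} ≤ ENNReal.ofReal δ := by
  refine ⟨8 * Real.exp 1 ^ 2, Real.exp 1, by positivity, by positivity, ?_⟩
  intro k q H hH ν hν δ ⟨hδ, hδ1⟩
  have := fun i => (hν i).1
  obtain ⟨Q, Λ, hQ, hΛ, hHQ⟩ := spectral H hH
  set n := Fintype.card (∀ i, Fin (q i)) with hn
  set μ := (8 * Real.exp 1 ^ 2) ^ ((k : ℝ) / 2) *
    (Real.log (Real.exp 1 * k * (n : ℝ) ^ 2 / δ)) ^ ((k : ℝ) / 2) with hμ
  rcases isEmpty_or_nonempty (∀ i, Fin (q i)) with hE | hne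
  · have : {V : ∀ i, Matrix (Fin (q i)) (Fin (q i)) ℝ |
        ¬ IncoherentH (kronFamily V * H * (kronFamily V)ᵀ) μ} = ∅ := by
      ext V
      simp only [Set.mem_ofPred_eq, Set.mem_empty_iff_false, iff_false, not_not]
      exact ⟨1, 1, by ext i; exact hE.elim i, fun i => hE.elim i, by ext i; exact hE.elim i,
        fun i => hE.elim i⟩
    rw [this]; simp
  have hnpos : 0 < n := Fintype.card_pos
  rcases Nat.eq_zero_or_pos k with rfl | hk
  · have : {V : ∀ i, Matrix (Fin (q i)) (Fin (q i)) ℝ |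
        ¬ IncoherentH (kronFamily V * H * (kronFamily V)ᵀ) μ} = ∅ := by
      ext V
      simp only [Set.mem_ofPred_eq, Set.mem_empty_iff_false, iff_false, not_not]
      refine ⟨1, kronFamily V * H * (kronFamily V)ᵀ, by simp,
        fun i j hij => absurd (Subsingleton.elim i j) hij, by simp, fun i j => ?_⟩
      have e : i = j := Subsingleton.elim i j
      rw [e]
      simp [hμ]
    rw [this]; simp
  obtain ⟨hL1, m, hm, hnum⟩ := numeric k n hk hnpos δ hδ hδ1
  set L := Real.log (Real.exp 1 * k * (n : ℝ) ^ 2 / δ) with hL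
  have hnR : (0 : ℝ) < n := by exact_mod_cast hnpos
  have hL0 : 0 < L := by linarith
  have hμpos : 0 < μ := by positivity
  have hμ2 : μ ^ 2 = (8 * Real.exp 1 ^ 2 * L) ^ k := by
    have hB : 0 ≤ 8 * Real.exp 1 ^ 2 * L := by positivity
    rw [hμ, ← Real.mul_rpow (by positivity) hL0.le]
    generalize 8 * Real.exp 1 ^ 2 * L = B at hB
    rw [← Real.rpow_natCast, ← Real.rpow_mul hB, ← Real.rpow_natCast,
      show (k : ℝ) / 2 * ((2 : ℕ) : ℝ) = k by push_cast; ring]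
  set t := μ / Real.sqrt n with ht
  have htpos : 0 < t := by positivity
  have ht2 : t ^ (2 * m) = (8 * Real.exp 1 ^ 2 * L) ^ (k * m) / (n : ℝ) ^ m := by
    rw [pow_mul, ht, div_pow, hμ2, Real.sq_sqrt hnR.le, div_pow, pow_mul]
  have hprod : ∏ i, (4 * Real.exp 1 * m / (q i : ℝ)) ^ m
      = (4 * Real.exp 1 * m) ^ (k * m) / (n : ℝ) ^ m := by
    have hcard : (n : ℝ) = ∏ i, (q i : ℝ) := by
      rw [hn, Fintype.card_pi]; push_cast; simp
    rw [Finset.prod_pow, Finset.prod_div_distrib, ← hcard, div_pow, pow_mul]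
    simp
  have hQ' : Qᵀ * Q = 1 := mul_eq_one_comm.1 hQ
  have hcol : ∀ j, ∑ b, Q b j ^ 2 = 1 := by
    intro j
    have := congrFun (congrFun hQ' j) j
    simpa [Matrix.mul_apply, sq] using this
  have hone : ∀ a j, Measure.pi ν {V | t < |(kronFamily V * Q) a j|}
      ≤ ENNReal.ofReal (δ / (n : ℝ) ^ 2) := by
    intro a j
    have hmom := moment_k m hm k q ν hν a (fun b => Q b j)
    rw [hcol j, one_pow, mul_one, hprod] at hmom
    have hmark := mul_meas_ge_le_lintegral₀ (μ := Measure.pi ν)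
      (((meas_form a (fun b => Q b j)).pow_const (2 * m)).ennreal_ofReal).aemeasurable
      (ENNReal.ofReal (t ^ (2 * m)))
    have hsub : {V : ∀ i, Matrix (Fin (q i)) (Fin (q i)) ℝ | t < |(kronFamily V * Q) a j|} ⊆
        {V | ENNReal.ofReal (t ^ (2 * m)) ≤ ENNReal.ofReal
          ((∑ b : ∀ i, Fin (q i), (∏ i, V i (a i) (b i)) * Q b j) ^ (2 * m))} := by
      intro V hV
      simp only [Set.mem_ofPred_eq, Matrix.mul_apply, kronFamily, Matrix.of_apply] at hV ⊢
      refine ENNReal.ofReal_le_ofReal ?_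
      rw [← (even_two_mul m).pow_abs (∑ b : ∀ i, Fin (q i), (∏ i, V i (a i) (b i)) * Q b j)]
      gcongr
    have h1 : ENNReal.ofReal (t ^ (2 * m)) * Measure.pi ν {V | t < |(kronFamily V * Q) a j|}
        ≤ ENNReal.ofReal (t ^ (2 * m)) * ENNReal.ofReal (δ / (n : ℝ) ^ 2) := by
      calc _ ≤ _ := by gcongr
        _ ≤ _ := hmark
        _ ≤ _ := hmom
        _ ≤ _ := by
          rw [← ENNReal.ofReal_mul (by positivity)]
          refine ENNReal.ofReal_le_ofReal ?_
          rw [ht2, div_mul_eq_mul_div]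
          gcongr
          rw [mul_comm (_ ^ (k * m))]
          exact hnum
    exact (ENNReal.mul_le_mul_iff_right (by
      rw [Ne, ENNReal.ofReal_eq_zero, not_le]; positivity) ENNReal.ofReal_ne_top).1 h1
  have hae : ∀ᵐ V ∂(Measure.pi ν), ∀ i, V i * (V i)ᵀ = 1 := by
    rw [ae_all_iff]
    intro i
    exact Measure.tendsto_eval_ae_ae.eventually (haar_ae (hν i))
  have hsub : {V : ∀ i, Matrix (Fin (q i)) (Fin (q i)) ℝ |
        ¬ IncoherentH (kronFamily V * H * (kronFamily V)ᵀ) μ} ⊆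
      {V | ¬ ∀ i, V i * (V i)ᵀ = 1} ∪
        ⋃ a, ⋃ j, {V | t < |(kronFamily V * Q) a j|} := by
    intro V hV
    by_contra hcon
    simp only [Set.mem_union, Set.mem_iUnion, Set.mem_ofPred_eq, not_or, not_not, not_exists,
      not_lt] at hcon
    refine hV ⟨kronFamily V * Q, Λ, ?_, hΛ, ?_, hcon.2⟩
    · rw [Matrix.transpose_mul, Matrix.mul_assoc, ← Matrix.mul_assoc Q, hQ, Matrix.one_mul,
        kron_orth V hcon.1]
    · rw [hHQ, Matrix.transpose_mul]
      simp only [Matrix.mul_assoc]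
  calc _ ≤ _ := measure_mono hsub
    _ ≤ _ := measure_union_le _ _
    _ = Measure.pi ν (⋃ a, ⋃ j, {V | t < |(kronFamily V * Q) a j|}) := by
        rw [show Measure.pi ν {V | ¬ ∀ i, V i * (V i)ᵀ = 1} = 0 from hae, zero_add]
    _ ≤ ∑ a : ∀ i, Fin (q i), ∑ j : ∀ i, Fin (q i),
          Measure.pi ν {V | t < |(kronFamily V * Q) a j|} :=
        (measure_iUnion_fintype_le _ _).trans
          (Finset.sum_le_sum fun a _ => measure_iUnion_fintype_le _ _)
    _ ≤ ∑ a : ∀ i, Fin (q i), ∑ j : ∀ i, Fin (q i), ENNReal.ofReal (δ / (n : ℝ) ^ 2) :=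
        Finset.sum_le_sum fun a _ => Finset.sum_le_sum fun j _ => hone a j
    _ = ENNReal.ofReal δ := by
        simp only [Finset.sum_const, Finset.card_univ, ← hn, nsmul_eq_mul]
        rw [← ENNReal.ofReal_natCast, ← ENNReal.ofReal_mul hnR.le, ← ENNReal.ofReal_mul hnR.le]
        congr 1
        field_simp
end

section
/- Let W ∈ ℝ^{m×n} with m = p_1·p_2···p_k and n = q_1·q_2···q_k, and let U_1, …, U_k, V_1, …, V_k be independent Haar-uniform random orthogonal matrices with U_i ∈ ℝ^{p_i×p_i} and V_i ∈ ℝ^{q_i×q_i}; set U = U_1 ⊗ ⋯ ⊗ U_k and V = V_1 ⊗ ⋯ ⊗ V_k. Then there exist global constants A and C, independent of m, n and k, such that for every δ ∈ (0,1], with probability at least 1 − δ the matrix U W V^T is μ_W-incoherent with μ_W = A^k·(log(2Ckmn/δ))^k. -/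
open MeasureTheory Matrix

/-- A matrix `W ∈ ℝ^{m×n}` is `μc`-incoherent if
`|W i j| ≤ μc ‖W‖_F / √(mn)` for all `i, j`. -/
def IncoherentW {ι κ : Type*} [Fintype ι] [Fintype κ]
    (W : Matrix ι κ ℝ) (μc : ℝ) : Prop :=
  ∀ i j, |W i j| ≤
    μc * Real.sqrt (∑ i', ∑ j', W i' j' ^ 2) /
      Real.sqrt ((Fintype.card ι : ℝ) * (Fintype.card κ : ℝ))

namespace KronInc

/-- sign of a Boolean -/
noncomputable def sg (b : Bool) : ℝ := if b then 1 else -1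

lemma sg_sq (b : Bool) : sg b ^ 2 = 1 := by cases b <;> simp [sg]

lemma sum_exp_signs {d : ℕ} (u : Fin d → ℝ) (l : ℝ) (hu : ∑ i, u i ^ 2 = 1) :
    ∑ e : Fin d → Bool, Real.exp (l * ∑ i, u i * sg (e i)) ≤ 2 ^ d * Real.exp (l ^ 2 / 2) := by
  have h1 : ∀ e : Fin d → Bool, Real.exp (l * ∑ i, u i * sg (e i)) =
      ∏ i, Real.exp (l * (u i * sg (e i))) := by
    intro e
    rw [Finset.mul_sum, Real.exp_sum]
  simp_rw [h1]
  have h2 := Finset.prod_univ_sum (fun _ : Fin d => (Finset.univ : Finset Bool))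
    (fun i b => Real.exp (l * (u i * sg b)))
  rw [Fintype.piFinset_univ] at h2
  rw [← h2]
  have h3 : ∀ i, ∑ b : Bool, Real.exp (l * (u i * sg b)) ≤ 2 * Real.exp (l ^ 2 / 2 * u i ^ 2) := by
    intro i
    have := Real.cosh_le_exp_half_sq (l * u i)
    rw [Real.cosh_eq] at this
    simp only [Fintype.sum_bool, sg]
    simp only [if_true, mul_one, mul_neg, Bool.false_eq_true, if_false]
    have e : (l * u i) ^ 2 / 2 = l ^ 2 / 2 * u i ^ 2 := by ring
    rw [e] at this
    linarith
  refine (Finset.prod_le_prod (fun i _ => by positivity) (fun i _ => h3 i)).trans ?_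
  rw [Finset.prod_mul_distrib, ← Real.exp_sum, ← Finset.mul_sum, hu]
  simp

lemma khintchine {d : ℕ} (u : Fin d → ℝ) (hu : ∑ i, u i ^ 2 = 1) (r : ℕ) (hr : 1 ≤ r) :
    ∑ e : Fin d → Bool, (∑ i, u i * sg (e i)) ^ (2 * r) ≤ 2 ^ d * (2 * r : ℝ) ^ r := by
  have hr' : (1 : ℝ) ≤ r := by exact_mod_cast hr
  set l := Real.sqrt (2 * r) with hl
  have hl2 : l ^ 2 = 2 * r := Real.sq_sqrt (by positivity)
  have hlpos : 0 < l := Real.sqrt_pos.2 (by positivity)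
  have key : ∀ x : ℝ, x ^ (2 * r) ≤ (2 * r : ℝ) ^ r * Real.exp (-(2 * r)) *
      (Real.exp (l * x) + Real.exp (-l * x)) := by
    intro x
    have h1 : l * |x| / (2 * r) ≤ Real.exp (l * |x| / (2 * r) - 1) := by
      have := Real.add_one_le_exp (l * |x| / (2 * r) - 1)
      linarith
    have h2 := pow_le_pow_left₀ (by positivity) h1 (2 * r)
    rw [← Real.exp_nat_mul] at h2
    have e1 : ((2 * r : ℕ) : ℝ) * (l * |x| / (2 * r) - 1) = -(2 * r) + l * |x| := by
      push_cast; field_simp; ring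
    rw [e1, Real.exp_add] at h2
    have e2 : (l * |x| / (2 * r)) ^ (2 * r) = x ^ (2 * r) / (2 * r : ℝ) ^ r := by
      rw [pow_mul, div_pow, mul_pow, hl2, sq_abs, pow_mul x, ← div_pow]
      congr 1
      field_simp
    rw [e2, div_le_iff₀ (by positivity)] at h2
    have h3 : Real.exp (l * |x|) ≤ Real.exp (l * x) + Real.exp (-l * x) := by
      rcases abs_cases x with ⟨h, _⟩ | ⟨h, _⟩ <;> rw [h]
      · linarith [Real.exp_pos (-l * x)]
      · have : l * -x = -l * x := by ring
        rw [this]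
        linarith [Real.exp_pos (l * x)]
    calc x ^ (2 * r) ≤ _ := h2
      _ = (2 * r : ℝ) ^ r * Real.exp (-(2 * r)) * Real.exp (l * |x|) := by ring
      _ ≤ _ := by gcongr
  refine (Finset.sum_le_sum (fun e _ => key _)).trans ?_
  rw [← Finset.mul_sum, Finset.sum_add_distrib]
  have a1 := sum_exp_signs u l hu
  have a2 := sum_exp_signs u (-l) hu
  rw [neg_sq] at a2
  rw [hl2] at a1 a2
  have e3 : (2 * r : ℝ) / 2 = r := by ring
  rw [e3] at a1 a2
  have h4 : Real.exp (-(2 * r)) * (2 * Real.exp r) ≤ 1 := by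
    have : Real.exp (-(2 * r : ℝ)) = Real.exp (-r) * Real.exp (-r) := by
      rw [← Real.exp_add]; ring_nf
    rw [this, Real.exp_neg]
    have h5 : 2 ≤ Real.exp r := by linarith [Real.add_one_le_exp (r : ℝ)]
    have h6 := Real.exp_pos (r : ℝ)
    field_simp
    exact h5
  calc _ ≤ (2 * r : ℝ) ^ r * Real.exp (-(2 * r)) * (2 ^ d * Real.exp r + 2 ^ d * Real.exp r) := by
        gcongr
    _ = 2 ^ d * (2 * r : ℝ) ^ r * (Real.exp (-(2 * r)) * (2 * Real.exp r)) := by ring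
    _ ≤ 2 ^ d * (2 * r : ℝ) ^ r * 1 := by gcongr
    _ = _ := by ring

lemma exists_reflect {d : ℕ} (x y : Fin d → ℝ) (h : ∑ i, x i ^ 2 = ∑ i, y i ^ 2) :
    ∃ O : Matrix (Fin d) (Fin d) ℝ, O * Oᵀ = 1 ∧ x ᵥ* O = y := by
  set v := x - y with hv
  by_cases hv0 : v ⬝ᵥ v = 0
  · have : v = 0 := dotProduct_self_eq_zero.1 hv0
    refine ⟨1, by simp, ?_⟩
    rw [Matrix.vecMul_one]
    exact sub_eq_zero.1 this
  · have hx : x ⬝ᵥ v = (v ⬝ᵥ v) / 2 := by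
      have h' : x ⬝ᵥ x = y ⬝ᵥ y := by simpa [dotProduct, sq] using h
      simp only [hv, dotProduct_sub, sub_dotProduct, dotProduct_comm y x]
      linarith
    refine ⟨1 - (2 / (v ⬝ᵥ v)) • Matrix.vecMulVec v v, ?_, ?_⟩
    · simp only [Matrix.transpose_sub, Matrix.transpose_one, Matrix.transpose_smul,
        Matrix.transpose_vecMulVec, sub_mul, mul_sub, one_mul, mul_one, Matrix.smul_mul,
        Matrix.mul_smul, Matrix.vecMulVec_mul_vecMulVec, smul_smul]
      ext i j
      simp [Matrix.vecMulVec_apply]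
      field_simp
      ring
    · ext i
      simp [Matrix.vecMul_sub, Matrix.vecMul_smul, Matrix.vecMul_vecMulVec, hx]
      field_simp
      simp [hv]


lemma measurable_entry {q : ℕ} (i j : Fin q) :
    Measurable (fun V : Matrix (Fin q) (Fin q) ℝ => V i j) := by
  have h1 : Measurable (fun V : Fin q → Fin q → ℝ => V i j) := by fun_prop
  exact h1

lemma measurable_mat {α : Type*} [MeasurableSpace α] {q : ℕ}
    {f : α → Matrix (Fin q) (Fin q) ℝ} (h : ∀ i j, Measurable (fun x => f x i j)) :
    Measurable f := by
  have h1 : Measurable (fun x => (fun i j => f x i j : Fin q → Fin q → ℝ)) :=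
    measurable_pi_iff.2 fun i => measurable_pi_iff.2 fun j => h i j
  exact h1

lemma measurable_lmul {q : ℕ} (O : Matrix (Fin q) (Fin q) ℝ) :
    Measurable (fun V : Matrix (Fin q) (Fin q) ℝ => O * V) := by
  refine measurable_mat fun i j => ?_
  simp only [Matrix.mul_apply]
  exact Finset.measurable_sum _ fun l _ => (measurable_entry l j).const_mul _

lemma haar_ae {q : ℕ} {ν : Measure (Matrix (Fin q) (Fin q) ℝ)} (h : IsHaarOrthogonal ν) :
    ∀ᵐ V ∂ν, V * Vᵀ = 1 := by
  have := h.1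
  have hm : MeasurableSet {V : Matrix (Fin q) (Fin q) ℝ | V * Vᵀ = 1} := by
    have : {V : Matrix (Fin q) (Fin q) ℝ | V * Vᵀ = 1} =
        ⋂ i, ⋂ j, {V | (V * Vᵀ) i j = (1 : Matrix (Fin q) (Fin q) ℝ) i j} := by
      ext V
      simp only [Set.mem_ofPred_eq, Set.mem_iInter]
      exact ⟨fun h i j => by rw [h], fun h => Matrix.ext h⟩
    rw [this]
    refine MeasurableSet.iInter fun i => MeasurableSet.iInter fun j => ?_
    refine measurableSet_eq_fun ?_ measurable_const
    simp only [Matrix.mul_apply, Matrix.transpose_apply]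
    exact Finset.measurable_sum _ fun l _ => (measurable_entry i l).mul (measurable_entry j l)
  exact (prob_compl_eq_zero_iff hm).2 h.2.1

lemma haar_left {q : ℕ} {ν : Measure (Matrix (Fin q) (Fin q) ℝ)} (h : IsHaarOrthogonal ν)
    (O : Matrix (Fin q) (Fin q) ℝ) (hO : O * Oᵀ = 1)
    (g : Matrix (Fin q) (Fin q) ℝ → ENNReal) (hg : Measurable g) :
    ∫⁻ V, g (O * V) ∂ν = ∫⁻ V, g V ∂ν := by
  conv_rhs => rw [← h.2.2 O hO]
  rw [lintegral_map hg (measurable_lmul O)]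

lemma haar_transpose {q : ℕ} {ν : Measure (Matrix (Fin q) (Fin q) ℝ)} (h : IsHaarOrthogonal ν)
    (g : Matrix (Fin q) (Fin q) ℝ → ENNReal) (hg : Measurable g) :
    ∫⁻ V, g Vᵀ ∂ν = ∫⁻ V, g V ∂ν := by
  have := h.1
  have hT : Measurable (fun V : Matrix (Fin q) (Fin q) ℝ => Vᵀ) :=
    measurable_mat fun i j => measurable_entry j i
  have hjoint : Measurable (Function.uncurry
      (fun O V : Matrix (Fin q) (Fin q) ℝ => g (Oᵀ * V))) := by
    refine hg.comp (measurable_mat fun i j => ?_)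
    simp only [Matrix.mul_apply, Matrix.transpose_apply]
    exact Finset.measurable_sum _ fun l _ =>
      ((measurable_entry l i).comp measurable_fst).mul ((measurable_entry l j).comp measurable_snd)
  have hA : ∫⁻ O, ∫⁻ V, g (Oᵀ * V) ∂ν ∂ν = ∫⁻ V, g V ∂ν := by
    have : ∀ᵐ O ∂ν, ∫⁻ V, g (Oᵀ * V) ∂ν = ∫⁻ V, g V ∂ν := by
      filter_upwards [haar_ae h] with O hO
      refine haar_left h Oᵀ ?_ g hg
      rw [Matrix.transpose_transpose]
      exact mul_eq_one_comm.1 hO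
    rw [lintegral_congr_ae this]
    simp
  have hB : ∫⁻ V, ∫⁻ O, g (Oᵀ * V) ∂ν ∂ν = ∫⁻ V, g Vᵀ ∂ν := by
    have : ∀ᵐ V ∂ν, ∫⁻ O, g (Oᵀ * V) ∂ν = ∫⁻ O, g Oᵀ ∂ν := by
      filter_upwards [haar_ae h] with V hV
      have := haar_left h Vᵀ (by rw [Matrix.transpose_transpose]; exact mul_eq_one_comm.1 hV)
        (fun O => g Oᵀ) (hg.comp hT)
      simpa [Matrix.transpose_mul] using this
    rw [lintegral_congr_ae this]
    simp
  rw [← hA, ← hB]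
  exact lintegral_lintegral_swap hjoint.aemeasurable |>.symm

lemma measurable_rowsum {q : ℕ} (a : Fin q) (t : Fin q → ℝ) :
    Measurable (fun V : Matrix (Fin q) (Fin q) ℝ => ∑ j, V a j * t j) :=
  Finset.measurable_sum _ fun l _ => (measurable_entry a l).mul_const _

/-- The law of `⟨row a of V, t⟩` only depends on the norm of `t`. -/
lemma haar_row_eq {q : ℕ} {ν : Measure (Matrix (Fin q) (Fin q) ℝ)} (h : IsHaarOrthogonal ν)
    (a : Fin q) (s t : Fin q → ℝ) (hst : ∑ i, s i ^ 2 = ∑ i, t i ^ 2)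
    (g : ℝ → ENNReal) (hg : Measurable g) :
    ∫⁻ V, g (∑ j, V a j * s j) ∂ν = ∫⁻ V, g (∑ j, V a j * t j) ∂ν := by
  have hc : ∀ t : Fin q → ℝ, Measurable
      (fun V : Matrix (Fin q) (Fin q) ℝ => g (∑ j, V j a * t j)) := fun t =>
    hg.comp (Finset.measurable_sum _ fun l _ => (measurable_entry l a).mul_const _)
  obtain ⟨O, hO, hOs⟩ := exists_reflect s t hst
  have h1 : ∀ t : Fin q → ℝ, ∫⁻ V, g (∑ j, V a j * t j) ∂ν = ∫⁻ V, g (∑ j, V j a * t j) ∂ν :=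
    fun t => haar_transpose h (fun V => g (∑ j, V j a * t j)) (hc t)
  rw [h1, h1, ← haar_left h O hO _ (hc s)]
  refine lintegral_congr fun V => ?_
  congr 1
  have : ∑ j, (O * V) j a * s j = (s ᵥ* (O * V)) a := by
    simp [Matrix.vecMul, dotProduct, mul_comm]
  rw [this, ← Matrix.vecMul_vecMul, hOs]
  simp [Matrix.vecMul, dotProduct, mul_comm]

lemma haar_moment {q : ℕ} {ν : Measure (Matrix (Fin q) (Fin q) ℝ)} (h : IsHaarOrthogonal ν)
    (a : Fin q) (t : Fin q → ℝ) (r : ℕ) (hr : 1 ≤ r) :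
    ∫⁻ V, ENNReal.ofReal ((∑ j, V a j * t j) ^ (2 * r)) ∂ν ≤
      ENNReal.ofReal ((2 * r / q : ℝ) ^ r * (∑ j, t j ^ 2) ^ r) := by
  have := h.1
  have hq : 0 < q := Fin.pos a
  have hq' : (0 : ℝ) < q := by exact_mod_cast hq
  have hg : Measurable (fun x : ℝ => ENNReal.ofReal (x ^ (2 * r))) := by fun_prop
  -- normalized case
  have norm : ∀ t : Fin q → ℝ, ∑ j, t j ^ 2 = q →
      ∫⁻ V, ENNReal.ofReal ((∑ j, V a j * t j) ^ (2 * r)) ∂ν ≤ ENNReal.ofReal ((2 * r : ℝ) ^ r) := by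
    intro t ht
    have h1 : ∀ e : Fin q → Bool, ∫⁻ V, ENNReal.ofReal ((∑ j, V a j * t j) ^ (2 * r)) ∂ν =
        ∫⁻ V, ENNReal.ofReal ((∑ j, V a j * sg (e j)) ^ (2 * r)) ∂ν := fun e =>
      haar_row_eq h a t (fun j => sg (e j)) (by simp [sg_sq, ht]) _ hg
    have h2 : ∑ e : Fin q → Bool, ∫⁻ V, ENNReal.ofReal ((∑ j, V a j * t j) ^ (2 * r)) ∂ν ≤
        ENNReal.ofReal (2 ^ q * (2 * r : ℝ) ^ r) := by
      rw [Finset.sum_congr rfl (fun e _ => h1 e), ← lintegral_finsetSum]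
      · have : ∀ᵐ V ∂ν, ∑ e : Fin q → Bool, ENNReal.ofReal ((∑ j, V a j * sg (e j)) ^ (2 * r)) ≤
            ENNReal.ofReal (2 ^ q * (2 * r : ℝ) ^ r) := by
          filter_upwards [haar_ae h] with V hV
          rw [← ENNReal.ofReal_sum_of_nonneg]
          · refine ENNReal.ofReal_le_ofReal (khintchine (fun j => V a j) ?_ r hr)
            have := congrFun (congrFun hV a) a
            simpa [Matrix.mul_apply, sq] using this
          · intro e _
            exact (even_two_mul r).pow_nonneg _
        refine (lintegral_mono_ae this).trans ?_
        simp
      · intro e _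
        exact hg.comp (measurable_rowsum a _)
    rw [Finset.sum_const, nsmul_eq_mul] at h2
    simp only [Finset.card_univ, Fintype.card_pi, Fintype.card_bool, Finset.prod_const,
      Fintype.card_fin] at h2
    rw [ENNReal.ofReal_mul (by positivity), ENNReal.ofReal_pow (by norm_num)] at h2
    simp only [Nat.cast_pow, Nat.cast_ofNat, ENNReal.ofReal_ofNat] at h2
    exact (ENNReal.mul_le_mul_iff_right (by simp) (by simp)).1 h2
  -- general case by scaling
  by_cases hS : ∑ j, t j ^ 2 = 0
  · have : t = 0 := by
      rw [Finset.sum_eq_zero_iff_of_nonneg (fun i _ => sq_nonneg _)] at hS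
      ext i
      simpa using hS i (Finset.mem_univ i)
    subst this
    have : r ≠ 0 := by omega
    simp [this]
  · set S := ∑ j, t j ^ 2 with hSdef
    have hSpos : 0 < S := lt_of_le_of_ne (Finset.sum_nonneg fun i _ => sq_nonneg _) (Ne.symm hS)
    set c := Real.sqrt (S / q) with hc
    have hc2 : c ^ 2 = S / q := Real.sq_sqrt (by positivity)
    have hcpos : 0 < c := Real.sqrt_pos.2 (by positivity)
    have hn := norm (fun j => t j / c) (by
      simp only [div_pow, ← Finset.sum_div, ← hSdef, hc2]
      field_simp)
    have e : ∀ V : Matrix (Fin q) (Fin q) ℝ, ENNReal.ofReal ((∑ j, V a j * t j) ^ (2 * r)) =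
        ENNReal.ofReal ((S / q) ^ r) * ENNReal.ofReal ((∑ j, V a j * (t j / c)) ^ (2 * r)) := by
      intro V
      rw [← ENNReal.ofReal_mul (by positivity)]
      congr 1
      simp only [← mul_div_assoc, ← Finset.sum_div]
      rw [div_pow _ c, pow_mul c, hc2]
      have : (S / q) ^ r ≠ 0 := by positivity
      field_simp
    have hM : Measurable (fun V : Matrix (Fin q) (Fin q) ℝ =>
        ENNReal.ofReal ((∑ j, V a j * (t j / c)) ^ (2 * r))) :=
      hg.comp (measurable_rowsum a _)
    simp_rw [e]
    rw [lintegral_const_mul _ hM]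
    refine (mul_le_mul_right hn _).trans ?_
    rw [← ENNReal.ofReal_mul (by positivity)]
    refine ENNReal.ofReal_le_ofReal (le_of_eq ?_)
    rw [← mul_pow, ← mul_pow]
    congr 1
    ring

/-- Moment bound predicate: a random vector `x` with
`E (∑_j (∑_c x_c T_{c j})²)^r ≤ B ‖T‖_F^{2r}` for every matrix `T`. -/
structure Mom {Ω : Type} [MeasurableSpace Ω] (μ : Measure Ω) {ι : Type} [Fintype ι]
    (x : Ω → ι → ℝ) (r : ℕ) (B : ℝ) : Prop where
  meas : ∀ c, Measurable (fun ω => x ω c)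
  nonneg : 0 ≤ B
  bound : ∀ (J : Type) [Fintype J] (T : ι → J → ℝ),
    ∫⁻ ω, ENNReal.ofReal ((∑ j, (∑ c, x ω c * T c j) ^ 2) ^ r) ∂μ ≤
      ENNReal.ofReal (B * (∑ c, ∑ j, T c j ^ 2) ^ r)

lemma jensen {J : Type} [Fintype J] (w z : J → ℝ) (hw : ∀ j, 0 ≤ w j) (hz : ∀ j, 0 ≤ z j)
    (hwz : ∀ j, w j = 0 → z j = 0) (hS : 0 < ∑ j, w j) (r : ℕ) :
    (∑ j, z j) ^ r ≤ ∑ j, (w j / ∑ i, w i) * ((∑ i, w i) / w j) ^ r * z j ^ r := by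
  set S := ∑ i, w i with hSd
  have := Real.pow_arith_mean_le_arith_mean_pow Finset.univ (fun j => w j / S)
    (fun j => S / w j * z j) (fun j _ => div_nonneg (hw j) hS.le)
    (by rw [← Finset.sum_div]; exact div_self hS.ne')
    (fun j _ => mul_nonneg (div_nonneg hS.le (hw j)) (hz j)) r
  have e : ∀ j, w j / S * (S / w j * z j) = z j := by
    intro j
    by_cases h0 : w j = 0
    · simp [h0, hwz j h0]
    · field_simp
  simp only [e, mul_pow, ← mul_assoc] at this
  exact this

lemma mom_haar {q : ℕ} {ν : Measure (Matrix (Fin q) (Fin q) ℝ)} (h : IsHaarOrthogonal ν)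
    (a : Fin q) (r : ℕ) (hr : 1 ≤ r) :
    Mom ν (fun V c => V a c) r ((2 * r / q : ℝ) ^ r) where
  meas c := measurable_entry a c
  nonneg := by positivity
  bound J _ T := by
    set w : J → ℝ := fun j => ∑ c, T c j ^ 2 with hw
    have hwn : ∀ j, 0 ≤ w j := fun j => Finset.sum_nonneg fun i _ => sq_nonneg _
    have hSeq : ∑ c, ∑ j, T c j ^ 2 = ∑ j, w j := Finset.sum_comm
    rw [hSeq]
    have hT0 : ∀ j, w j = 0 → ∀ c, T c j = 0 := by
      intro j hj c
      rw [hw] at hj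
      simp only at hj
      rw [Finset.sum_eq_zero_iff_of_nonneg (fun i _ => sq_nonneg _)] at hj
      simpa using hj c (Finset.mem_univ c)
    rcases (Finset.sum_nonneg fun j _ => hwn j : 0 ≤ ∑ j, w j).eq_or_lt with hS | hS
    · have : ∀ j, w j = 0 := by
        have := (Finset.sum_eq_zero_iff_of_nonneg (fun j _ => hwn j)).1 hS.symm
        exact fun j => this j (Finset.mem_univ j)
      have hT : ∀ c j, T c j = 0 := fun c j => hT0 j (this j) c
      have : r ≠ 0 := by omega
      simp [hT, this]
    · set S := ∑ j, w j with hSd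
      set k : J → ℝ := fun j => (w j / S) * (S / w j) ^ r with hk
      have hkn : ∀ j, 0 ≤ k j := fun j => mul_nonneg (div_nonneg (hwn j) hS.le)
        (pow_nonneg (div_nonneg hS.le (hwn j)) _)
      have hmeas : ∀ j, Measurable (fun V : Matrix (Fin q) (Fin q) ℝ =>
          ENNReal.ofReal ((∑ c, V a c * T c j) ^ (2 * r))) := fun j =>
        ((measurable_rowsum a fun c => T c j).pow_const _).ennreal_ofReal
      have h1 : ∀ V : Matrix (Fin q) (Fin q) ℝ,
          ENNReal.ofReal ((∑ j, (∑ c, V a c * T c j) ^ 2) ^ r) ≤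
          ∑ j, ENNReal.ofReal (k j) * ENNReal.ofReal ((∑ c, V a c * T c j) ^ (2 * r)) := by
        intro V
        have := jensen w (fun j => (∑ c, V a c * T c j) ^ 2) hwn (fun j => sq_nonneg _)
          (fun j hj => by simp [hT0 j hj]) hS r
        refine (ENNReal.ofReal_le_ofReal this).trans (le_of_eq ?_)
        rw [ENNReal.ofReal_sum_of_nonneg]
        · refine Finset.sum_congr rfl fun j _ => ?_
          rw [ENNReal.ofReal_mul (hkn j), pow_mul]
        · intro j _
          exact mul_nonneg (hkn j) (pow_nonneg (sq_nonneg _) _)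
      refine (lintegral_mono h1).trans ?_
      rw [lintegral_finsetSum _ (fun j _ => (hmeas j).const_mul _)]
      have h2 : ∀ j, ∫⁻ V, ENNReal.ofReal (k j) * ENNReal.ofReal ((∑ c, V a c * T c j) ^ (2 * r)) ∂ν
          ≤ ENNReal.ofReal ((w j / S) * ((2 * r / q : ℝ) ^ r * S ^ r)) := by
        intro j
        rw [lintegral_const_mul _ (hmeas j)]
        refine (mul_le_mul_right (haar_moment h a (fun c => T c j) r hr) _).trans ?_
        rw [← ENNReal.ofReal_mul (hkn j)]
        refine ENNReal.ofReal_le_ofReal (le_of_eq ?_)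
        change w j / S * (S / w j) ^ r * ((2 * r / q : ℝ) ^ r * (w j) ^ r) = _
        by_cases h0 : w j = 0
        · simp [h0]
        · rw [div_pow]; field_simp
      refine (Finset.sum_le_sum fun j _ => h2 j).trans ?_
      rw [← ENNReal.ofReal_sum_of_nonneg]
      · rw [← Finset.sum_mul, ← Finset.sum_div, ← hSd, div_self hS.ne', one_mul]
      · intro j _
        exact mul_nonneg (div_nonneg (hwn j) hS.le) (by positivity)

lemma Mom.measurable_form {Ω : Type} [MeasurableSpace Ω] {ι : Type} [Fintype ι]
    {x : Ω → ι → ℝ} (hx : ∀ c, Measurable (fun ω => x ω c)) {J : Type} [Fintype J]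
    (T : ι → J → ℝ) (r : ℕ) :
    Measurable (fun ω => ENNReal.ofReal ((∑ j, (∑ c, x ω c * T c j) ^ 2) ^ r)) := by
  refine Measurable.ennreal_ofReal (Measurable.pow_const ?_ _)
  refine Finset.measurable_sum _ fun j _ => Measurable.pow_const ?_ _
  exact Finset.measurable_sum _ fun c _ => (hx c).mul_const _

lemma Mom.prod {Ω Ω' : Type} [MeasurableSpace Ω] [MeasurableSpace Ω'] {μ : Measure Ω}
    {ν : Measure Ω'} [SFinite μ] [SFinite ν] {ι κ : Type} [Fintype ι] [Fintype κ]
    {x : Ω → ι → ℝ} {y : Ω' → κ → ℝ} {r : ℕ} {B B' : ℝ}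
    (hx : Mom μ x r B) (hy : Mom ν y r B') :
    Mom (μ.prod ν) (fun ω (c : ι × κ) => x ω.1 c.1 * y ω.2 c.2) r (B * B') where
  meas c := ((hx.meas c.1).comp measurable_fst).mul ((hy.meas c.2).comp measurable_snd)
  nonneg := mul_nonneg hx.nonneg hy.nonneg
  bound J _ T := by
    have hm : ∀ c : ι × κ, Measurable (fun ω : Ω × Ω' => x ω.1 c.1 * y ω.2 c.2) := fun c =>
      ((hx.meas c.1).comp measurable_fst).mul ((hy.meas c.2).comp measurable_snd)
    rw [lintegral_prod _ (Mom.measurable_form hm T r).aemeasurable]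
    have h1 : ∀ ω : Ω, ∫⁻ ω', ENNReal.ofReal
        ((∑ j, (∑ c : ι × κ, x ω c.1 * y ω' c.2 * T c j) ^ 2) ^ r) ∂ν ≤
        ENNReal.ofReal B' * ENNReal.ofReal
          ((∑ dj : κ × J, (∑ c, x ω c * T (c, dj.1) dj.2) ^ 2) ^ r) := by
      intro ω
      have := hy.bound J (fun d j => ∑ c, x ω c * T (c, d) j)
      rw [← ENNReal.ofReal_mul hy.nonneg, Fintype.sum_prod_type]
      refine le_trans (le_of_eq ?_) this
      refine lintegral_congr fun ω' => ?_
      congr 2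
      refine Finset.sum_congr rfl fun j _ => ?_
      congr 1
      rw [Fintype.sum_prod_type, Finset.sum_comm]
      refine Finset.sum_congr rfl fun d _ => ?_
      rw [Finset.mul_sum]
      refine Finset.sum_congr rfl fun c _ => ?_
      ring
    refine (lintegral_mono h1).trans ?_
    rw [lintegral_const_mul _
      (Mom.measurable_form hx.meas (fun c (dj : κ × J) => T (c, dj.1) dj.2) r)]
    refine (mul_le_mul_right (hx.bound (κ × J) (fun c dj => T (c, dj.1) dj.2)) _).trans ?_
    rw [← ENNReal.ofReal_mul hy.nonneg]
    refine ENNReal.ofReal_le_ofReal (le_of_eq ?_)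
    simp only [Fintype.sum_prod_type]
    ring

lemma Mom.pi : ∀ (k : ℕ) (Ω ι : Fin k → Type) [∀ i, MeasurableSpace (Ω i)] [∀ i, Fintype (ι i)]
    (μ : ∀ i, Measure (Ω i)) (_ : ∀ i, IsProbabilityMeasure (μ i))
    (x : ∀ i, Ω i → ι i → ℝ) (r : ℕ) (B : Fin k → ℝ) (_ : ∀ i, Mom (μ i) (x i) r (B i)),
    Mom (Measure.pi μ) (fun (ω : ∀ i, Ω i) (c : ∀ i, ι i) => ∏ i, x i (ω i) (c i)) r (∏ i, B i) := by
  intro k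
  induction k with
  | zero =>
    intro Ω ι _ _ μ hμ x r B h
    refine ⟨fun c => by simp, by simp, fun J _ T => ?_⟩
    simp
  | succ k ih =>
    intro Ω ι _ _ μ hμ x r B h
    have h1 := ih (fun i => Ω i.succ) (fun i => ι i.succ) (fun i => μ i.succ) (fun i => hμ _)
      (fun i => x i.succ) r (fun i => B i.succ) (fun i => h _)
    have h2 := (h 0).prod h1
    have hm : ∀ c : ∀ i, ι i, Measurable (fun ω : ∀ i, Ω i => ∏ i, x i (ω i) (c i)) := fun c =>
      Finset.measurable_prod _ fun i _ => ((h i).meas (c i)).comp (measurable_pi_apply i)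
    refine ⟨hm, Finset.prod_nonneg fun i _ => (h i).nonneg, fun J _ T => ?_⟩
    have h3 := h2.bound J (fun c j => T (Fin.consEquiv ι c) j)
    have hp : MeasurePreserving (fun ω : ∀ i, Ω i => (ω 0, fun i : Fin k => ω i.succ))
        (Measure.pi μ) ((μ 0).prod (Measure.pi fun i : Fin k => μ i.succ)) :=
      measurePreserving_piFinSuccAbove μ 0
    rw [← hp.lintegral_comp (Mom.measurable_form h2.meas _ r)] at h3
    rw [Fin.prod_univ_succ, ← (Fin.consEquiv ι).sum_comp]
    refine le_trans (le_of_eq ?_) h3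
    refine lintegral_congr fun ω => ?_
    congr 2
    refine Finset.sum_congr rfl fun j _ => ?_
    congr 1
    rw [← (Fin.consEquiv ι).sum_comp]
    refine Finset.sum_congr rfl fun c _ => ?_
    rw [Fin.prod_univ_succ]
    rfl

lemma kron_orth {k : ℕ} {q : Fin k → ℕ} (V : ∀ i, Matrix (Fin (q i)) (Fin (q i)) ℝ)
    (h : ∀ i, V i * (V i)ᵀ = 1) : kronFamily V * (kronFamily V)ᵀ = 1 := by
  ext a b
  simp only [Matrix.mul_apply, Matrix.transpose_apply, kronFamily, Matrix.of_apply,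
    ← Finset.prod_mul_distrib]
  have h2 := Finset.prod_univ_sum (fun i : Fin k => (Finset.univ : Finset (Fin (q i))))
    (fun i c => V i (a i) c * V i (b i) c)
  rw [Fintype.piFinset_univ] at h2
  rw [← h2]
  have h3 : ∀ i, ∑ c, V i (a i) c * V i (b i) c = if a i = b i then 1 else 0 := by
    intro i
    have := congrFun (congrFun (h i) (a i)) (b i)
    simpa [Matrix.mul_apply, Matrix.one_apply] using this
  simp only [h3, Matrix.one_apply]
  by_cases hab : a = b
  · subst hab; simp
  · rw [if_neg hab]
    obtain ⟨i, hi⟩ := Function.ne_iff.1 hab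
    exact Finset.prod_eq_zero (Finset.mem_univ i) (if_neg hi)

lemma sum_sq_eq_trace {ι κ : Type} [Fintype ι] [Fintype κ] (X : Matrix ι κ ℝ) :
    ∑ i, ∑ j, X i j ^ 2 = Matrix.trace (X * Xᵀ) := by
  simp [Matrix.trace, Matrix.mul_apply, sq]

lemma frob_inv {ι κ : Type} [Fintype ι] [Fintype κ] [DecidableEq ι] [DecidableEq κ]
    (M : Matrix ι ι ℝ) (N : Matrix κ κ ℝ) (hM : M * Mᵀ = 1) (hN : N * Nᵀ = 1)
    (W : Matrix ι κ ℝ) :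
    ∑ i, ∑ j, (M * W * Nᵀ) i j ^ 2 = ∑ i, ∑ j, W i j ^ 2 := by
  rw [sum_sq_eq_trace, sum_sq_eq_trace]
  have hM' : Mᵀ * M = 1 := mul_eq_one_comm.1 hM
  have hN' : Nᵀ * N = 1 := mul_eq_one_comm.1 hN
  have : M * W * Nᵀ * (M * W * Nᵀ)ᵀ = M * (W * Wᵀ * Mᵀ) := by
    rw [Matrix.transpose_mul, Matrix.transpose_mul, Matrix.transpose_transpose]
    calc M * W * Nᵀ * (N * (Wᵀ * Mᵀ)) = M * W * (Nᵀ * N) * (Wᵀ * Mᵀ) := by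
          simp only [Matrix.mul_assoc]
      _ = _ := by rw [hN']; simp only [Matrix.mul_assoc, Matrix.one_mul]
  rw [this, Matrix.trace_mul_comm, Matrix.mul_assoc, hM', Matrix.mul_one]

lemma Mom.tail {Ω : Type} [MeasurableSpace Ω] {μ : Measure Ω} {ι : Type} [Fintype ι]
    {x : Ω → ι → ℝ} {r : ℕ} {B : ℝ} (h : Mom μ x r B) (T : ι → ℝ) (c : ℝ) (hc : 0 < c) :
    μ {ω | c < |∑ i, x ω i * T i|} ≤
      ENNReal.ofReal (B * (∑ i, T i ^ 2) ^ r / c ^ (2 * r)) := by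
  have h1 := h.bound Unit (fun i _ => T i)
  have hm := Mom.measurable_form h.meas (fun i (_ : Unit) => T i) r
  have h2 := meas_ge_le_lintegral_div (μ := μ) hm.aemeasurable
    (ε := ENNReal.ofReal (c ^ (2 * r))) (by simpa using by positivity) (by simp)
  rw [ENNReal.ofReal_div_of_pos (by positivity)]
  simp only [Finset.univ_unique, Finset.sum_singleton] at h1 h2
  refine le_trans (measure_mono ?_) (h2.trans (ENNReal.div_le_div_right h1 _))
  intro ω hω
  change c < |∑ i, x ω i * T i| at hω
  change ENNReal.ofReal (c ^ (2 * r)) ≤ ENNReal.ofReal (((∑ i, x ω i * T i) ^ 2) ^ r)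
  refine ENNReal.ofReal_le_ofReal ?_
  rw [pow_mul, ← sq_abs (∑ i, x ω i * T i)]
  gcongr

lemma entry_eq {k : ℕ} {p q : Fin k → ℕ}
    (W : Matrix (∀ i, Fin (p i)) (∀ i, Fin (q i)) ℝ)
    (U : ∀ i, Matrix (Fin (p i)) (Fin (p i)) ℝ) (V : ∀ i, Matrix (Fin (q i)) (Fin (q i)) ℝ)
    (a : ∀ i, Fin (p i)) (b : ∀ i, Fin (q i)) :
    (kronFamily U * W * (kronFamily V)ᵀ) a b =
      ∑ c : (∀ i, Fin (p i)) × (∀ i, Fin (q i)),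
        ((∏ i, U i (a i) (c.1 i)) * ∏ i, V i (b i) (c.2 i)) * W c.1 c.2 := by
  rw [Fintype.sum_prod_type, Finset.sum_comm]
  simp only [Matrix.mul_apply, Matrix.transpose_apply, kronFamily, Matrix.of_apply, Finset.sum_mul]
  refine Finset.sum_congr rfl fun d _ => Finset.sum_congr rfl fun c _ => ?_
  ring

lemma numeric (k r : ℕ) (hk : 1 ≤ k) (mn δ L : ℝ) (hmn : 1 ≤ mn) (hδ0 : 0 < δ)
    (hL1 : 1 ≤ L) (hL : L = Real.log (4 * k * mn / δ)) (hr : r = ⌈L⌉₊) :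
    ((2 * r : ℝ) ^ k) ^ (2 * r) / (16 ^ k * L ^ k) ^ (2 * r) ≤ δ / mn := by
  have hk' : (1 : ℝ) ≤ k := by exact_mod_cast hk
  have hLr : L ≤ r := hr ▸ Nat.le_ceil L
  have hr2 : (r : ℝ) ≤ 2 * L := by
    have := Nat.ceil_lt_add_one (show 0 ≤ L by linarith)
    rw [← hr] at this
    linarith
  have hr1 : 1 ≤ r := by
    have : (1 : ℝ) ≤ r := hL1.trans hLr
    exact_mod_cast this
  rw [← div_pow, ← mul_pow, ← div_pow, ← pow_mul]
  have h1 : (2 * r : ℝ) / (16 * L) ≤ Real.exp (-1) := by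
    have h2 : (2 * r : ℝ) / (16 * L) ≤ 1 / 4 := by
      rw [div_le_div_iff₀ (by linarith) (by norm_num)]
      linarith
    have h3 : (1 / 4 : ℝ) ≤ Real.exp (-1) := by
      rw [Real.exp_neg, one_div]
      exact inv_anti₀ (Real.exp_pos _) (by linarith [Real.exp_one_lt_d9])
    exact h2.trans h3
  have h4 : ((2 * r : ℝ) / (16 * L)) ^ (k * (2 * r)) ≤ Real.exp (-1) ^ (k * (2 * r)) :=
    pow_le_pow_left₀ (by positivity) h1 _
  refine h4.trans ?_
  have h5 : Real.exp (-1) ^ (k * (2 * r)) ≤ Real.exp (-1) ^ r := by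
    refine pow_le_pow_of_le_one (Real.exp_pos _).le (by simp) ?_
    nlinarith
  refine h5.trans ?_
  rw [← Real.exp_nat_mul]
  have h6 : Real.exp (r * (-1 : ℝ)) ≤ Real.exp (-L) := Real.exp_le_exp.2 (by linarith)
  refine h6.trans ?_
  rw [Real.exp_neg, hL, Real.exp_log (by positivity), inv_div]
  gcongr
  nlinarith

end KronInc

/-- Let `W ∈ ℝ^{m×n}` with `m = p_1⋯p_k`, `n = q_1⋯q_k`, and
let `U = U_1 ⊗ ⋯ ⊗ U_k`, `V = V_1 ⊗ ⋯ ⊗ V_k` with all the `U_i, V_i`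
independent Haar-uniform random orthogonal matrices.  There are global constants
`A, C > 0` independent of `m`, `n` and `k` such that for every `δ ∈ (0,1]`, with
probability at least `1 − δ` the matrix `U W Vᵀ` is `μ_W`-incoherent with
`μ_W = A^k (log(2Ckmn/δ))^k`. -/
theorem kron_orthogonal_incoherence_W :
    ∃ A C : ℝ, 0 < A ∧ 0 < C ∧
      ∀ (k : ℕ) (p q : Fin k → ℕ)
        (W : Matrix (∀ i, Fin (p i)) (∀ i, Fin (q i)) ℝ)
        (νU : ∀ i, Measure (Matrix (Fin (p i)) (Fin (p i)) ℝ))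
        (νV : ∀ i, Measure (Matrix (Fin (q i)) (Fin (q i)) ℝ)),
        (∀ i, IsHaarOrthogonal (νU i)) → (∀ i, IsHaarOrthogonal (νV i)) →
        ∀ δ : ℝ, δ ∈ Set.Ioc (0 : ℝ) 1 →
        (Measure.pi νU).prod (Measure.pi νV)
          {UV | ¬ IncoherentW (kronFamily UV.1 * W * (kronFamily UV.2)ᵀ)
              ((A : ℝ) ^ (k : ℕ) *
                (Real.log (2 * C * k * (Fintype.card (∀ i, Fin (p i)) : ℝ) *
                    (Fintype.card (∀ i, Fin (q i)) : ℝ) / δ)) ^ (k : ℕ))} ≤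
          ENNReal.ofReal δ := by

  refine ⟨16, 2, by norm_num, by norm_num, ?_⟩
  intro k p q W νU νV hU hV δ hδ
  obtain ⟨hδ0, hδ1⟩ := hδ
  have iU : ∀ i, IsProbabilityMeasure (νU i) := fun i => (hU i).1
  have iV : ∀ i, IsProbabilityMeasure (νV i) := fun i => (hV i).1
  have hUo : ∀ᵐ UV ∂((Measure.pi νU).prod (Measure.pi νV)), ∀ i, UV.1 i * (UV.1 i)ᵀ = 1 := by
    refine Measure.quasiMeasurePreserving_fst.ae (p := fun U : (∀ i, Matrix (Fin (p i)) (Fin (p i)) ℝ) => ∀ i, U i * (U i)ᵀ = 1) ?_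
    exact Filter.eventually_all.2 fun i =>
      (Measure.quasiMeasurePreserving_eval νU i).ae (KronInc.haar_ae (hU i))
  have hVo : ∀ᵐ UV ∂((Measure.pi νU).prod (Measure.pi νV)), ∀ i, UV.2 i * (UV.2 i)ᵀ = 1 := by
    refine Measure.quasiMeasurePreserving_snd.ae (p := fun V : (∀ i, Matrix (Fin (q i)) (Fin (q i)) ℝ) => ∀ i, V i * (V i)ᵀ = 1) ?_
    exact Filter.eventually_all.2 fun i =>
      (Measure.quasiMeasurePreserving_eval νV i).ae (KronInc.haar_ae (hV i))
  set m : ℝ := (Fintype.card (∀ i, Fin (p i)) : ℝ) with hm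
  set n : ℝ := (Fintype.card (∀ i, Fin (q i)) : ℝ) with hn
  set L : ℝ := Real.log (2 * 2 * k * m * n / δ) with hL
  set S : ℝ := ∑ i, ∑ j, W i j ^ 2 with hS
  set c : ℝ := (16 : ℝ) ^ k * L ^ k * Real.sqrt S / Real.sqrt (m * n) with hc
  -- reduction to entries
  have hred : (Measure.pi νU).prod (Measure.pi νV)
      {UV | ¬ IncoherentW (kronFamily UV.1 * W * (kronFamily UV.2)ᵀ) ((16 : ℝ) ^ k * L ^ k)} ≤
      (Measure.pi νU).prod (Measure.pi νV)
      (⋃ ab : (∀ i, Fin (p i)) × (∀ i, Fin (q i)),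
        {UV | c < |(kronFamily UV.1 * W * (kronFamily UV.2)ᵀ) ab.1 ab.2|}) := by
    refine measure_mono_ae ?_
    filter_upwards [hUo, hVo] with UV h1 h2 h3
    change ¬ IncoherentW _ _ at h3
    unfold IncoherentW at h3
    rw [KronInc.frob_inv _ _ (KronInc.kron_orth _ h1) (KronInc.kron_orth _ h2)] at h3
    push Not at h3
    obtain ⟨a, b, hab⟩ := h3
    exact Set.mem_iUnion.2 ⟨(a, b), hab⟩
  refine hred.trans ((measure_iUnion_fintype_le _ _).trans ?_)
  -- per-entry bound
  have hent : ∀ ab : (∀ i, Fin (p i)) × (∀ i, Fin (q i)),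
      (Measure.pi νU).prod (Measure.pi νV)
        {UV | c < |(kronFamily UV.1 * W * (kronFamily UV.2)ᵀ) ab.1 ab.2|} ≤
      ENNReal.ofReal (δ / (m * n)) := by
    rintro ⟨a, b⟩
    have hm1 : 1 ≤ m := by
      rw [hm]; exact_mod_cast Fintype.card_pos_iff.2 ⟨a⟩
    have hn1 : 1 ≤ n := by
      rw [hn]; exact_mod_cast Fintype.card_pos_iff.2 ⟨b⟩
    have hmn1 : 1 ≤ m * n := by nlinarith
    have hSn : 0 ≤ S := Finset.sum_nonneg fun i _ => Finset.sum_nonneg fun j _ => sq_nonneg _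
    rcases hSn.eq_or_lt with hS0 | hSpos
    · -- W = 0
      have hW : ∀ i j, W i j = 0 := by
        intro i j
        have h1 := (Finset.sum_eq_zero_iff_of_nonneg (fun i _ =>
          Finset.sum_nonneg fun j _ => sq_nonneg (W i j))).1 hS0.symm i (Finset.mem_univ i)
        have h2 := (Finset.sum_eq_zero_iff_of_nonneg (fun j _ => sq_nonneg (W i j))).1 h1 j
          (Finset.mem_univ j)
        simpa using h2
      have hW0 : W = 0 := by ext i j; exact hW i j
      have hc0 : c = 0 := by rw [hc, ← hS0]; simp
      simp [hW0, hc0]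
    rcases Nat.eq_zero_or_pos k with hk0 | hk
    · subst hk0
      have hm' : m = 1 := by simp [hm]
      have hn' : n = 1 := by simp [hn]
      have hemp : {UV : (∀ i, Matrix (Fin (p i)) (Fin (p i)) ℝ) ×
          (∀ i, Matrix (Fin (q i)) (Fin (q i)) ℝ) |
          c < |(kronFamily UV.1 * W * (kronFamily UV.2)ᵀ) a b|} = ∅ := by
        ext UV
        simp only [Set.mem_ofPred_eq, Set.mem_empty_iff_false, iff_false, not_lt]
        rw [KronInc.entry_eq]
        have hSS : S = W a b ^ 2 := by
          rw [hS, Fintype.sum_eq_single a (fun i hi => (hi (Subsingleton.elim _ _)).elim),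
            Fintype.sum_eq_single b (fun i hi => (hi (Subsingleton.elim _ _)).elim)]
        rw [Fintype.sum_eq_single (a, b) (fun i hi => (hi (Subsingleton.elim _ _)).elim), hc, hm',
          hn', hSS, Real.sqrt_sq_eq_abs]
        simp
      rw [hemp]
      simp
    have hk1 : (1 : ℝ) ≤ k := by exact_mod_cast hk
    have hLe : L = Real.log (4 * k * (m * n) / δ) := by
      rw [hL]; congr 1; ring
    have hL1 : 1 ≤ L := by
      rw [hLe, Real.le_log_iff_exp_le (by positivity)]
      have h1 : (4 : ℝ) ≤ 4 * k * (m * n) / δ := by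
        rw [le_div_iff₀ hδ0]
        nlinarith
      linarith [Real.exp_one_lt_d9]
    set r : ℕ := ⌈L⌉₊ with hr
    have hr1 : 1 ≤ r := Nat.ceil_pos.2 (by linarith)
    have hr0 : (0 : ℝ) < r := by exact_mod_cast hr1
    have hcpos : 0 < c := by
      have := Real.sqrt_pos.2 hSpos
      have : 0 < Real.sqrt (m * n) := Real.sqrt_pos.2 (by linarith)
      positivity
    have M1 := KronInc.Mom.pi k _ _ νU iU (fun i V c => V (a i) c) r _
      (fun i => KronInc.mom_haar (hU i) (a i) r hr1)
    have M2 := KronInc.Mom.pi k _ _ νV iV (fun i V c => V (b i) c) r _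
      (fun i => KronInc.mom_haar (hV i) (b i) r hr1)
    have M := (M1.prod M2).tail (fun c => W c.1 c.2) c hcpos
    simp only [KronInc.entry_eq]
    refine M.trans (ENNReal.ofReal_le_ofReal ?_)
    refine le_trans (le_of_eq ?_) (KronInc.numeric k r hk (m * n) δ L hmn1 hδ0 hL1 hLe hr)
    have em : m = ∏ i, (p i : ℝ) := by rw [hm]; simp
    have en : n = ∏ i, (q i : ℝ) := by rw [hn]; simp
    have e1 : ∏ i, (2 * r / p i : ℝ) ^ r = ((2 * r : ℝ) ^ k / m) ^ r := by
      rw [Finset.prod_pow, Finset.prod_div_distrib, ← em]; simp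
    have e2 : ∏ i, (2 * r / q i : ℝ) ^ r = ((2 * r : ℝ) ^ k / n) ^ r := by
      rw [Finset.prod_pow, Finset.prod_div_distrib, ← en]; simp
    have e3 : c ^ (2 * r) = (16 ^ k * L ^ k) ^ (2 * r) * (S / (m * n)) ^ r := by
      rw [hc, mul_div_assoc, mul_pow]
      congr 1
      rw [pow_mul, div_pow, Real.sq_sqrt hSn, Real.sq_sqrt (by positivity)]
    rw [e1, e2, e3, Fintype.sum_prod_type, ← hS, ← mul_pow, ← mul_pow]
    have e4 : (2 * r : ℝ) ^ k / m * ((2 * r : ℝ) ^ k / n) * S =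
        ((2 * r : ℝ) ^ k) ^ 2 * (S / (m * n)) := by
      field_simp
    rw [e4, mul_pow, ← pow_mul]
    have : (S / (m * n)) ^ r ≠ 0 := by positivity
    rw [mul_div_mul_right _ _ this]
  refine (Finset.sum_le_sum fun ab _ => hent ab).trans ?_
  rw [Finset.sum_const, nsmul_eq_mul, Finset.card_univ, Fintype.card_prod]
  rw [← ENNReal.ofReal_natCast, ← ENNReal.ofReal_mul (by positivity)]
  refine ENNReal.ofReal_le_ofReal ?_
  rw [Nat.cast_mul, ← hm, ← hn]
  by_cases h0 : m * n = 0
  · rw [h0]; simpa using hδ0.le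
  · rw [mul_div_cancel₀ _ h0]
end
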